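/- arXiv:0911.4823 — 8 statements merged into one kernel-verified Lean document; each statement's English description precedes it below -/
import Mathlib

section
/- Let X be a finite list of vectors in ℤ^n whose ℝ-linear span is all of ℝ^n. Then M_X(1,1) equals the Lebesgue volume of the zonotope Z(X). (Equivalently, the volume of Z(X) equals the sum, over all sublists B of X that are bases of ℝ^n, of the absolute value of the determinant of B.) -/
open MeasureTheory

/-- The rank of a sublist `A` of the list `X` of integer vectors: the dimension of the
real span of the corresponding real vectors. -/
noncomputable def rnk {n : ℕ} {ι : Type} [Fintype ι] (X : ι → Fin n → ℤ) (A : Finset ι) : ℕ :=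
  Module.finrank ℝ (Submodule.span ℝ ((fun i (j : Fin n) => (X i j : ℝ)) '' ↑A))

/-- The multiplicity of a sublist `A`: the cardinality of the torsion subgroup of
`ℤ^n / ⟨A⟩`, i.e. the index `[Λ_A : ⟨A⟩]`. -/
noncomputable def mult {n : ℕ} {ι : Type} [Fintype ι] (X : ι → Fin n → ℤ) (A : Finset ι) : ℕ :=
  Nat.card (Submodule.torsion ℤ ((Fin n → ℤ) ⧸ Submodule.span ℤ (X '' ↑A)))

/-- The multiplicity Tutte polynomial `M_X(x,y)`, as a real-valued function. -/
noncomputable def Mpoly {n : ℕ} {ι : Type} [Fintype ι] (X : ι → Fin n → ℤ) (x y : ℝ) : ℝ :=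
  ∑ A : Finset ι, (mult X A : ℝ) * (x - 1) ^ (rnk X Finset.univ - rnk X A) *
    (y - 1) ^ (A.card - rnk X A)

/-- The zonotope generated by a list of real vectors. -/
def zonotope {n : ℕ} {ι : Type} [Fintype ι] (v : ι → Fin n → ℝ) : Set (Fin n → ℝ) :=
  {z | ∃ t : ι → ℝ, (∀ i, t i ∈ Set.Icc (0 : ℝ) 1) ∧ z = ∑ i, t i • v i}

section ZonotopeVolume

open Set

/-- The zonotope generated by the vectors `v i` with `i ∈ s`. -/
def subZonotope {ι E : Type*} [AddCommGroup E] [Module ℝ E] (v : ι → E) (s : Finset ι) : Set E :=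
  (fun t : ι → ℝ => ∑ i ∈ s, t i • v i) '' Icc 0 1

theorem zonotope_eq_subZonotope {n : ℕ} {ι : Type} [Fintype ι] (v : ι → Fin n → ℝ) :
    zonotope v = subZonotope v Finset.univ := by
  ext z
  simp only [zonotope, subZonotope, mem_ofPred_eq, mem_image, mem_Icc, Pi.le_def, Pi.zero_apply,
    Pi.one_apply, forall_and]
  exact exists_congr fun t => and_congr_right fun _ => eq_comm

theorem convex_subZonotope {ι E : Type*} [AddCommGroup E] [Module ℝ E] (v : ι → E)
    (s : Finset ι) : Convex ℝ (subZonotope v s) := by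
  have h : IsLinearMap ℝ (fun t : ι → ℝ => ∑ i ∈ s, t i • v i) :=
    ⟨fun x y => by simp [add_smul, Finset.sum_add_distrib],
      fun c x => by simp [mul_smul, Finset.smul_sum]⟩
  exact (convex_Icc (𝕜 := ℝ) (0 : ι → ℝ) 1).is_linear_image h

theorem isCompact_subZonotope {ι E : Type*} [AddCommGroup E] [Module ℝ E] [TopologicalSpace E]
    [ContinuousAdd E] [ContinuousSMul ℝ E] (v : ι → E) (s : Finset ι) :
    IsCompact (subZonotope v s) := by
  have h : IsCompact (Icc (0 : ι → ℝ) 1) := by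
    rw [← pi_univ_Icc]
    exact isCompact_univ_pi fun _ => isCompact_Icc
  exact h.image (by fun_prop)

theorem subZonotope_insert {ι E : Type*} [DecidableEq ι] [AddCommGroup E] [Module ℝ E]
    (v : ι → E) {s : Finset ι} {a : ι} (ha : a ∉ s) :
    subZonotope v (insert a s) =
      (fun p : ℝ × E => p.1 • v a + p.2) '' (Icc 0 1 ×ˢ subZonotope v s) := by
  ext z
  simp only [subZonotope, mem_image, mem_prod, Prod.exists]
  constructor
  · rintro ⟨t, ht, rfl⟩
    exact ⟨t a, _, ⟨⟨ht.1 a, ht.2 a⟩, t, ht, rfl⟩, by rw [Finset.sum_insert ha]⟩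
  · rintro ⟨c, _, ⟨hc, t, ht, rfl⟩, rfl⟩
    refine ⟨Function.update t a c, ⟨fun i => ?_, fun i => ?_⟩, ?_⟩
    · by_cases h : i = a
      · subst h; simpa using hc.1
      · simpa [h] using ht.1 i
    · by_cases h : i = a
      · subst h; simpa using hc.2
      · simpa [h] using ht.2 i
    · rw [Finset.sum_insert ha, Function.update_self]
      congr 1
      refine Finset.sum_congr rfl fun i hi => ?_
      rw [Function.update_of_ne (ne_of_mem_of_not_mem hi ha)]

theorem image_subZonotope {ι E F : Type*} [AddCommGroup E] [Module ℝ E] [AddCommGroup F]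
    [Module ℝ F] (f : E →ₗ[ℝ] F) (v : ι → E) (s : Finset ι) :
    f '' subZonotope v s = subZonotope (f ∘ v) s := by
  simp [subZonotope, image_image]

theorem subZonotope_subset_span {ι E : Type*} [AddCommGroup E] [Module ℝ E] (v : ι → E)
    (s : Finset ι) : subZonotope v s ⊆ Submodule.span ℝ (v '' s) := by
  rintro _ ⟨t, -, rfl⟩
  exact Submodule.sum_mem _ fun i hi =>
    Submodule.smul_mem _ _ (Submodule.subset_span (mem_image_of_mem v hi))

theorem volume_subZonotope_eq_zero {ι : Type*} {n : ℕ} (v : ι → Fin n → ℝ) (s : Finset ι)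
    (h : Module.finrank ℝ (Submodule.span ℝ (v '' s)) < n) :
    volume (subZonotope v s) = 0 := by
  refine measure_mono_null (subZonotope_subset_span v s) (Measure.addHaar_submodule _ _ ?_)
  intro htop
  rw [htop, finrank_top] at h
  simp at h

theorem finrank_span_image_finset_le {ι E : Type*} [AddCommGroup E] [Module ℝ E] (v : ι → E)
    (s : Finset ι) : Module.finrank ℝ (Submodule.span ℝ (v '' s)) ≤ s.card := by
  classical
  rw [← Finset.coe_image]
  exact (finrank_span_finset_le_card _).trans Finset.card_image_le

/-- Sweeping a compact convex set along a unit segment of the first axis adds the volume of its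
shadow. -/
theorem volume_sweep_prod {F : Type*} [AddCommGroup F] [Module ℝ F] [TopologicalSpace F]
    [T2Space F] [ContinuousAdd F] [SecondCountableTopology F] [MeasurableSpace F] [BorelSpace F]
    (ν : Measure F) [SFinite ν] {K : Set (ℝ × F)} (hK : IsCompact K) (hc : Convex ℝ K) :
    (volume.prod ν) ((fun p : ℝ × (ℝ × F) => p.1 • ((1 : ℝ), (0 : F)) + p.2) '' (Icc 0 1 ×ˢ K)) =
      (volume.prod ν) K + ν (Prod.snd '' K) := by
  have hK' : IsCompact
      ((fun p : ℝ × (ℝ × F) => p.1 • ((1 : ℝ), (0 : F)) + p.2) '' (Icc 0 1 ×ˢ K)) := by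
    refine (isCompact_Icc.prod hK).image ?_
    simp only [Prod.smul_mk, smul_zero, smul_eq_mul, mul_one]
    fun_prop
  have hS : MeasurableSet (Prod.snd '' K) := (hK.image continuous_snd).measurableSet
  rw [Measure.prod_apply_symm hK'.measurableSet, Measure.prod_apply_symm hK.measurableSet,
    ← lintegral_indicator_one hS, ← lintegral_add_right _ (measurable_one.indicator hS)]
  refine lintegral_congr fun y => ?_
  have hsweep : (fun x : ℝ => (x, y)) ⁻¹'
      ((fun p : ℝ × (ℝ × F) => p.1 • ((1 : ℝ), (0 : F)) + p.2) '' (Icc 0 1 ×ˢ K)) =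
      {z | ∃ c ∈ Icc (0 : ℝ) 1, ∃ x, (x, y) ∈ K ∧ c + x = z} := by
    ext z
    simp only [mem_preimage, mem_image, mem_prod, Prod.exists, mem_ofPred_eq]
    constructor
    · rintro ⟨c, x, y', ⟨hc, hx⟩, h⟩
      simp only [Prod.smul_mk, smul_zero, smul_eq_mul, mul_one, Prod.mk_add_mk, zero_add,
        Prod.mk.injEq] at h
      exact ⟨c, hc, x, h.2 ▸ hx, h.1⟩
    · rintro ⟨c, hc, x, hx, rfl⟩
      exact ⟨c, x, y, ⟨hc, hx⟩, by simp⟩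
  rw [hsweep]
  by_cases hy : y ∈ Prod.snd '' K
  · have hconn : IsConnected ((fun x : ℝ => (x, y)) ⁻¹' K) := by
      obtain ⟨⟨x, y'⟩, hx, rfl⟩ := hy
      refine ⟨⟨x, hx⟩, Convex.isPreconnected ?_⟩
      intro a ha b hb s t hs ht hst
      have := hc ha hb hs ht hst
      simpa [← add_smul, hst] using this
    have hcomp : IsCompact ((fun x : ℝ => (x, y)) ⁻¹' K) := by
      have : (fun x : ℝ => (x, y)) ⁻¹' K = Prod.fst '' (K ∩ Prod.snd ⁻¹' {y}) := by
        ext x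
        simp
      rw [this]
      exact (hK.inter_right (isClosed_singleton.preimage continuous_snd)).image continuous_fst
    have hIcc := eq_Icc_of_connected_compact hconn hcomp
    set a := sInf ((fun x : ℝ => (x, y)) ⁻¹' K)
    set b := sSup ((fun x : ℝ => (x, y)) ⁻¹' K)
    have hab : a ≤ b := by
      rw [← nonempty_Icc, ← hIcc]
      exact hconn.nonempty
    have hmem : ∀ x, (x, y) ∈ K ↔ a ≤ x ∧ x ≤ b := fun x => by
      rw [← mem_Icc, ← hIcc, mem_preimage]
    have : {z | ∃ c ∈ Icc (0 : ℝ) 1, ∃ x, (x, y) ∈ K ∧ c + x = z} = Icc a (b + 1) := by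
      ext z
      simp only [mem_ofPred_eq, hmem, mem_Icc]
      constructor
      · rintro ⟨c, ⟨h0, h1⟩, x, ⟨h2, h3⟩, rfl⟩
        constructor <;> linarith
      · rintro ⟨h0, h1⟩
        rcases le_total z b with h | h
        · exact ⟨0, by simp, z, ⟨h0, h⟩, by simp⟩
        · exact ⟨z - b, ⟨by linarith, by linarith⟩, b, ⟨hab, le_rfl⟩, by ring⟩
    rw [this, hIcc, indicator_of_mem hy, Real.volume_Icc, Real.volume_Icc, Pi.one_apply,
      ← ENNReal.ofReal_one, ← ENNReal.ofReal_add (by linarith) zero_le_one]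
    congr 1
    ring
  · have hempty : ∀ x, (x, y) ∉ K := fun x hx => hy ⟨_, hx, rfl⟩
    have h : (fun x : ℝ => (x, y)) ⁻¹' K = ∅ := by
      ext x
      simp [hempty]
    simp [hempty, hy, h]

/-- Sweeping a compact convex set along a segment adds a multiple, depending only on the segment,
of the volume of a linear projection of the set. -/
theorem exists_volume_sweep {n : ℕ} (a : Fin (n + 1) → ℝ) :
    ∃ (f : (Fin (n + 1) → ℝ) →ₗ[ℝ] (Fin n → ℝ)) (c : ENNReal),
      ∀ K : Set (Fin (n + 1) → ℝ), IsCompact K → Convex ℝ K →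
        volume ((fun p : ℝ × (Fin (n + 1) → ℝ) => p.1 • a + p.2) '' (Icc 0 1 ×ˢ K)) =
          volume K + c * volume (f '' K) := by
  by_cases ha : a = 0
  · subst ha
    refine ⟨0, 0, fun K _ _ => ?_⟩
    have : (fun p : ℝ × (Fin (n + 1) → ℝ) => p.1 • (0 : Fin (n + 1) → ℝ) + p.2) ''
        (Icc 0 1 ×ˢ K) = K := by
      simp only [smul_zero, zero_add]
      exact snd_image_prod ⟨0, by simp⟩ K
    rw [this, zero_mul, add_zero]
  obtain ⟨L, hL⟩ : ∃ L : (Fin (n + 1) → ℝ) ≃L[ℝ] ℝ × (Fin n → ℝ), L a = (1, 0) := by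
    let E : (Fin (n + 1) → ℝ) ≃L[ℝ] ℝ × (Fin n → ℝ) :=
      ContinuousLinearEquiv.ofFinrankEq (by simp [add_comm])
    obtain ⟨A, hA⟩ := SeparatingDual.exists_continuousLinearEquiv_apply_eq (R := ℝ)
      (x := E a) (y := ((1 : ℝ), (0 : Fin n → ℝ))) (by simpa using ha) (by simp)
    exact ⟨E.trans A, by simpa using hA⟩
  have hmap : Measure.IsAddHaarMeasure
      (Measure.map L (volume : Measure (Fin (n + 1) → ℝ))) := L.isAddHaarMeasure_map _
  have hsmul := Measure.isAddLeftInvariant_eq_smul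
    (Measure.map L (volume : Measure (Fin (n + 1) → ℝ)))
    ((volume : Measure ℝ).prod (volume : Measure (Fin n → ℝ)))
  set c := Measure.addHaarScalarFactor (Measure.map L (volume : Measure (Fin (n + 1) → ℝ)))
    ((volume : Measure ℝ).prod (volume : Measure (Fin n → ℝ)))
  have hvol : ∀ S : Set (Fin (n + 1) → ℝ), volume S =
      c * ((volume : Measure ℝ).prod (volume : Measure (Fin n → ℝ))) (L '' S) := by
    intro S
    have h' : Measure.map L (volume : Measure (Fin (n + 1) → ℝ)) (L '' S) = volume S := by
      rw [show (L : (Fin (n + 1) → ℝ) → _) = L.toHomeomorph.toMeasurableEquiv from rfl,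
        MeasurableEquiv.map_apply]
      congr 1
      exact preimage_image_eq _ L.injective
    rw [← h', hsmul, Measure.smul_apply, ENNReal.smul_def, smul_eq_mul]
  refine ⟨LinearMap.snd ℝ ℝ (Fin n → ℝ) ∘ₗ L.toLinearEquiv.toLinearMap, c, fun K hK hc => ?_⟩
  have himg : L '' ((fun p : ℝ × (Fin (n + 1) → ℝ) => p.1 • a + p.2) '' (Icc 0 1 ×ˢ K)) =
      (fun p : ℝ × (ℝ × (Fin n → ℝ)) => p.1 • ((1 : ℝ), (0 : Fin n → ℝ)) + p.2) ''
        (Icc 0 1 ×ˢ (L '' K)) := by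
    ext z
    simp only [mem_image, mem_prod]
    constructor
    · rintro ⟨_, ⟨⟨t, x⟩, ⟨ht, hx⟩, rfl⟩, rfl⟩
      exact ⟨(t, L x), ⟨ht, x, hx, rfl⟩, by rw [map_add, map_smul, hL]⟩
    · rintro ⟨⟨t, _⟩, ⟨ht, x, hx, rfl⟩, rfl⟩
      exact ⟨_, ⟨(t, x), ⟨ht, hx⟩, rfl⟩, by rw [map_add, map_smul, hL]⟩
  rw [hvol, hvol K, himg, volume_sweep_prod _ (hK.image L.continuous)
    (hc.linear_image L.toLinearEquiv.toLinearMap), mul_add, image_image]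
  rfl

/-- The volume of a zonotope is the sum of the volumes of the parallelepipeds spanned by its
generators. -/
theorem volume_subZonotope {ι : Type*} [DecidableEq ι] (s : Finset ι) :
    ∀ {n : ℕ} (v : ι → Fin n → ℝ),
      volume (subZonotope v s) = ∑ B ∈ s.powersetCard n, volume (subZonotope v B) := by
  induction s using Finset.induction_on with
  | empty =>
    intro n v
    rcases n with _ | n
    · simp
    · rw [Finset.powersetCard_eq_empty.2 (by simp), Finset.sum_empty]
      exact volume_subZonotope_eq_zero v ∅
        ((finrank_span_image_finset_le v ∅).trans_lt (by simp))
  | insert a s ha ih =>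
    intro n v
    rcases n with _ | n
    · have h : ∀ B : Finset ι, subZonotope v B = Set.univ := fun B =>
        Subsingleton.eq_univ_of_nonempty ⟨_, 0, by simp, rfl⟩
      simp [h]
    obtain ⟨f, c, hf⟩ := exists_volume_sweep (v a)
    have hins : ∀ B : Finset ι, a ∉ B → volume (subZonotope v (insert a B)) =
        volume (subZonotope v B) + c * volume (subZonotope (f ∘ v) B) := fun B hB => by
      rw [subZonotope_insert v hB, hf _ (isCompact_subZonotope v B) (convex_subZonotope v B),
        image_subZonotope]
    have hnot : ∀ B ∈ s.powersetCard n, a ∉ B := fun B hB h =>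
      ha ((Finset.mem_powersetCard.1 hB).1 h)
    rw [hins s ha, ih v, ih (f ∘ v), Finset.powersetCard_succ_insert ha, Finset.sum_union,
      Finset.sum_image, Finset.mul_sum]
    · congr 1
      refine Finset.sum_congr rfl fun B hB => ?_
      rw [hins B (hnot B hB), volume_subZonotope_eq_zero v B, zero_add]
      have := finrank_span_image_finset_le v B
      rw [(Finset.mem_powersetCard.1 hB).2] at this
      omega
    · intro B hB C hC h
      rw [← Finset.erase_insert (hnot B hB), h, Finset.erase_insert (hnot C hC)]
    · rw [Finset.disjoint_left]
      intro B hB hB'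
      obtain ⟨C, -, rfl⟩ := Finset.mem_image.1 hB'
      exact ha ((Finset.mem_powersetCard.1 hB).1 (Finset.mem_insert_self a C))

theorem volume_subZonotope_eq_abs_det {ι : Type*} {n : ℕ} (v : ι → Fin n → ℝ) (B : Finset ι)
    (e : Fin n ≃ B) :
    volume (subZonotope v B) = ENNReal.ofReal |(Matrix.of fun i => v (e i)).det| := by
  classical
  have h : subZonotope v B =
      Matrix.toLin' (Matrix.of fun i => v (e i)).transpose '' Icc (0 : Fin n → ℝ) 1 := by
    have happ : ∀ t : Fin n → ℝ, Matrix.toLin' (Matrix.of fun i => v (e i)).transpose t =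
        ∑ i, t i • v (e i) := fun t => by
      ext j
      simp [Matrix.mulVec, dotProduct, mul_comm]
    ext z
    constructor
    · rintro ⟨t, ht, rfl⟩
      refine ⟨fun i => t (e i), ⟨fun i => ht.1 _, fun i => ht.2 _⟩, ?_⟩
      rw [happ, e.sum_comp (fun b : B => t b • v b), Finset.sum_coe_sort B (fun i => t i • v i)]
    · rintro ⟨t, ht, rfl⟩
      refine ⟨fun i => if hi : i ∈ B then t (e.symm ⟨i, hi⟩) else 0,
        ⟨fun i => ?_, fun i => ?_⟩, ?_⟩
      · by_cases hi : i ∈ B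
        · simpa [hi] using ht.1 _
        · simp [hi]
      · by_cases hi : i ∈ B
        · simpa [hi] using ht.2 _
        · simp [hi]
      · rw [happ]
        dsimp only
        rw [← Finset.sum_coe_sort B, ← e.sum_comp]
        simp
  rw [h, Measure.addHaar_image_linearMap, LinearMap.det_toLin', Matrix.det_transpose,
    Real.volume_Icc_pi]
  simp

end ZonotopeVolume

/-- The multiplicity of a basis is the absolute value of its determinant. -/
theorem mult_eq_natAbs_det {n : ℕ} {ι : Type} [Fintype ι] (X : ι → Fin n → ℤ) (B : Finset ι)
    (e : Fin n ≃ B) (hdet : (Matrix.of fun i => X (e i)).det ≠ 0) :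
    mult X B = (Matrix.of fun i => X (e i)).det.natAbs := by
  have hrange : X '' ↑B = Set.range fun i => X (e i) := by
    ext z
    constructor
    · rintro ⟨i, hi, rfl⟩
      exact ⟨e.symm ⟨i, hi⟩, by simp⟩
    · rintro ⟨i, rfl⟩
      exact ⟨e i, (e i).2, rfl⟩
  have hli : LinearIndependent ℤ fun i => X (e i) :=
    Matrix.linearIndependent_rows_of_det_ne_zero hdet
  have hcard : (Matrix.of fun i => X (e i)).det.natAbs =
      Nat.card ((Fin n → ℤ) ⧸ Submodule.span ℤ (X '' ↑B)) := by
    rw [hrange, ← Submodule.natAbs_det_basis_change (Pi.basisFun ℤ (Fin n)) _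
      (Module.Basis.span hli), Module.Basis.det_apply, ← Matrix.det_transpose]
    congr 2
    ext i j
    simp [Module.Basis.toMatrix_apply, Module.Basis.span_apply]
  have htop : Submodule.torsion ℤ ((Fin n → ℤ) ⧸ Submodule.span ℤ (X '' ↑B)) = ⊤ := by
    rw [eq_top_iff]
    intro x _
    rw [Submodule.mem_torsion_iff]
    refine ⟨⟨Nat.card ((Fin n → ℤ) ⧸ Submodule.span ℤ (X '' ↑B)), ?_⟩, ?_⟩
    · rw [mem_nonZeroDivisors_iff_ne_zero, ← hcard]
      simpa using hdet
    · rw [Submonoid.mk_smul, natCast_zsmul]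
      exact card_nsmul_eq_zero'
  rw [mult, htop, hcard]
  exact Nat.card_congr Submodule.topEquiv.toEquiv

/-- `M_X(1,1)` equals the Lebesgue volume of the zonotope `Z(X)`. -/
theorem stmt0 {n N : ℕ} (X : Fin N → Fin n → ℤ)
    (hspan : Submodule.span ℝ (Set.range (fun i (j : Fin n) => (X i j : ℝ))) = ⊤) :
    Mpoly X 1 1 = (volume (zonotope (fun i (j : Fin n) => (X i j : ℝ)))).toReal := by
  classical
  have huniv : rnk X Finset.univ = n := by
    rw [rnk, Finset.coe_univ, Set.image_univ, hspan, finrank_top]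
    simp
  have hcard (A : Finset (Fin N)) : rnk X A ≤ A.card := finrank_span_image_finset_le _ A
  have hn (A : Finset (Fin N)) : rnk X A ≤ n := (Submodule.finrank_le _).trans (by simp)
  rw [zonotope_eq_subZonotope, volume_subZonotope, Mpoly, huniv, ENNReal.toReal_sum
    fun B _ => (isCompact_subZonotope _ B).measure_lt_top.ne]
  symm
  refine Finset.sum_subset_zero_on_sdiff (Finset.subset_univ _) (fun A hA => ?_) fun A hA => ?_
  · have hA' : A.card ≠ n := by simpa using hA
    have := hcard A
    have := hn A
    by_cases h : rnk X A = n
    · rw [sub_self, zero_pow (n := A.card - rnk X A) (by omega), mul_zero]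
    · rw [sub_self, zero_pow (n := n - rnk X A) (by omega), mul_zero, zero_mul]
  · have hA' : A.card = n := (Finset.mem_powersetCard.1 hA).2
    by_cases h : rnk X A = n
    · have e : Fin n ≃ A := (A.equivFinOfCardEq hA').symm
      have hcast : (Matrix.of fun i => fun j : Fin n => (X (e i) j : ℝ)).det =
          ((Matrix.of fun i => X (e i)).det : ℝ) :=
        (RingHom.map_det (Int.castRingHom ℝ) (Matrix.of fun i => X (e i))).symm
      have hdet : (Matrix.of fun i => X (e i)).det ≠ 0 := by
        have himage : (fun i (j : Fin n) => (X i j : ℝ)) '' ↑A =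
            Set.range fun i => fun j : Fin n => (X (e i) j : ℝ) := by
          ext z
          constructor
          · rintro ⟨i, hi, rfl⟩
            exact ⟨e.symm ⟨i, hi⟩, by simp⟩
          · rintro ⟨i, rfl⟩
            exact ⟨e i, (e i).2, rfl⟩
        have hli : LinearIndependent ℝ fun i => fun j : Fin n => (X (e i) j : ℝ) := by
          rw [linearIndependent_iff_card_eq_finrank_span, Set.finrank, ← himage, Fintype.card_fin]
          exact h.symm
        have hunit := (Matrix.linearIndependent_rows_iff_isUnit
          (A := Matrix.of fun i => fun j : Fin n => (X (e i) j : ℝ))).1 hli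
        rw [Matrix.isUnit_iff_isUnit_det, hcast, isUnit_iff_ne_zero] at hunit
        exact_mod_cast hunit
      rw [volume_subZonotope_eq_abs_det _ A e, hcast, mult_eq_natAbs_det X A e hdet,
        ENNReal.toReal_ofReal (abs_nonneg _), h, hA', Nat.cast_natAbs]
      simp
    · have hlt := lt_of_le_of_ne (hn A) h
      rw [volume_subZonotope_eq_zero _ A hlt, sub_self, zero_pow (n := n - rnk X A) (by omega)]
      simp
end

section
/- Let X be a finite list of vectors in a real vector space U, and let λ ∈ X be a nonzero element lying in the linear span of X₁ := X ∖ {λ}. Let X₂ be the list of images of the elements of X₁ under the quotient map U → U/⟨λ⟩. Then T_X(x,y) = T_{X₁}(x,y) + T_{X₂}(x,y). -/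
/-- The rank of a sublist `A` of a list of vectors in a real vector space. -/
noncomputable def rk {V : Type*} [AddCommGroup V] [Module ℝ V] {ι : Type*} [Fintype ι]
    (v : ι → V) (A : Finset ι) : ℕ :=
  Module.finrank ℝ (Submodule.span ℝ (v '' ↑A))

/-- The Tutte polynomial `T_X(x,y)` of a list of vectors, as a real-valued function. -/
noncomputable def Tpoly {V : Type*} [AddCommGroup V] [Module ℝ V] {ι : Type*} [Fintype ι]
    (v : ι → V) (x y : ℝ) : ℝ :=
  ∑ A : Finset ι, (x - 1) ^ (rk v Finset.univ - rk v A) * (y - 1) ^ (A.card - rk v A)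

/-- Quotienting by a nonzero vector `u` lowers the dimension of the span of `insert u S` by one. -/
theorem finrank_span_insert_eq_finrank_span_mk_image {V : Type*} [AddCommGroup V] [Module ℝ V]
    {u : V} (hu : u ≠ 0) {S : Set V} (hS : S.Finite) :
    Module.finrank ℝ (Submodule.span ℝ (insert u S)) =
      Module.finrank ℝ (Submodule.span ℝ
        (Submodule.Quotient.mk (p := Submodule.span ℝ {u}) '' S)) + 1 := by
  set L := Submodule.span ℝ {u}
  set W := Submodule.span ℝ (insert u S)
  have : FiniteDimensional ℝ W := FiniteDimensional.span_of_finite ℝ (hS.insert u)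
  have hLW : L ≤ W := Submodule.span_mono (by simp)
  have hrange : LinearMap.range (L.mkQ.domRestrict W) =
      Submodule.span ℝ (Submodule.Quotient.mk (p := L) '' S) := by
    have hmap : LinearMap.range (L.mkQ.domRestrict W) = W.map L.mkQ := by
      rw [LinearMap.domRestrict, LinearMap.range_comp, Submodule.range_subtype]
    have hu0 : L.mkQ u = 0 := by simp [L, Submodule.mem_span_singleton_self]
    rw [hmap, Submodule.map_span, Set.image_insert_eq, hu0, Submodule.span_insert_zero]
    rfl
  have hker : LinearMap.ker (L.mkQ.domRestrict W) = L.comap W.subtype := by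
    rw [LinearMap.domRestrict, LinearMap.ker_comp, Submodule.ker_mkQ]
  have h := LinearMap.finrank_range_add_finrank_ker (L.mkQ.domRestrict W)
  rw [hrange, hker, (Submodule.comapSubtypeEquivOfLe hLW).finrank_eq,
    finrank_span_singleton hu] at h
  exact h.symm

/-- A sum over all finsets splits according to whether a given element belongs to them. -/
theorem sum_finset_eq_sum_add_insert {ι M : Type*} [Fintype ι] [DecidableEq ι]
    [AddCommMonoid M] (a : ι) (f : Finset ι → M) :
    ∑ A, f A = ∑ B : Finset {i // i ≠ a}, f (B.map (Function.Embedding.subtype _)) +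
      ∑ B : Finset {i // i ≠ a}, f (insert a (B.map (Function.Embedding.subtype _))) := by
  have key (g : Finset ι → M) : ∑ A ∈ (Finset.univ.erase a).powerset, g A =
      ∑ B : Finset {i // i ≠ a}, g (B.map (Function.Embedding.subtype _)) := by
    symm
    refine Finset.sum_bij (fun B _ => B.map (Function.Embedding.subtype _)) ?_ ?_ ?_ ?_
    · intro B _
      rw [Finset.mem_powerset]
      intro i hi
      obtain ⟨j, -, rfl⟩ := Finset.mem_map.1 hi
      simpa using j.2
    · intro B _ C _ h
      exact Finset.map_injective _ h
    · intro A hA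
      refine ⟨A.subtype _, Finset.mem_univ _, Finset.subtype_map_of_mem fun i hi => ?_⟩
      exact Finset.ne_of_mem_erase (Finset.mem_powerset.1 hA hi)
    · intro B _
      rfl
  rw [← key f, ← key fun A => f (insert a A),
    ← Finset.sum_powerset_insert (Finset.notMem_erase a Finset.univ),
    Finset.insert_erase (Finset.mem_univ a), Finset.powerset_univ]

/-- Deletion-restriction for the Tutte polynomial: if `λ = X i₀` is a nonzero element of the
list `X` lying in the span of the remaining elements `X₁`, and `X₂` is the image of `X₁` in
the quotient `U/⟨λ⟩`, then `T_X = T_{X₁} + T_{X₂}`. -/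
theorem stmt1 {U : Type*} [AddCommGroup U] [Module ℝ U] {N : ℕ} (X : Fin N → U) (i₀ : Fin N)
    (h0 : X i₀ ≠ 0)
    (hdep : X i₀ ∈ Submodule.span ℝ (X '' {i | i ≠ i₀})) (x y : ℝ) :
    Tpoly X x y =
      Tpoly (fun i : {i : Fin N // i ≠ i₀} => X i) x y +
      Tpoly (fun i : {i : Fin N // i ≠ i₀} =>
        Submodule.Quotient.mk (p := Submodule.span ℝ {X i₀}) (X i)) x y := by
  have hmap (B : Finset {i : Fin N // i ≠ i₀}) :
      X '' ↑(B.map (Function.Embedding.subtype _)) =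
        (fun i : {i : Fin N // i ≠ i₀} => X i) '' ↑B := by
    rw [Finset.coe_map, Set.image_image]
    rfl
  have hdel (B : Finset {i : Fin N // i ≠ i₀}) :
      rk X (B.map (Function.Embedding.subtype _)) =
        rk (fun i : {i : Fin N // i ≠ i₀} => X i) B := by
    rw [rk, rk, hmap]
  have hquot (B : Finset {i : Fin N // i ≠ i₀}) :
      rk X (insert i₀ (B.map (Function.Embedding.subtype _))) =
        rk (fun i : {i : Fin N // i ≠ i₀} =>
          Submodule.Quotient.mk (p := Submodule.span ℝ {X i₀}) (X i)) B + 1 := by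
    rw [rk, rk, Finset.coe_insert, Set.image_insert_eq, hmap,
      finrank_span_insert_eq_finrank_span_mk_image h0 (B.finite_toSet.image _), Set.image_image]
  have huniv : insert i₀ ((Finset.univ : Finset {i : Fin N // i ≠ i₀}).map
      (Function.Embedding.subtype _)) = Finset.univ := by
    ext i
    simp [em]
  have hr₂ := hquot Finset.univ
  rw [huniv] at hr₂
  have hr₁ : rk X Finset.univ = rk (fun i : {i : Fin N // i ≠ i₀} => X i) Finset.univ := by
    have himage : X '' ↑((Finset.univ : Finset {i : Fin N // i ≠ i₀}).map
        (Function.Embedding.subtype _)) = X '' {i | i ≠ i₀} := by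
      congr 1
      ext i
      simp
    rw [← hdel, rk, rk, ← huniv, Finset.coe_insert, Set.image_insert_eq, himage,
      Submodule.span_insert_eq_span hdep]
  rw [Tpoly, sum_finset_eq_sum_add_insert i₀, Tpoly, Tpoly]
  congr 1
  · refine Finset.sum_congr rfl fun B _ => ?_
    rw [hr₁, hdel, Finset.card_map]
  · refine Finset.sum_congr rfl fun B _ => ?_
    rw [hr₂, hquot, Finset.card_insert_of_notMem (by simp), Finset.card_map,
      Nat.add_sub_add_right, Nat.add_sub_add_right]
end

section
/- For every finite list X of vectors in a real vector space, the Tutte polynomial T_X(x,y), expanded as a polynomial in the variables x and y, has all coefficients nonnegative. -/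
/-- The Tutte polynomial `T_X(x,y)` of a list of vectors, as a genuine polynomial in the two
variables `x = X 0`, `y = X 1`. -/
noncomputable def TuttePoly {V : Type*} [AddCommGroup V] [Module ℝ V] {ι : Type*} [Fintype ι]
    (v : ι → V) : MvPolynomial (Fin 2) ℤ :=
  ∑ A : Finset ι,
    (MvPolynomial.X 0 - 1) ^ (rk v Finset.univ - rk v A) *
      (MvPolynomial.X 1 - 1) ^ (A.card - rk v A)

/-- The rank axioms of a matroid, for an integer-valued function on finite sets. -/
structure IsRankFunction {ι : Type*} [DecidableEq ι] (r : Finset ι → ℕ) : Prop where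
  empty : r ∅ = 0
  mono : ∀ {A B : Finset ι}, A ⊆ B → r A ≤ r B
  insert_le : ∀ (e : ι) (A : Finset ι), r (insert e A) ≤ r A + 1
  submodular : ∀ (e : ι) {A B : Finset ι}, A ⊆ B → r (insert e B) + r A ≤ r B + r (insert e A)

/-- The contraction of a rank function by an element. -/
def contractRank {ι : Type*} [DecidableEq ι] (r : Finset ι → ℕ) (e : ι) (A : Finset ι) : ℕ :=
  r (insert e A) - r {e}

/-- The Tutte polynomial of the restriction of a rank function to the finite set `S`. -/
noncomputable def rankTutte {ι : Type*} (r : Finset ι → ℕ) (S : Finset ι) :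
    MvPolynomial (Fin 2) ℤ :=
  ∑ A ∈ S.powerset, (MvPolynomial.X 0 - 1) ^ (r S - r A) * (MvPolynomial.X 1 - 1) ^ (A.card - r A)

namespace IsRankFunction

variable {ι : Type*} [DecidableEq ι] {r : Finset ι → ℕ}

lemma singleton_le_insert (hr : IsRankFunction r) (e : ι) (A : Finset ι) :
    r {e} ≤ r (insert e A) :=
  hr.mono (by simp)

lemma le_card (hr : IsRankFunction r) (A : Finset ι) : r A ≤ A.card := by
  induction A using Finset.induction_on with
  | empty => simp [hr.empty]
  | insert e A he ih =>
    rw [Finset.card_insert_of_notMem he]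
    exact (hr.insert_le e A).trans (by lia)

lemma contractRank (hr : IsRankFunction r) (e : ι) : IsRankFunction (contractRank r e) where
  empty := by simp [_root_.contractRank]
  mono h := Nat.sub_le_sub_right (hr.mono (Finset.insert_subset_insert e h)) _
  insert_le f A := by
    have h := hr.insert_le f (insert e A)
    rw [Finset.insert_comm] at h
    have := hr.singleton_le_insert e A
    simp only [_root_.contractRank]
    lia
  submodular f A B h := by
    have h' := hr.submodular f (Finset.insert_subset_insert e h)
    rw [Finset.insert_comm f e B, Finset.insert_comm f e A] at h'
    have := hr.singleton_le_insert e A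
    have := hr.singleton_le_insert e B
    have := hr.singleton_le_insert e (insert f A)
    have := hr.singleton_le_insert e (insert f B)
    simp only [_root_.contractRank]
    lia

end IsRankFunction

section Recursion

variable {ι : Type*} [DecidableEq ι] {r : Finset ι → ℕ} {e : ι} {S : Finset ι}

lemma rankTutte_insert_of_loop (hr : IsRankFunction r) (he : e ∉ S) (hl : r {e} = 0) :
    rankTutte r (insert e S) = MvPolynomial.X 1 * rankTutte r S := by
  have key (A : Finset ι) : r (insert e A) = r A := by
    have h := hr.submodular e (Finset.empty_subset A)
    have h' := hr.mono (Finset.subset_insert e A)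
    simp only [insert_empty_eq, hl, hr.empty] at h
    lia
  rw [rankTutte, Finset.sum_powerset_insert he, rankTutte, Finset.mul_sum,
    ← Finset.sum_add_distrib]
  refine Finset.sum_congr rfl fun A hA => ?_
  have heA : e ∉ A := fun h => he (Finset.mem_powerset.1 hA h)
  have hcard : (insert e A).card - r A = (A.card - r A) + 1 := by
    rw [Finset.card_insert_of_notMem heA]
    have := hr.le_card A
    lia
  rw [key, key, hcard]
  ring

lemma rankTutte_insert_of_coloop (hr : IsRankFunction r) (he : e ∉ S)
    (hc : r (insert e S) = r S + 1) :
    rankTutte r (insert e S) = MvPolynomial.X 0 * rankTutte r S := by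
  rw [rankTutte, Finset.sum_powerset_insert he, rankTutte, Finset.mul_sum,
    ← Finset.sum_add_distrib]
  refine Finset.sum_congr rfl fun A hA => ?_
  have hAS := Finset.mem_powerset.1 hA
  have heA : e ∉ A := fun h => he (hAS h)
  have key : r (insert e A) = r A + 1 := by
    have h := hr.submodular e hAS
    have h' := hr.insert_le e A
    lia
  have hmono := hr.mono hAS
  have hrank : r S + 1 - r A = (r S - r A) + 1 := by lia
  rw [key, hc, hrank, Finset.card_insert_of_notMem heA, Nat.add_sub_add_right,
    Nat.add_sub_add_right]
  ring

lemma rankTutte_insert (hr : IsRankFunction r) (he : e ∉ S) (hl : r {e} = 1)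
    (hc : r (insert e S) = r S) :
    rankTutte r (insert e S) = rankTutte r S + rankTutte (contractRank r e) S := by
  rw [rankTutte, Finset.sum_powerset_insert he, hc]
  congr 1
  refine Finset.sum_congr rfl fun A hA => ?_
  have heA : e ∉ A := fun h => he (Finset.mem_powerset.1 hA h)
  have hA1 := hr.singleton_le_insert e A
  have hS1 := hr.singleton_le_insert e S
  rw [Finset.card_insert_of_notMem heA]
  simp only [contractRank]
  congr 2 <;> lia

end Recursion

lemma MvPolynomial.coeff_X_mul_nonneg {σ : Type*} {p : MvPolynomial σ ℤ}
    (hp : ∀ d, 0 ≤ p.coeff d) (i : σ) (d : σ →₀ ℕ) : 0 ≤ (MvPolynomial.X i * p).coeff d := by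
  classical
  rw [MvPolynomial.coeff_X_mul']
  split_ifs
  exacts [hp _, le_rfl]

lemma coeff_rankTutte_nonneg {ι : Type*} [DecidableEq ι] {r : Finset ι → ℕ}
    (hr : IsRankFunction r) (S : Finset ι) (d : Fin 2 →₀ ℕ) : 0 ≤ (rankTutte r S).coeff d := by
  induction S using Finset.induction_on generalizing r d with
  | empty =>
    simp only [rankTutte, Finset.powerset_empty, Finset.sum_singleton, Finset.card_empty,
      Nat.sub_self, Nat.zero_sub, pow_zero, mul_one, MvPolynomial.coeff_one]
    split_ifs <;> simp
  | insert e S he ih =>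
    have h1 : r {e} ≤ 1 := by simpa using hr.le_card {e}
    have h2 := hr.insert_le e S
    have h3 := hr.mono (Finset.subset_insert e S)
    obtain hl | hl : r {e} = 0 ∨ r {e} = 1 := by lia
    · rw [rankTutte_insert_of_loop hr he hl]
      exact MvPolynomial.coeff_X_mul_nonneg (ih hr) 1 d
    obtain hc | hc : r (insert e S) = r S + 1 ∨ r (insert e S) = r S := by lia
    · rw [rankTutte_insert_of_coloop hr he hc]
      exact MvPolynomial.coeff_X_mul_nonneg (ih hr) 0 d
    · rw [rankTutte_insert hr he hl hc, MvPolynomial.coeff_add]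
      exact add_nonneg (ih hr d) (ih (hr.contractRank e) d)

section LinearRank

variable {V : Type*} [AddCommGroup V] [Module ℝ V] {ι : Type*} [Fintype ι] (v : ι → V)

instance finite_span_image (A : Finset ι) : Module.Finite ℝ (Submodule.span ℝ (v '' ↑A)) :=
  Module.Finite.span_of_finite ℝ (A.finite_toSet.image v)

lemma rk_mono {A B : Finset ι} (h : A ⊆ B) : rk v A ≤ rk v B :=
  Submodule.finrank_mono (Submodule.span_mono (Set.image_mono (Finset.coe_subset.2 h)))

lemma rk_le_card (A : Finset ι) : rk v A ≤ A.card := by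
  classical
  rw [rk, ← Finset.coe_image]
  exact (finrank_span_finset_le_card _).trans Finset.card_image_le

lemma rk_union_add_rk_inter_le [DecidableEq ι] (A B : Finset ι) :
    rk v (A ∪ B) + rk v (A ∩ B) ≤ rk v A + rk v B := by
  have h := Submodule.finrank_sup_add_finrank_inf_eq
    (Submodule.span ℝ (v '' ↑A)) (Submodule.span ℝ (v '' ↑B))
  rw [← Submodule.span_union, ← Set.image_union, ← Finset.coe_union] at h
  have hle : Submodule.span ℝ (v '' ↑(A ∩ B)) ≤
      Submodule.span ℝ (v '' ↑A) ⊓ Submodule.span ℝ (v '' ↑B) :=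
    le_inf (Submodule.span_mono (Set.image_mono (by simp)))
      (Submodule.span_mono (Set.image_mono (by simp)))
  have h' := Submodule.finrank_mono hle
  simp only [rk]
  lia

lemma isRankFunction_rk [DecidableEq ι] : IsRankFunction (rk v) where
  empty := by simpa using rk_le_card v ∅
  mono := rk_mono v
  insert_le e A := by
    have h := rk_union_add_rk_inter_le v A {e}
    have h' := rk_le_card v {e}
    rw [Finset.union_comm, ← Finset.insert_eq] at h
    rw [Finset.card_singleton] at h'
    lia
  submodular e A B hAB := by
    have h := rk_union_add_rk_inter_le v B (insert e A)
    have h' : rk v A ≤ rk v (B ∩ insert e A) :=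
      rk_mono v (Finset.subset_inter hAB (Finset.subset_insert e A))
    rw [Finset.union_insert, Finset.union_eq_left.2 hAB] at h
    lia

end LinearRank

/-- The Tutte polynomial of a finite list of vectors has nonnegative coefficients. -/
theorem stmt3 {V : Type*} [AddCommGroup V] [Module ℝ V] {ι : Type*} [Fintype ι]
    (v : ι → V) (d : Fin 2 →₀ ℕ) :
    0 ≤ (TuttePoly v).coeff d := by
  classical
  have h : TuttePoly v = rankTutte (rk v) Finset.univ := by
    rw [TuttePoly, rankTutte, Finset.powerset_univ]
  rw [h]
  exact coeff_rankTutte_nonneg (isRankFunction_rk v) Finset.univ d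
end

section
/- Let Γ be a finitely generated abelian group and X a finite list of elements of Γ. Then the multiplicity Tutte polynomial M_X(x,y), expanded as a polynomial in the variables x and y, has all coefficients nonnegative. -/
/-- The (free) rank of the subgroup generated by a sublist `A` of a list of elements of a
finitely generated abelian group. -/
noncomputable def rkZ {Γ : Type*} [AddCommGroup Γ] {ι : Type*} [Fintype ι]
    (v : ι → Γ) (A : Finset ι) : ℕ :=
  Module.finrank ℤ ↥(AddSubgroup.closure (v '' ↑A))

/-- The multiplicity of a sublist `A`: the cardinality of the torsion subgroup of the quotient
group `Γ/⟨A⟩`. -/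
noncomputable def mZ {Γ : Type*} [AddCommGroup Γ] {ι : Type*} [Fintype ι]
    (v : ι → Γ) (A : Finset ι) : ℕ :=
  Nat.card (AddCommGroup.torsion (Γ ⧸ AddSubgroup.closure (v '' ↑A)))

/-- The multiplicity Tutte polynomial `M_X(x,y)` of a list of elements of a finitely generated
abelian group, as a genuine polynomial in the variables `x = X 0`, `y = X 1`. -/
noncomputable def MGammaPoly {Γ : Type*} [AddCommGroup Γ] {ι : Type*} [Fintype ι]
    (v : ι → Γ) : MvPolynomial (Fin 2) ℤ :=
  ∑ A : Finset ι,
    MvPolynomial.C (mZ v A : ℤ) *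
      (MvPolynomial.X 0 - 1) ^ (rkZ v Finset.univ - rkZ v A) *
      (MvPolynomial.X 1 - 1) ^ (A.card - rkZ v A)

namespace MultiplicityTutte

variable {Γ : Type*} [AddCommGroup Γ] {ι : Type*}

/-- The subgroup generated by the elements of the list `v` indexed by `A`. -/
def gen (v : ι → Γ) (A : Finset ι) : AddSubgroup Γ :=
  AddSubgroup.closure (v '' ↑A)

/-- The largest subgroup in which `gen v A` has torsion quotient. -/
def sat (v : ι → Γ) (A : Finset ι) : AddSubgroup Γ :=
  (AddCommGroup.torsion (Γ ⧸ gen v A)).comap (QuotientAddGroup.mk' (gen v A))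

lemma mem_sat {v : ι → Γ} {A : Finset ι} {g : Γ} :
    g ∈ sat v A ↔ ∃ n : ℕ, 0 < n ∧ n • g ∈ gen v A := by
  change IsOfFinAddOrder (QuotientAddGroup.mk g : Γ ⧸ gen v A) ↔ _
  rw [isOfFinAddOrder_iff_nsmul_eq_zero]
  refine exists_congr fun n => and_congr_right fun _ => ?_
  rw [← QuotientAddGroup.mk_nsmul, QuotientAddGroup.eq_zero_iff]

lemma apply_mem_gen (v : ι → Γ) {A : Finset ι} {i : ι} (hi : i ∈ A) : v i ∈ gen v A :=
  AddSubgroup.subset_closure ⟨i, hi, rfl⟩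

lemma gen_mono (v : ι → Γ) {A B : Finset ι} (h : A ⊆ B) : gen v A ≤ gen v B :=
  AddSubgroup.closure_mono (Set.image_mono (Finset.coe_subset.2 h))

lemma gen_union [DecidableEq ι] (v : ι → Γ) (A B : Finset ι) :
    gen v (A ∪ B) = gen v A ⊔ gen v B := by
  simp only [gen, Finset.coe_union, Set.image_union, AddSubgroup.closure_union]

lemma gen_le_sat (v : ι → Γ) (A : Finset ι) : gen v A ≤ sat v A :=
  fun g hg => mem_sat.2 ⟨1, one_pos, by simpa using hg⟩

lemma sat_mono (v : ι → Γ) {A B : Finset ι} (h : A ⊆ B) : sat v A ≤ sat v B := fun g hg => by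
  obtain ⟨n, hn, hg⟩ := mem_sat.1 hg
  exact mem_sat.2 ⟨n, hn, gen_mono v h hg⟩

lemma sat_le_sat {v : ι → Γ} {A B : Finset ι} (h : gen v A ≤ sat v B) :
    sat v A ≤ sat v B := fun g hg => by
  obtain ⟨n, hn, hg⟩ := mem_sat.1 hg
  obtain ⟨k, hk, hg⟩ := mem_sat.1 (h hg)
  exact mem_sat.2 ⟨k * n, Nat.mul_pos hk hn, by rwa [mul_nsmul']⟩

/-- Adjoining elements of `sat v A` to `A` does not change its saturation. -/
lemma sat_union_eq [DecidableEq ι] {v : ι → Γ} {A S : Finset ι} (h : ∀ s ∈ S, v s ∈ sat v A) :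
    sat v (A ∪ S) = sat v A := by
  refine le_antisymm (sat_le_sat ?_) (sat_mono v Finset.subset_union_left)
  rw [gen_union]
  refine sup_le (gen_le_sat v A) ((AddSubgroup.closure_le _).2 ?_)
  rintro _ ⟨s, hs, rfl⟩
  exact h s hs

lemma mZ_eq_relIndex [Fintype ι] (v : ι → Γ) (A : Finset ι) :
    mZ v A = (gen v A).relIndex (sat v A) := by
  have h := AddSubgroup.relIndex_ker (sat v A) (QuotientAddGroup.mk' (gen v A))
  rw [QuotientAddGroup.ker_mk'] at h
  rw [h, sat, AddSubgroup.map_comap_eq_self_of_surjective (QuotientAddGroup.mk'_surjective _)]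
  rfl

lemma finite_torsion (M : Type*) [AddCommGroup M] [Module.Finite ℤ M] :
    Finite (AddCommGroup.torsion M) := by
  have : Module.Finite ℤ (AddCommGroup.torsion M) :=
    inferInstanceAs (Module.Finite ℤ (AddSubgroup.toIntSubmodule (AddCommGroup.torsion M)))
  have : AddGroup.FG (AddCommGroup.torsion M) := Module.Finite.iff_addGroup_fg.1 this
  refine AddCommGroup.finite_of_fg_isAddTorsion _ ?_
  exact fun x => AddSubmonoid.isOfFinAddOrder_coe.1 x.2

lemma mZ_pos [Fintype ι] [Module.Finite ℤ Γ] (v : ι → Γ) (A : Finset ι) : 0 < mZ v A := by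
  have : Finite (AddCommGroup.torsion (Γ ⧸ gen v A)) := by
    have : Module.Finite ℤ (Γ ⧸ gen v A) :=
      inferInstanceAs (Module.Finite ℤ (Γ ⧸ AddSubgroup.toIntSubmodule (gen v A)))
    exact finite_torsion _
  exact @Nat.card_pos _ _ this

lemma finrank_span_singleton_int (M : Type*) [AddCommGroup M] [Module.Finite ℤ M] (x : M)
    [Decidable (IsOfFinAddOrder x)] :
    Module.finrank ℤ (Submodule.span ℤ {x}) = if IsOfFinAddOrder x then 0 else 1 := by
  split_ifs with h
  · rw [Module.finrank_eq_zero_iff_isTorsion]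
    obtain ⟨n, hn, hx⟩ := isOfFinAddOrder_iff_nsmul_eq_zero.1 h
    rintro ⟨y, hy⟩
    obtain ⟨k, rfl⟩ := Submodule.mem_span_singleton.1 hy
    refine ⟨⟨n, mem_nonZeroDivisors_of_ne_zero (by exact_mod_cast hn.ne')⟩, Subtype.ext ?_⟩
    change (n : ℤ) • k • x = 0
    rw [smul_comm, natCast_zsmul, hx, smul_zero]
  · have hinj : Function.Injective (LinearMap.toSpanSingleton ℤ M x) := by
      refine (injective_iff_map_eq_zero _).2 fun k hk => ?_
      by_contra hk0
      exact h (isOfFinAddOrder_iff_zsmul_eq_zero.2 ⟨k, hk0, by simpa using hk⟩)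
    rw [← LinearMap.range_toSpanSingleton, ← (LinearEquiv.ofInjective _ hinj).finrank_eq,
      Module.finrank_self]

lemma rkZ_insert [Fintype ι] [DecidableEq ι] [Module.Finite ℤ Γ] (v : ι → Γ) (A : Finset ι)
    (b : ι) [Decidable (v b ∈ sat v A)] :
    rkZ v (insert b A) = rkZ v A + if v b ∈ sat v A then 0 else 1 := by
  classical
  set K := AddSubgroup.toIntSubmodule (gen v A) with hK
  have hK2 : AddSubgroup.toIntSubmodule (gen v (insert b A)) = K ⊔ Submodule.span ℤ {v b} := by
    simp only [hK, gen, AddSubgroup.toIntSubmodule_closure, Finset.coe_insert, Set.image_insert_eq,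
      Submodule.span_insert, sup_comm]
  have h1 : Module.finrank ℤ (Γ ⧸ K) + rkZ v A = Module.finrank ℤ Γ :=
    Submodule.finrank_quotient_add_finrank K
  have h2 : Module.finrank ℤ (Γ ⧸ K ⊔ Submodule.span ℤ {v b}) + rkZ v (insert b A) =
      Module.finrank ℤ Γ := by
    rw [← hK2]
    exact Submodule.finrank_quotient_add_finrank _
  have h3 := Submodule.finrank_quotient_add_finrank
    (Submodule.map K.mkQ (Submodule.span ℤ {v b}))
  rw [(Submodule.quotientQuotientEquivQuotientSup _ _).finrank_eq, Submodule.map_span,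
    Set.image_singleton, finrank_span_singleton_int] at h3
  have h4 : IsOfFinAddOrder (K.mkQ (v b)) ↔ v b ∈ sat v A := Iff.rfl
  simp only [h4] at h3
  omega

/-- If `v b` is not in the saturation of `A`, some rational functional on `Γ` vanishes on `A`
and takes the value `1` at `v b`. -/
lemma exists_functional [Module.Finite ℤ Γ] {v : ι → Γ} {A : Finset ι} {b : ι}
    (hb : v b ∉ sat v A) :
    ∃ φ : Γ →+ ℚ, φ (v b) = 1 ∧ ∀ i ∈ A, φ (v i) = 0 := by
  set K := AddSubgroup.toIntSubmodule (gen v A) with hK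
  let T := Submodule.torsion ℤ (Γ ⧸ K)
  let q : Γ →ₗ[ℤ] (Γ ⧸ K) ⧸ T := T.mkQ ∘ₗ K.mkQ
  have hq : q (v b) ≠ 0 := by
    intro h
    have h' : K.mkQ (v b) ∈ T := (Submodule.Quotient.mk_eq_zero _).1 h
    obtain ⟨⟨n, hn⟩, hn'⟩ := (Submodule.mem_torsion_iff _).1 h'
    exact hb (isOfFinAddOrder_iff_zsmul_eq_zero.2 ⟨n, nonZeroDivisors.ne_zero hn, hn'⟩)
  obtain ⟨f, hf⟩ := not_forall.1 (mt (Module.forall_dual_apply_eq_zero_iff ℤ (q (v b))).1 hq)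
  have hf' : (f (q (v b)) : ℚ) ≠ 0 := by exact_mod_cast hf
  refine ⟨(AddMonoidHom.mulRight (f (q (v b)) : ℚ)⁻¹).comp
    ((Int.castAddHom ℚ).comp (f ∘ₗ q).toAddMonoidHom), ?_, fun i hi => ?_⟩
  · simp [hf']
  · have : K.mkQ (v i) = 0 := (Submodule.Quotient.mk_eq_zero _).2 (apply_mem_gen v hi)
    have hqi : q (v i) = 0 := by change T.mkQ (K.mkQ (v i)) = 0; rw [this, map_zero]
    simp [hqi]

/-- The functionals `φ b`, `b ∈ B`, are dual to the vectors indexed by `B` and vanish on the other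
vectors indexed by `D`. -/
structure IsDualFamily (φ : ι → Γ →+ ℚ) (v : ι → Γ) (B D : Finset ι) : Prop where
  subset : B ⊆ D
  apply_self : ∀ b ∈ B, φ b (v b) = 1
  apply_of_ne : ∀ b ∈ B, ∀ i ∈ D, i ≠ b → φ b (v i) = 0

namespace IsDualFamily

variable {φ : ι → Γ →+ ℚ} {v : ι → Γ} {B D U : Finset ι}

lemma mono (h : IsDualFamily φ v B D) (hU : U ⊆ B) : IsDualFamily φ v U D :=
  ⟨hU.trans h.subset, fun b hb => h.apply_self b (hU hb), fun b hb => h.apply_of_ne b (hU hb)⟩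

variable [DecidableEq ι]

lemma exists_coeff (h : IsDualFamily φ v B D) {g : Γ} (hg : g ∈ gen v D) :
    ∃ k : ι → ℤ, (∀ b ∈ B, φ b g = k b) ∧ g - ∑ b ∈ B, k b • v b ∈ gen v (D \ B) := by
  induction hg using AddSubgroup.closure_induction with
  | mem x hx =>
    obtain ⟨i, hi, rfl⟩ := hx
    by_cases hiB : i ∈ B
    · refine ⟨Pi.single i 1, fun b hb => ?_, ?_⟩
      · by_cases hib : i = b
        · subst hib; simp [h.apply_self i hiB]
        · rw [h.apply_of_ne b hb i hi hib, Pi.single_eq_of_ne (Ne.symm hib), Int.cast_zero]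
      · simp [Pi.single_apply, ite_smul, hiB]
    · refine ⟨0, fun b hb => ?_, ?_⟩
      · rw [h.apply_of_ne b hb i hi fun hib => hiB (hib ▸ hb)]; simp
      · simpa using apply_mem_gen v (Finset.mem_sdiff.2 ⟨hi, hiB⟩)
  | zero => exact ⟨0, by simp, by simp⟩
  | add x y _ _ hx hy =>
    obtain ⟨k, hk, hx⟩ := hx
    obtain ⟨l, hl, hy⟩ := hy
    refine ⟨k + l, fun b hb => by simp [hk b hb, hl b hb], ?_⟩
    convert add_mem hx hy using 1
    simp only [Pi.add_apply, add_smul, Finset.sum_add_distrib]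
    abel
  | neg x _ hx =>
    obtain ⟨k, hk, hx⟩ := hx
    refine ⟨-k, fun b hb => by simp [hk b hb], ?_⟩
    convert neg_mem hx using 1
    simp only [Pi.neg_apply, neg_smul, Finset.sum_neg_distrib]
    abel

lemma exists_int (h : IsDualFamily φ v B D) {g : Γ} (hg : g ∈ gen v D) {b : ι} (hb : b ∈ B) :
    ∃ k : ℤ, φ b g = k :=
  let ⟨k, hk, _⟩ := h.exists_coeff hg
  ⟨k b, hk b hb⟩

lemma mem_gen_sdiff (h : IsDualFamily φ v B D) {g : Γ} (hg : g ∈ gen v D)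
    (h0 : ∀ b ∈ B, φ b g = 0) : g ∈ gen v (D \ B) := by
  obtain ⟨k, hk, hg⟩ := h.exists_coeff hg
  have hk0 : ∀ b ∈ B, k b = 0 := fun b hb => by
    have := hk b hb
    rw [h0 b hb] at this
    exact_mod_cast this.symm
  rwa [Finset.sum_eq_zero fun b hb => by rw [hk0 b hb, zero_smul], sub_zero] at hg

lemma mem_sat_sdiff (h : IsDualFamily φ v B D) {g : Γ} :
    g ∈ sat v (D \ B) ↔ g ∈ sat v D ∧ ∀ b ∈ B, φ b g = 0 := by
  constructor
  · refine fun hg => ⟨sat_mono v Finset.sdiff_subset hg, fun b hb => ?_⟩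
    obtain ⟨n, hn, hg⟩ := mem_sat.1 hg
    have hle : gen v (D \ B) ≤ (φ b).ker := by
      refine (AddSubgroup.closure_le _).2 ?_
      rintro _ ⟨i, hi, rfl⟩
      obtain ⟨hiD, hiB⟩ := Finset.mem_sdiff.1 hi
      exact h.apply_of_ne b hb i hiD fun hib => hiB (hib ▸ hb)
    have h0 : φ b (n • g) = 0 := hle hg
    rw [map_nsmul, smul_eq_zero] at h0
    exact h0.resolve_left hn.ne'
  · rintro ⟨hg, h0⟩
    obtain ⟨n, hn, hg⟩ := mem_sat.1 hg
    exact mem_sat.2 ⟨n, hn, h.mem_gen_sdiff hg fun b hb => by rw [map_nsmul, h0 b hb, smul_zero]⟩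

lemma rkZ_sdiff_add_card [Fintype ι] [Module.Finite ℤ Γ] (h : IsDualFamily φ v B D) :
    rkZ v (D \ B) + B.card = rkZ v D := by
  induction B using Finset.induction_on with
  | empty => simp
  | insert b B hb ih =>
    have hins : insert b (D \ insert b B) = D \ B := by
      have := h.subset (Finset.mem_insert_self b B)
      ext i
      simp only [Finset.mem_insert, Finset.mem_sdiff]
      grind
    have hsat : v b ∉ sat v (D \ insert b B) := fun hv => by
      have h0 := (h.mem_sat_sdiff.1 hv).2 b (Finset.mem_insert_self b B)
      rw [h.apply_self b (Finset.mem_insert_self b B)] at h0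
      exact one_ne_zero h0
    classical
    have hr := rkZ_insert v (D \ insert b B) b
    rw [if_neg hsat, hins] at hr
    rw [← ih (h.mono (Finset.subset_insert b B)), Finset.card_insert_of_notMem hb, hr]
    ring

lemma mem_map_sat_sdiff (h : IsDualFamily φ v B D) (q : Γ ⧸ gen v D) :
    q ∈ (sat v (D \ B)).map (QuotientAddGroup.mk' (gen v D)) ↔
      q ∈ AddCommGroup.torsion (Γ ⧸ gen v D) ∧ ∀ b ∈ B, ∃ k : ℤ, φ b q.out = k := by
  constructor
  · rintro ⟨g, hg, rfl⟩
    obtain ⟨hgD, h0⟩ := h.mem_sat_sdiff.1 hg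
    refine ⟨hgD, fun b hb => ?_⟩
    obtain ⟨x, hx⟩ := QuotientAddGroup.mk_out_eq_add (gen v D) g
    obtain ⟨k, hk⟩ := h.exists_int x.2 hb
    refine ⟨k, ?_⟩
    rw [QuotientAddGroup.mk'_apply, hx, map_add, h0 b hb, hk, zero_add]
  · rintro ⟨hq, hk⟩
    choose! k hk using hk
    have hsum : ∑ b ∈ B, k b • v b ∈ gen v D :=
      sum_mem fun b hb => zsmul_mem (apply_mem_gen v (h.subset hb)) _
    refine ⟨q.out - ∑ b ∈ B, k b • v b, h.mem_sat_sdiff.2 ⟨sub_mem ?_ (gen_le_sat v D hsum), ?_⟩, ?_⟩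
    · change QuotientAddGroup.mk' (gen v D) q.out ∈ AddCommGroup.torsion _
      rwa [QuotientAddGroup.mk'_apply, QuotientAddGroup.out_eq']
    · intro b hb
      rw [map_sub, map_sum, Finset.sum_eq_single_of_mem b hb, map_zsmul, h.apply_self b hb, hk b hb]
      · simp
      · intro c hc hcb
        rw [map_zsmul, h.apply_of_ne b hb c (h.subset hc) hcb, smul_zero]
    · rw [map_sub, QuotientAddGroup.mk'_apply, QuotientAddGroup.out_eq', sub_eq_self]
      exact (QuotientAddGroup.eq_zero_iff _).2 hsum

lemma mZ_sdiff [Fintype ι] (h : IsDualFamily φ v B D) :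
    mZ v (D \ B) = Nat.card {q : AddCommGroup.torsion (Γ ⧸ gen v D) //
      ∀ b ∈ B, ∃ k : ℤ, φ b (q : Γ ⧸ gen v D).out = k} := by
  have hinf : gen v D ⊓ sat v (D \ B) = gen v (D \ B) :=
    le_antisymm (fun g hg => h.mem_gen_sdiff hg.1 (h.mem_sat_sdiff.1 hg.2).2)
      (le_inf (gen_mono v Finset.sdiff_subset) (gen_le_sat v _))
  have hker := AddSubgroup.relIndex_ker (sat v (D \ B)) (QuotientAddGroup.mk' (gen v D))
  rw [QuotientAddGroup.ker_mk'] at hker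
  rw [mZ_eq_relIndex, ← hinf, AddSubgroup.inf_relIndex_right, hker]
  refine Nat.card_congr ((Equiv.subtypeEquivRight fun q => h.mem_map_sat_sdiff q).trans
    (Equiv.subtypeSubtypeEquivSubtypeInter _ _).symm)

/-- The multiplicity of a molecule factors. -/
lemma mZ_union_mul [Fintype ι] (h : IsDualFamily φ v B D) {S : Finset ι}
    (hS : ∀ s ∈ S, v s ∈ sat v (D \ B)) :
    mZ v (D \ B) * mZ v (D ∪ S) = mZ v D * mZ v (D \ B ∪ S) := by
  have hsat := sat_union_eq hS
  have hsat' := sat_union_eq fun s hs => sat_mono v (Finset.sdiff_subset (t := B)) (hS s hs)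
  have hinf : gen v D ⊓ gen v (D \ B ∪ S) = gen v (D \ B) :=
    le_antisymm
      (fun g hg => h.mem_gen_sdiff hg.1 (h.mem_sat_sdiff.1 (hsat ▸ gen_le_sat v _ hg.2)).2)
      (le_inf (gen_mono v Finset.sdiff_subset) (gen_mono v Finset.subset_union_left))
  have hsup : gen v (D ∪ S) = gen v (D \ B ∪ S) ⊔ gen v D := by
    rw [← gen_union]
    congr 1
    ext i
    simp only [Finset.mem_union, Finset.mem_sdiff]
    tauto
  have h1 := AddSubgroup.relIndex_mul_relIndex (gen v D) (gen v (D ∪ S)) (sat v D)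
    (gen_mono v Finset.subset_union_left) (hsat' ▸ gen_le_sat v _)
  have h2 := AddSubgroup.relIndex_mul_relIndex (gen v (D \ B)) (gen v (D \ B ∪ S))
    (sat v (D \ B)) (gen_mono v Finset.subset_union_left) (hsat ▸ gen_le_sat v _)
  have h3 : (gen v D).relIndex (gen v (D ∪ S)) = (gen v (D \ B)).relIndex (gen v (D \ B ∪ S)) := by
    rw [hsup, AddSubgroup.relIndex_sup_right, ← AddSubgroup.inf_relIndex_right, hinf]
  simp only [mZ_eq_relIndex, hsat, hsat']
  rw [← h1, ← h2, h3]
  ring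

end IsDualFamily

lemma rkZ_union [Fintype ι] [DecidableEq ι] [Module.Finite ℤ Γ] {v : ι → Γ} {A S : Finset ι}
    (hS : ∀ s ∈ S, v s ∈ sat v A) : rkZ v (A ∪ S) = rkZ v A := by
  classical
  induction S using Finset.induction_on with
  | empty => simp
  | insert s S hs ih =>
    have hr := rkZ_insert v (A ∪ S) s
    rw [if_pos (sat_mono v Finset.subset_union_left (hS s (Finset.mem_insert_self s S))),
      ih fun t ht => hS t (Finset.mem_insert_of_mem ht)] at hr
    rw [Finset.union_insert]
    exact hr

/-- Characters of `H` trivial on `K` are characters of `H ⧸ K`. -/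
lemma card_addChar_trivial_on {H : Type*} [AddCommGroup H] (K : AddSubgroup H)
    [Finite (H ⧸ K)] :
    Nat.card {χ : AddChar H ℂ // ∀ k ∈ K, χ k = 1} = K.index := by
  have := Fintype.ofFinite (H ⧸ K)
  rw [AddSubgroup.index, Nat.card_eq_fintype_card (α := H ⧸ K), ← AddChar.card_eq,
    ← Nat.card_eq_fintype_card]
  symm
  refine Nat.card_congr (Equiv.ofBijective (fun ψ => ⟨ψ.compAddMonoidHom (QuotientAddGroup.mk' K),
    fun k hk => ?_⟩) ⟨fun ψ ψ' h => ?_, fun χ => ?_⟩)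
  · rw [AddChar.compAddMonoidHom_apply, QuotientAddGroup.mk'_apply,
      (QuotientAddGroup.eq_zero_iff k).2 hk, AddChar.map_zero_eq_one]
  · refine AddChar.compAddMonoidHom_injective_left _ (QuotientAddGroup.mk'_surjective K) ?_
    exact congrArg Subtype.val h
  · refine ⟨AddChar.toAddMonoidHomEquiv.symm
      (QuotientAddGroup.lift K χ.1.toAddMonoidHom fun k hk => χ.2 k hk), ?_⟩
    ext x
    rfl

/-- For torsion vectors `S` over `A`, the multiplicity counts the characters of `sat v A` trivial
on `A` that are also trivial on `S`. -/
lemma mZ_union [Fintype ι] [DecidableEq ι] [Module.Finite ℤ Γ] {v : ι → Γ} {A S : Finset ι}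
    (hS : ∀ s ∈ S, v s ∈ sat v A) :
    mZ v (A ∪ S) = Nat.card {χ : {χ : AddChar (sat v A) ℂ //
        ∀ k ∈ (gen v A).addSubgroupOf (sat v A), χ k = 1} //
      ∀ s ∈ S, ∃ h : v s ∈ sat v A, χ.1 ⟨v s, h⟩ = 1} := by
  have hidx : mZ v (A ∪ S) = ((gen v (A ∪ S)).addSubgroupOf (sat v A)).index := by
    rw [mZ_eq_relIndex, sat_union_eq hS]
    rfl
  have : Finite (sat v A ⧸ (gen v (A ∪ S)).addSubgroupOf (sat v A)) :=
    Nat.finite_of_card_ne_zero (hidx.symm.trans_ne (mZ_pos v (A ∪ S)).ne')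
  rw [hidx, ← card_addChar_trivial_on]
  refine Nat.card_congr ((Equiv.subtypeEquivRight fun χ => ?_).trans
    (Equiv.subtypeSubtypeEquivSubtypeInter _
      fun χ : AddChar (sat v A) ℂ => ∀ s ∈ S, ∃ h : v s ∈ sat v A, χ ⟨v s, h⟩ = 1).symm)
  constructor
  · exact fun h => ⟨fun k hk => h k (gen_mono v Finset.subset_union_left hk),
      fun s hs => ⟨hS s hs, h _ (apply_mem_gen v (Finset.mem_union_right A hs))⟩⟩
  · rintro ⟨hA, hχ⟩ k hk
    have hle : gen v (A ∪ S) ≤ χ.toAddMonoidHom.ker.map (sat v A).subtype := by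
      refine (AddSubgroup.closure_le _).2 ?_
      rintro _ ⟨i, hi, rfl⟩
      rcases Finset.mem_union.1 hi with hi | hi
      · exact ⟨⟨v i, gen_le_sat v A (apply_mem_gen v hi)⟩, hA _ (apply_mem_gen v hi), rfl⟩
      · obtain ⟨h, hi⟩ := hχ i hi
        exact ⟨⟨v i, h⟩, hi, rfl⟩
    obtain ⟨k', hk', hkk⟩ := hle hk
    rw [← Subtype.ext hkk]
    exact hk'

open MvPolynomial

lemma coeff_mul_nonneg {p q : MvPolynomial (Fin 2) ℤ} (hp : ∀ d, 0 ≤ p.coeff d)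
    (hq : ∀ d, 0 ≤ q.coeff d) (d : Fin 2 →₀ ℕ) : 0 ≤ (p * q).coeff d := by
  classical
  rw [coeff_mul]
  exact Finset.sum_nonneg fun x _ => mul_nonneg (hp _) (hq _)

/-- If `f U` counts the `q` satisfying `P q b` for all `b ∈ U`, then `∑ f U (X - 1) ^ |U|` is a sum of
powers of `X`, so its coefficients are nonnegative. -/
lemma coeff_sum_powerset_nonneg {Q : Type*} [Finite Q] (P : Q → ι → Prop) (B : Finset ι)
    (f : Finset ι → ℕ) (hf : ∀ U ⊆ B, f U = Nat.card {q : Q // ∀ b ∈ U, P q b}) (j : Fin 2)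
    (d : Fin 2 →₀ ℕ) :
    0 ≤ (∑ U ∈ B.powerset, C (f U : ℤ) * (X j - 1) ^ U.card :
      MvPolynomial (Fin 2) ℤ).coeff d := by
  classical
  have := Fintype.ofFinite Q
  have key : (∑ U ∈ B.powerset, C (f U : ℤ) * (X j - 1) ^ U.card : MvPolynomial (Fin 2) ℤ) =
      ∑ q : Q, X j ^ (B.filter (P q)).card := by
    calc _ = ∑ U ∈ B.powerset, ∑ q : Q,
          if ∀ b ∈ U, P q b then (X j - 1 : MvPolynomial (Fin 2) ℤ) ^ U.card else 0 := by
          refine Finset.sum_congr rfl fun U hU => ?_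
          rw [hf U (Finset.mem_powerset.1 hU), Nat.card_eq_fintype_card, Fintype.card_subtype,
            ← Finset.sum_filter, Finset.sum_const, nsmul_eq_mul]
          simp
      _ = _ := by
          rw [Finset.sum_comm]
          refine Finset.sum_congr rfl fun q _ => ?_
          have hfilter : B.powerset.filter (fun U => ∀ b ∈ U, P q b) =
              (B.filter (P q)).powerset := by
            ext U
            simp only [Finset.mem_filter, Finset.mem_powerset, Finset.subset_iff]
            grind
          have h := Finset.sum_pow_mul_eq_add_pow (X j - 1 : MvPolynomial (Fin 2) ℤ) 1
            (B.filter (P q))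
          rw [← Finset.sum_filter, hfilter]
          simpa using h
  rw [key, coeff_sum]
  refine Finset.sum_nonneg fun q _ => ?_
  rw [coeff_X_pow]
  split_ifs <;> norm_num

/-- The multiplicity Tutte polynomial of the list `D \ A` in the quotient of `Γ` by `A`. -/
noncomputable def tuttePoly [Fintype ι] [DecidableEq ι] (v : ι → Γ) (A D : Finset ι) :
    MvPolynomial (Fin 2) ℤ :=
  ∑ E ∈ Finset.Icc A D, C (mZ v E : ℤ) * (X 0 - 1) ^ (rkZ v D - rkZ v E) *
    (X 1 - 1) ^ (E.card + rkZ v A - (A.card + rkZ v E))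

section

variable [Fintype ι] [DecidableEq ι] [Module.Finite ℤ Γ]

lemma tuttePoly_deletion_contraction {v : ι → Γ} {A D : Finset ι} {b : ι}
    (hbD : b ∈ D) (hbA : b ∉ A) (h1 : v b ∉ sat v A) (h2 : v b ∈ sat v (D.erase b)) :
    tuttePoly v A D = tuttePoly v A (D.erase b) + tuttePoly v (insert b A) D := by
  classical
  have hD := rkZ_insert v (D.erase b) b
  rw [if_pos h2, Finset.insert_erase hbD, add_zero] at hD
  have hA := rkZ_insert v A b
  rw [if_neg h1] at hA
  have hunion : Finset.Icc A D = Finset.Icc A (D.erase b) ∪ Finset.Icc (insert b A) D := by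
    ext E
    simp only [Finset.mem_union, Finset.mem_Icc, Finset.subset_iff,
      Finset.mem_erase, Finset.mem_insert]
    grind
  have hdisj : Disjoint (Finset.Icc A (D.erase b)) (Finset.Icc (insert b A) D) := by
    refine Finset.disjoint_left.2 fun E h h' => ?_
    have hb := (Finset.mem_Icc.1 h').1 (Finset.mem_insert_self b A)
    exact Finset.notMem_erase b D ((Finset.mem_Icc.1 h).2 hb)
  rw [tuttePoly, hunion, Finset.sum_union hdisj]
  congr 1
  · rw [tuttePoly, hD]
  · rw [tuttePoly]
    refine Finset.sum_congr rfl fun E _ => ?_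
    congr 2
    rw [hA, Finset.card_insert_of_notMem hbA]
    omega

/-- The multiplicity Tutte polynomial of a molecule is, up to the multiplicity of the contracted
set, the product of a polynomial in `x` and a polynomial in `y`. -/
lemma C_mul_tuttePoly_molecule {φ : ι → Γ →+ ℚ} {v : ι → Γ} {A B T : Finset ι}
    (hAB : Disjoint A B) (hAT : Disjoint A T) (hBT : Disjoint B T)
    (h : IsDualFamily φ v B (A ∪ B)) (hT : ∀ t ∈ T, v t ∈ sat v A) :
    C (mZ v A : ℤ) * tuttePoly v A (A ∪ B ∪ T) =
      (∑ U ∈ B.powerset, C (mZ v ((A ∪ B) \ U) : ℤ) * (X 0 - 1) ^ U.card) *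
        ∑ S ∈ T.powerset, C (mZ v (A ∪ S) : ℤ) * (X 1 - 1) ^ S.card := by
  rw [Finset.sum_mul_sum, ← Finset.sum_product', tuttePoly, Finset.mul_sum]
  symm
  refine Finset.sum_nbij' (fun p => (A ∪ B) \ p.1 ∪ p.2) (fun E => (B \ E, E ∩ T)) ?_ ?_ ?_ ?_ ?_
  · rintro ⟨U, S⟩ hp
    simp only [Finset.mem_product, Finset.mem_powerset, Finset.mem_Icc,
      Finset.subset_iff, Finset.mem_union, Finset.mem_sdiff, Finset.disjoint_left] at *
    grind
  · intro E hE
    simp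
  · rintro ⟨U, S⟩ hp
    simp only [Finset.mem_product, Finset.mem_powerset,
      Finset.subset_iff, Finset.disjoint_left, Prod.mk.injEq, Finset.ext_iff, Finset.mem_union,
      Finset.mem_sdiff, Finset.mem_inter] at *
    grind
  · intro E hE
    simp only [Finset.mem_Icc,
      Finset.subset_iff, Finset.disjoint_left, Finset.ext_iff, Finset.mem_union,
      Finset.mem_sdiff, Finset.mem_inter] at *
    grind
  · rintro ⟨U, S⟩ hp
    have hU : U ⊆ B := Finset.mem_powerset.1 (Finset.mem_product.1 hp).1
    have hS : S ⊆ T := Finset.mem_powerset.1 (Finset.mem_product.1 hp).2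
    have hA : ((A ∪ B) \ U) \ (B \ U) = A := by
      simp only [Finset.subset_iff, Finset.disjoint_left, Finset.ext_iff, Finset.mem_union,
        Finset.mem_sdiff] at *
      grind
    have hA' : (A ∪ B) \ B = A := Finset.union_sdiff_cancel_right hAB
    have hdual : IsDualFamily φ v (B \ U) ((A ∪ B) \ U) :=
      ⟨Finset.sdiff_subset_sdiff Finset.subset_union_right le_rfl,
        fun b hb => h.apply_self b (Finset.mem_sdiff.1 hb).1,
        fun b hb i hi => h.apply_of_ne b (Finset.mem_sdiff.1 hb).1 i (Finset.mem_sdiff.1 hi).1⟩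
    have hAU : A ⊆ (A ∪ B) \ U := Finset.sdiff_subset.trans' hA.ge
    have hm := hdual.mZ_union_mul (S := S) (by rw [hA]; exact fun s hs => hT s (hS hs))
    rw [hA] at hm
    have hr1 := h.rkZ_sdiff_add_card
    rw [hA'] at hr1
    have hr2 := (h.mono hU).rkZ_sdiff_add_card
    have hr3 : rkZ v ((A ∪ B) \ U ∪ S) = rkZ v ((A ∪ B) \ U) :=
      rkZ_union fun s hs => sat_mono v hAU (hT s (hS hs))
    have hr4 : rkZ v (A ∪ B ∪ T) = rkZ v (A ∪ B) :=
      rkZ_union fun s hs => sat_mono v Finset.subset_union_left (hT s hs)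
    have hc1 : ((A ∪ B) \ U ∪ S).card = ((A ∪ B) \ U).card + S.card :=
      Finset.card_union_of_disjoint (Finset.disjoint_of_subset_left Finset.sdiff_subset
        (Finset.disjoint_union_left.2 ⟨hAT.mono_right hS, hBT.mono_right hS⟩))
    have hc2 := Finset.card_sdiff_add_card_eq_card (hU.trans (Finset.subset_union_right (s₁ := A)))
    have hc3 := Finset.card_union_of_disjoint hAB
    have he1 : rkZ v (A ∪ B ∪ T) - rkZ v ((A ∪ B) \ U ∪ S) = U.card := by omega
    have he2 : ((A ∪ B) \ U ∪ S).card + rkZ v A - (A.card + rkZ v ((A ∪ B) \ U ∪ S)) = S.card := by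
      omega
    have hmC : (C (mZ v A : ℤ) * C (mZ v ((A ∪ B) \ U ∪ S) : ℤ) : MvPolynomial (Fin 2) ℤ) =
        C (mZ v ((A ∪ B) \ U) : ℤ) * C (mZ v (A ∪ S) : ℤ) := by
      rw [← C_mul, ← C_mul]
      exact_mod_cast congrArg (fun n : ℕ => (C (n : ℤ) : MvPolynomial (Fin 2) ℤ)) hm
    simp only [he1, he2]
    linear_combination -((X 0 - 1) ^ U.card * (X 1 - 1) ^ S.card) * hmC

lemma coeff_tuttePoly_molecule_nonneg {φ : ι → Γ →+ ℚ} {v : ι → Γ} {A B T : Finset ι}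
    (hAB : Disjoint A B) (hAT : Disjoint A T) (hBT : Disjoint B T)
    (h : IsDualFamily φ v B (A ∪ B)) (hT : ∀ t ∈ T, v t ∈ sat v A) (d : Fin 2 →₀ ℕ) :
    0 ≤ (tuttePoly v A (A ∪ B ∪ T)).coeff d := by
  have hfin : Finite (AddCommGroup.torsion (Γ ⧸ gen v (A ∪ B))) :=
    Nat.finite_of_card_ne_zero (mZ_pos v (A ∪ B)).ne'
  have hfin' : Finite {χ : AddChar (sat v A) ℂ //
      ∀ k ∈ (gen v A).addSubgroupOf (sat v A), χ k = 1} := by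
    have hpos := mZ_pos v (A ∪ ∅)
    rw [mZ_union (by simp)] at hpos
    have := Nat.finite_of_card_ne_zero hpos.ne'
    exact (Equiv.subtypeUnivEquiv fun _ => by simp).finite_iff.1 this
  have hmul := coeff_mul_nonneg
    (coeff_sum_powerset_nonneg _ B (fun U => mZ v ((A ∪ B) \ U))
      (fun U hU => (h.mono hU).mZ_sdiff) 0)
    (coeff_sum_powerset_nonneg _ T (fun S => mZ v (A ∪ S))
      (fun S hS => mZ_union fun s hs => hT s (hS hs)) 1) d
  rw [← C_mul_tuttePoly_molecule hAB hAT hBT h hT, coeff_C_mul] at hmul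
  exact nonneg_of_mul_nonneg_right hmul (by exact_mod_cast mZ_pos v A)

theorem coeff_tuttePoly_nonneg (v : ι → Γ) {A D : Finset ι} (hAD : A ⊆ D) (d : Fin 2 →₀ ℕ) :
    0 ≤ (tuttePoly v A D).coeff d := by
  classical
  induction hn : (D \ A).card using Nat.strong_induction_on generalizing A D with
  | _ n ih =>
    subst hn
    by_cases hex : ∃ b ∈ D \ A, v b ∉ sat v A ∧ v b ∈ sat v (D.erase b)
    · obtain ⟨b, hb, h1, h2⟩ := hex
      obtain ⟨hbD, hbA⟩ := Finset.mem_sdiff.1 hb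
      rw [tuttePoly_deletion_contraction hbD hbA h1 h2, coeff_add]
      refine add_nonneg (ih _ (Finset.card_lt_card ?_) ?_ rfl) (ih _ (Finset.card_lt_card ?_) ?_ rfl)
      · rw [Finset.erase_sdiff_comm]
        exact Finset.erase_ssubset hb
      · exact Finset.subset_erase.2 ⟨hAD, hbA⟩
      · rw [Finset.sdiff_insert]
        exact Finset.erase_ssubset hb
      · exact Finset.insert_subset hbD hAD
    · push Not at hex
      set B := (D \ A).filter fun b => v b ∉ sat v A with hB
      set T := (D \ A).filter fun b => v b ∈ sat v A with hT
      have hD : A ∪ B ∪ T = D := by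
        ext i
        have := @hAD i
        simp only [hB, hT, Finset.mem_union, Finset.mem_filter, Finset.mem_sdiff]
        tauto
      have hφ : ∀ b, ∃ φ : Γ →+ ℚ, b ∈ B → φ (v b) = 1 ∧ ∀ i ∈ D.erase b, φ (v i) = 0 := by
        intro b
        by_cases hb : b ∈ B
        · obtain ⟨hbD, hbA⟩ := Finset.mem_filter.1 hb
          obtain ⟨φ, hφ⟩ := exists_functional (hex b hbD hbA)
          exact ⟨φ, fun _ => hφ⟩
        · exact ⟨0, fun h => absurd h hb⟩
      choose φ hφ using hφ
      have hdual : IsDualFamily φ v B (A ∪ B) :=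
        ⟨Finset.subset_union_right, fun b hb => (hφ b hb).1, fun b hb i hi hib => (hφ b hb).2 i
          (Finset.mem_erase.2 ⟨hib, hD ▸ Finset.mem_union_left T hi⟩)⟩
      rw [← hD]
      refine coeff_tuttePoly_molecule_nonneg ?_ ?_ ?_ hdual (fun t ht => (Finset.mem_filter.1 ht).2) d
      · exact Finset.disjoint_sdiff.mono_right (Finset.filter_subset _ _)
      · exact Finset.disjoint_sdiff.mono_right (Finset.filter_subset _ _)
      · exact (Finset.disjoint_filter_filter_not _ _ _).symm

end

lemma MGammaPoly_eq_tuttePoly [Fintype ι] [DecidableEq ι] (v : ι → Γ) :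
    MGammaPoly v = tuttePoly v ∅ Finset.univ := by
  have h0 : rkZ v ∅ = 0 := by
    rw [rkZ, Finset.coe_empty, Set.image_empty, AddSubgroup.closure_empty]
    exact Module.finrank_zero_of_subsingleton
  have hIcc : Finset.Icc ∅ (Finset.univ : Finset ι) = Finset.univ := Finset.Icc_bot_top
  simp [MGammaPoly, tuttePoly, h0, hIcc]

end MultiplicityTutte

/-- The multiplicity Tutte polynomial of a finite list of elements of a finitely generated
abelian group has nonnegative coefficients. -/
theorem stmt5 {Γ : Type*} [AddCommGroup Γ] [AddGroup.FG Γ] {ι : Type*} [Fintype ι]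
    (v : ι → Γ) (d : Fin 2 →₀ ℕ) :
    0 ≤ (MGammaPoly v).coeff d := by
  classical
  have : Module.Finite ℤ Γ := Module.Finite.iff_addGroup_fg.2 inferInstance
  rw [MultiplicityTutte.MGammaPoly_eq_tuttePoly]
  exact MultiplicityTutte.coeff_tuttePoly_nonneg v (Finset.subset_univ ∅) d
end

section
/- Let X be a set of n vectors in ℤ^n forming a basis of ℝ^n. For A ⊆ X let h(A) be the number of points of ℤ^n lying in the relatively open parallelepiped {Σ_{a∈A} t_a a : 0 < t_a < 1 for all a ∈ A}. Then M_X(x,1) = Σ_{k=0}^{n} ( Σ_{A ⊆ X, |A| = n−k} h(A) ) x^k. -/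
/-- `h(A)`: the number of integer points in the relatively open parallelepiped spanned by the
vectors of the sublist `A`. -/
noncomputable def hpts {n : ℕ} (X : Fin n → Fin n → ℤ) (A : Finset (Fin n)) : ℕ :=
  Nat.card {x : Fin n → ℤ | ∃ t : {i : Fin n // i ∈ A} → ℝ,
    (∀ i, t i ∈ Set.Ioo (0 : ℝ) 1) ∧
    (fun j => (x j : ℝ)) = ∑ i, t i • (fun j => (X i.1 j : ℝ))}

open Module

section ParallelepipedPoints

variable {n : ℕ} (X : Fin n → Fin n → ℤ) (b : Basis (Fin n) ℝ (Fin n → ℝ))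

/-- The coordinates of integer vectors with respect to a basis of `ℝ^n`, as a `ℤ`-linear map. -/
noncomputable def intCoord : (Fin n → ℤ) →ₗ[ℤ] (Fin n → ℝ) :=
  (b.equivFun.toLinearMap.restrictScalars ℤ) ∘ₗ
    ((Int.castAddHom ℝ).toIntLinearMap.compLeft (Fin n))

theorem intCoord_apply (z : Fin n → ℤ) :
    intCoord b z = b.equivFun (fun j => (z j : ℝ)) := rfl

theorem intCoord_injective : Function.Injective (intCoord b) := by
  intro z z' h
  have h' := b.equivFun.injective h
  ext j
  exact Int.cast_injective (α := ℝ) (congrFun h' j)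

variable {X b}

theorem intCoord_basis (hb : ∀ i, b i = fun j => (X i j : ℝ)) (i : Fin n) :
    intCoord b (X i) = Pi.single i 1 := by
  rw [intCoord_apply, ← hb]
  ext k
  simp [Pi.single_apply, eq_comm]

theorem intCoord_sum (hb : ∀ i, b i = fun j => (X i j : ℝ)) (w : Fin n → ℤ) :
    intCoord b (∑ i, w i • X i) = fun i => (w i : ℝ) := by
  simp only [map_sum, map_smul, intCoord_basis hb]
  ext k
  simp [Pi.single_apply]

theorem mem_span_image_iff (hb : ∀ i, b i = fun j => (X i j : ℝ)) (A : Finset (Fin n))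
    (z : Fin n → ℤ) :
    z ∈ Submodule.span ℤ (X '' ↑A) ↔
      ∃ w : Fin n → ℤ, (∀ i ∉ A, w i = 0) ∧ intCoord b z = fun i => (w i : ℝ) := by
  constructor
  · intro hz
    induction hz using Submodule.span_induction with
    | mem y hy =>
      obtain ⟨i, hi, rfl⟩ := hy
      refine ⟨Pi.single i 1, fun k hk => ?_, ?_⟩
      · exact Pi.single_eq_of_ne (fun h : k = i => hk (h ▸ hi)) _
      · rw [intCoord_basis hb]
        ext k
        by_cases h : k = i <;> simp [h]
    | zero => exact ⟨0, by simp, by ext; simp⟩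
    | add y y' _ _ hy hy' =>
      obtain ⟨w, hw, e⟩ := hy
      obtain ⟨w', hw', e'⟩ := hy'
      exact ⟨w + w', fun i hi => by simp [hw i hi, hw' i hi], by rw [map_add, e, e']; ext; simp⟩
    | smul a y _ hy =>
      obtain ⟨w, hw, e⟩ := hy
      exact ⟨a • w, fun i hi => by simp [hw i hi], by rw [map_smul, e]; ext; simp⟩
  · rintro ⟨w, hw, e⟩
    rw [← intCoord_sum hb w] at e
    rw [intCoord_injective b e]
    refine Submodule.sum_mem _ fun i _ => ?_
    by_cases hi : i ∈ A
    · exact Submodule.smul_mem _ _ (Submodule.subset_span ⟨i, hi, rfl⟩)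
    · simp [hw i hi]

theorem exists_int_smul_intCoord (hb : ∀ i, b i = fun j => (X i j : ℝ)) :
    ∃ d : ℤ, d ≠ 0 ∧ ∀ z, ∃ w : Fin n → ℤ, d • intCoord b z = fun i => (w i : ℝ) := by
  refine ⟨(Matrix.of X).det, ?_, fun z => ⟨Matrix.vecMul z (Matrix.of X).adjugate, ?_⟩⟩
  · intro h
    have hli : LinearIndependent ℝ ((Matrix.of X).map (Int.cast : ℤ → ℝ)).row := by
      convert b.linearIndependent using 1
      ext i j
      simp [hb, Matrix.row]
    have hu := Matrix.linearIndependent_rows_iff_isUnit.mp hli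
    rw [Matrix.isUnit_iff_isUnit_det] at hu
    have hd : ((Matrix.of X).map (Int.cast : ℤ → ℝ)).det = (((Matrix.of X).det : ℤ) : ℝ) :=
      ((Int.castRingHom ℝ).map_det (Matrix.of X)).symm
    rw [hd, h] at hu
    simp at hu
  · rw [← intCoord_sum hb, ← map_smul]
    congr 1
    have h : Matrix.vecMul (Matrix.vecMul z (Matrix.of X).adjugate) (Matrix.of X) =
        (Matrix.of X).det • z := by
      rw [Matrix.vecMul_vecMul, Matrix.adjugate_mul, Matrix.vecMul_smul, Matrix.vecMul_one]
    rw [← h]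
    ext j
    simp [Matrix.vecMul, dotProduct]

variable (b) in
/-- The integer points of the half-open parallelepiped spanned by the basis vectors in `A`. -/
def halfOpenPts (A : Finset (Fin n)) : Set (Fin n → ℤ) :=
  {z | ∀ i, intCoord b z i ∈ Set.Ico (0 : ℝ) 1 ∧ (i ∉ A → intCoord b z i = 0)}

variable (b) in
/-- The integer points of the relatively open parallelepiped spanned by the basis vectors
in `A`. -/
def openPts (A : Finset (Fin n)) : Set (Fin n → ℤ) :=
  {z | ∀ i, (i ∈ A → intCoord b z i ∈ Set.Ioo (0 : ℝ) 1) ∧ (i ∉ A → intCoord b z i = 0)}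

theorem mk_mem_torsion_iff (hb : ∀ i, b i = fun j => (X i j : ℝ)) (A : Finset (Fin n))
    (z : Fin n → ℤ) :
    (Submodule.Quotient.mk z : (Fin n → ℤ) ⧸ Submodule.span ℤ (X '' ↑A)) ∈
      Submodule.torsion ℤ ((Fin n → ℤ) ⧸ Submodule.span ℤ (X '' ↑A)) ↔
      ∀ i ∉ A, intCoord b z i = 0 := by
  have key : ∀ a : ℤ,
      a • (Submodule.Quotient.mk z : (Fin n → ℤ) ⧸ Submodule.span ℤ (X '' ↑A)) = 0 ↔
      a • z ∈ Submodule.span ℤ (X '' ↑A) := fun a => by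
    rw [← Submodule.Quotient.mk_smul, Submodule.Quotient.mk_eq_zero]
  rw [Submodule.mem_torsion_iff]
  constructor
  · rintro ⟨⟨a, ha⟩, h⟩ i hi
    obtain ⟨w, hw, e⟩ := (mem_span_image_iff hb A _).mp ((key a).mp h)
    have e' := congrFun e i
    rw [map_smul, hw i hi] at e'
    simpa [nonZeroDivisors.ne_zero ha] using e'
  · intro h
    obtain ⟨d, hd, hw⟩ := exists_int_smul_intCoord hb
    obtain ⟨w, e⟩ := hw z
    refine ⟨⟨d, mem_nonZeroDivisors_of_ne_zero hd⟩, (key d).mpr ?_⟩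
    refine (mem_span_image_iff hb A _).mpr ⟨w, fun i hi => ?_, by rw [map_smul, e]⟩
    have e' := congrFun e i
    simp only [Pi.smul_apply, h i hi, smul_zero] at e'
    exact_mod_cast e'.symm

theorem card_halfOpenPts (hb : ∀ i, b i = fun j => (X i j : ℝ)) (A : Finset (Fin n)) :
    Nat.card (halfOpenPts b A) = mult X A := by
  refine Nat.card_congr (Equiv.ofBijective (fun z => ⟨Submodule.Quotient.mk z.1,
    (mk_mem_torsion_iff hb A z.1).mpr fun i hi => (z.2 i).2 hi⟩) ⟨?_, ?_⟩)
  · rintro ⟨z, hz⟩ ⟨z', hz'⟩ h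
    have h' := (Submodule.Quotient.eq _).mp (Subtype.ext_iff.mp h)
    obtain ⟨w, -, e⟩ := (mem_span_image_iff hb A _).mp h'
    refine Subtype.ext (intCoord_injective b ?_)
    ext i
    have e' := congrFun e i
    simp only [map_sub, Pi.sub_apply] at e'
    obtain ⟨h0, h1⟩ := (hz i).1
    obtain ⟨h0', h1'⟩ := (hz' i).1
    have hlt : (w i : ℝ) < 1 := by linarith
    have hgt : (-1 : ℝ) < w i := by linarith
    have hw : w i = 0 := by
      have : w i < 1 := by exact_mod_cast hlt
      have : -1 < w i := by exact_mod_cast hgt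
      omega
    rw [hw, Int.cast_zero] at e'
    linarith
  · rintro ⟨q, hq⟩
    obtain ⟨z, rfl⟩ := Submodule.Quotient.mk_surjective _ q
    have hz := (mk_mem_torsion_iff hb A z).mp hq
    have e := intCoord_sum hb fun i => ⌊intCoord b z i⌋
    refine ⟨⟨z - ∑ i, ⌊intCoord b z i⌋ • X i, fun i => ?_⟩, Subtype.ext ?_⟩
    · rw [map_sub, e]
      exact ⟨⟨Int.fract_nonneg _, Int.fract_lt_one _⟩, fun hi => by simp [hz i hi]⟩
    · refine (Submodule.Quotient.eq _).mpr ((mem_span_image_iff hb A _).mpr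
        ⟨fun i => -⌊intCoord b z i⌋, fun i hi => by simp [hz i hi], ?_⟩)
      rw [sub_sub_cancel_left, map_neg, e]
      ext
      simp

theorem halfOpenPts_finite (hb : ∀ i, b i = fun j => (X i j : ℝ)) (A : Finset (Fin n)) :
    (halfOpenPts b A).Finite := by
  obtain ⟨d, hd, hw⟩ := exists_int_smul_intCoord hb
  choose w hw using hw
  refine Set.Finite.of_finite_image (f := w)
    ((Set.finite_Icc (fun _ => -|d|) fun _ => |d|).subset ?_)
    fun z _ z' _ h => intCoord_injective b ?_
  · rintro _ ⟨z, hz, rfl⟩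
    have h : ∀ i, |w z i| ≤ |d| := fun i => by
      have e := congrFun (hw z) i
      simp only [Pi.smul_apply, zsmul_eq_mul] at e
      have : |(w z i : ℝ)| ≤ |(d : ℝ)| := by
        rw [← e, abs_mul, abs_of_nonneg (hz i).1.1]
        exact mul_le_of_le_one_right (abs_nonneg _) (hz i).1.2.le
      exact_mod_cast this
    exact ⟨fun i => (abs_le.mp (h i)).1, fun i => (abs_le.mp (h i)).2⟩
  · have e : d • intCoord b z = d • intCoord b z' := by rw [hw, hw, h]
    exact smul_right_injective _ hd e

theorem openPts_subset_halfOpenPts {A B : Finset (Fin n)} (h : B ⊆ A) :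
    openPts b B ⊆ halfOpenPts b A := by
  intro z hz i
  by_cases hi : i ∈ B
  · exact ⟨Set.Ioo_subset_Ico_self ((hz i).1 hi), fun hA => absurd (h hi) hA⟩
  · rw [(hz i).2 hi]
    simp

theorem hpts_eq_card_openPts (hb : ∀ i, b i = fun j => (X i j : ℝ)) (A : Finset (Fin n)) :
    hpts X A = Nat.card (openPts b A) := by
  unfold hpts
  congr 2
  ext z
  simp only [Set.mem_ofPred_eq, openPts, ← hb]
  constructor
  · rintro ⟨t, ht, e⟩ i
    have hc : intCoord b z i = ∑ k : {k // k ∈ A}, if k.1 = i then t k else 0 := by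
      rw [intCoord_apply, e]
      simp [map_sum, Finsupp.single_apply]
    refine ⟨fun hi => ?_, fun hi => ?_⟩
    · rw [hc, Finset.sum_eq_single ⟨i, hi⟩ (fun k _ hk => if_neg fun h => hk (Subtype.ext h))
        (by simp)]
      simpa using ht ⟨i, hi⟩
    · rw [hc]
      exact Finset.sum_eq_zero fun k _ => if_neg fun h : k.1 = i => hi (h ▸ k.2)
  · intro h
    refine ⟨fun i => intCoord b z i, fun i => (h i).1 i.2, ?_⟩
    rw [Finset.sum_coe_sort A (fun i => intCoord b z i • b i),
      Finset.sum_subset (Finset.subset_univ A) (fun i _ hi => by rw [(h i).2 hi, zero_smul])]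
    exact (b.sum_equivFun _).symm

theorem mult_eq_sum_hpts (hb : ∀ i, b i = fun j => (X i j : ℝ)) (A : Finset (Fin n)) :
    mult X A = ∑ B ∈ A.powerset, hpts X B := by
  classical
  have hfin : ∀ B, (openPts b B).Finite := fun B =>
    (halfOpenPts_finite hb B).subset (openPts_subset_halfOpenPts subset_rfl)
  have hU : (halfOpenPts_finite hb A).toFinset =
      A.powerset.biUnion fun B => (hfin B).toFinset := by
    ext z
    simp only [Set.Finite.mem_toFinset, Finset.mem_biUnion, Finset.mem_powerset]
    constructor
    · intro hz
      refine ⟨A.filter fun i => intCoord b z i ≠ 0, Finset.filter_subset _ _, fun i => ?_⟩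
      have h := hz i
      simp only [Finset.mem_filter, not_and, not_not]
      refine ⟨fun hi => ⟨lt_of_le_of_ne h.1.1 hi.2.symm, h.1.2⟩, fun hi => ?_⟩
      by_cases hA : i ∈ A
      exacts [hi hA, h.2 hA]
    · rintro ⟨B, hB, hz⟩
      exact openPts_subset_halfOpenPts hB hz
  rw [← card_halfOpenPts hb, Nat.card_coe_set_eq, Set.ncard_eq_toFinset_card _
    (halfOpenPts_finite hb A), hU, Finset.card_biUnion]
  · refine Finset.sum_congr rfl fun B _ => ?_
    rw [hpts_eq_card_openPts hb, Nat.card_coe_set_eq, Set.ncard_eq_toFinset_card _ (hfin B)]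
  · intro B _ C _ hBC
    refine Finset.disjoint_left.mpr fun z hz hz' => hBC ?_
    rw [Set.Finite.mem_toFinset] at hz hz'
    have mem_iff : ∀ {D}, z ∈ openPts b D → ∀ i, i ∈ D ↔ intCoord b z i ≠ 0 := fun hD i =>
      ⟨fun hi => ((hD i).1 hi).1.ne', fun h => by_contra fun hi => h ((hD i).2 hi)⟩
    ext i
    rw [mem_iff hz, mem_iff hz']

end ParallelepipedPoints

theorem rnk_eq_card {n : ℕ} {ι : Type} [Fintype ι] {X : ι → Fin n → ℤ}
    (hind : LinearIndependent ℝ (fun i (j : Fin n) => (X i j : ℝ))) (A : Finset ι) :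
    rnk X A = A.card := by
  have h := finrank_span_eq_card (hind.comp ((↑) : A → ι) Subtype.val_injective)
  have hr : Set.range ((fun i (j : Fin n) => (X i j : ℝ)) ∘ ((↑) : A → ι)) =
      (fun i (j : Fin n) => (X i j : ℝ)) '' ↑A := by
    rw [Set.range_comp]
    simp
  rwa [hr, Fintype.card_coe] at h

theorem sum_superset_pow_compl {α : Type*} [Fintype α] [DecidableEq α] (B : Finset α) (x : ℝ) :
    ∑ A ∈ Finset.univ.filter (fun A => B ⊆ A), (x - 1) ^ (Fintype.card α - A.card) =
      x ^ (Fintype.card α - B.card) := by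
  have h := Finset.sum_pow_mul_eq_add_pow (x - 1) 1 Bᶜ
  rw [sub_add_cancel, Finset.card_compl] at h
  rw [← h]
  refine Finset.sum_bij' (fun A _ => Aᶜ) (fun A _ => Aᶜ) ?_ ?_ ?_ ?_ ?_
  · simp
  · intro A hA
    simpa [Finset.subset_compl_comm] using hA
  · simp
  · simp
  · intro A _
    simp [Finset.card_compl]

/-- If `X` is a set of `n` vectors in `ℤ^n` forming a basis of `ℝ^n`, then
`M_X(x,1) = Σ_{k=0}^n (Σ_{|A| = n−k} h(A)) x^k`. -/
theorem stmt7 {n : ℕ} (X : Fin n → Fin n → ℤ)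
    (hind : LinearIndependent ℝ (fun i (j : Fin n) => (X i j : ℝ)))
    (hspan : Submodule.span ℝ (Set.range (fun i (j : Fin n) => (X i j : ℝ))) = ⊤)
    (x : ℝ) :
    Mpoly X x 1 =
      ∑ k ∈ Finset.range (n + 1),
        (∑ A ∈ Finset.univ.filter (fun A : Finset (Fin n) => A.card = n - k),
          (hpts X A : ℝ)) * x ^ k := by
  have hb : ∀ i, Basis.mk hind hspan.ge i = fun j => (X i j : ℝ) := fun i => by simp
  have hM : Mpoly X x 1 = ∑ B : Finset (Fin n), (hpts X B : ℝ) * x ^ (n - B.card) := by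
    calc Mpoly X x 1
        = ∑ A : Finset (Fin n), ∑ B : Finset (Fin n),
            if B ⊆ A then (hpts X B : ℝ) * (x - 1) ^ (n - A.card) else 0 := by
          refine Finset.sum_congr rfl fun A _ => ?_
          rw [rnk_eq_card hind, rnk_eq_card hind, mult_eq_sum_hpts hb, ← Finset.sum_filter]
          have hf : Finset.univ.filter (fun B => B ⊆ A) = A.powerset := by ext; simp
          rw [hf]
          simp [Finset.sum_mul]
      _ = _ := by
          rw [Finset.sum_comm]
          refine Finset.sum_congr rfl fun B _ => ?_
          have h := sum_superset_pow_compl B x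
          rw [Fintype.card_fin] at h
          rw [← Finset.sum_filter, ← Finset.mul_sum, h]
  have hcard : ∀ B : Finset (Fin n), B.card ≤ n := fun B => by
    simpa using Finset.card_le_univ B
  rw [hM, ← Finset.sum_fiberwise_of_maps_to (s := Finset.univ) (t := Finset.range (n + 1))
    (g := fun B : Finset (Fin n) => n - B.card)
    (fun B _ => Finset.mem_range.mpr (by omega))]
  refine Finset.sum_congr rfl fun k hk => ?_
  rw [Finset.mem_range] at hk
  have hf : Finset.univ.filter (fun B : Finset (Fin n) => n - B.card = k) =
      Finset.univ.filter (fun B : Finset (Fin n) => B.card = n - k) :=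
    Finset.filter_congr fun B _ => by have := hcard B; omega
  rw [hf, Finset.sum_mul]
  refine Finset.sum_congr rfl fun B hB => ?_
  rw [Finset.mem_filter] at hB
  rw [hB.2, Nat.sub_sub_self (by omega)]
end

section
/- Let X be a finite list of vectors in ℤ^n whose ℝ-linear span is all of ℝ^n. Then the number of points of ℤ^n contained in the zonotope Z(X) equals M_X(2,1). -/
namespace ZonotopePoints

/-- Adding a generator `v` to a convex set `P` that is invariant under `S` and bounded in the
direction of `v`: the new cosets of `S` correspond to the cosets of `S ⊔ ℤ v` in `P + ℝ v`. -/
theorem encard_mkQ_image_add_segment {L V : Type*} [AddCommGroup L] [AddCommGroup V] [Module ℝ V]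
    (φ : L →+ V) (S : Submodule ℤ L) {P : Set V} (hP : Convex ℝ P) (v : L)
    (hS : ∀ s ∈ S, ∀ p ∈ P, p + φ s ∈ P)
    (hbdd : ∀ y : V, BddAbove {τ : ℝ | y + τ • φ v ∈ P}) :
    (S.mkQ '' {x | ∃ t ∈ Set.Icc (0 : ℝ) 1, φ x - t • φ v ∈ P}).encard =
      (S.mkQ '' {x | φ x ∈ P}).encard +
        ((S ⊔ Submodule.span ℤ {v}).mkQ '' {x | ∃ t : ℝ, φ x - t • φ v ∈ P}).encard := by
  set S' := S ⊔ Submodule.span ℤ {v} with hS'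
  set Q : Set L := {x | φ x ∈ P} with hQ
  set Q' : Set L := {x | ∃ t ∈ Set.Icc (0 : ℝ) 1, φ x - t • φ v ∈ P} with hQ'
  set Q'' : Set L := {x | ∃ t : ℝ, φ x - t • φ v ∈ P} with hQ''
  have hle : S ≤ S' := le_sup_left
  have hQS : ∀ s ∈ S, ∀ x ∈ Q, x + s ∈ Q := fun s hs x hx => by
    simpa [hQ] using hS s hs _ hx
  have hQ'S : ∀ s ∈ S, ∀ x ∈ Q', x + s ∈ Q' := by
    rintro s hs x ⟨t, ht, hx⟩
    refine ⟨t, ht, ?_⟩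
    have := hS s hs _ hx
    rwa [map_add, add_sub_right_comm]
  have hsub : Q ⊆ Q' := fun x hx => ⟨0, by simp, by simpa [hQ] using hx⟩
  have hsplit : S.mkQ '' Q' = S.mkQ '' Q ∪ S.mkQ '' (Q' \ Q) := by
    rw [← Set.image_union, Set.union_sdiff_cancel hsub]
  have hdisj : Disjoint (S.mkQ '' Q) (S.mkQ '' (Q' \ Q)) := by
    rw [Set.disjoint_left]
    rintro _ ⟨x, hx, rfl⟩ ⟨y, hy, hxy⟩
    refine hy.2 ?_
    have h : y - x ∈ S := (Submodule.Quotient.eq S).1 hxy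
    simpa using hQS _ h _ hx
  have hnot : ∀ x ∈ Q' \ Q, ∀ k : ℕ, x + ((k : ℤ) + 1) • v ∉ Q' := by
    rintro x ⟨⟨t', ht', hx'⟩, hx⟩ k ⟨t, ht, hk⟩
    refine hx ?_
    have hlow : φ x ∈ segment ℝ (φ x - t' • φ v) (φ x + ((k : ℝ) + 1 - t) • φ v) := by
      have hpos : 0 ≤ (k : ℝ) + 1 - t := by
        have := ht.2
        have : (0 : ℝ) ≤ k := k.cast_nonneg
        linarith
      rcases eq_or_lt_of_le ht'.1 with h0 | h0
      · rw [← h0]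
        simpa using left_mem_segment ℝ (φ x) _
      · have hd : 0 < t' + ((k : ℝ) + 1 - t) := by linarith
        refine ⟨((k : ℝ) + 1 - t) / (t' + ((k : ℝ) + 1 - t)), t' / (t' + ((k : ℝ) + 1 - t)),
          by positivity, by positivity, by field_simp; ring, ?_⟩
        match_scalars <;> field_simp <;> ring
    refine hP.segment_subset hx' ?_ hlow
    convert hk using 1
    rw [map_add, map_zsmul, ← Int.cast_smul_eq_zsmul ℝ]
    push_cast
    module
  have hinj : Set.InjOn (Submodule.factor hle) (S.mkQ '' (Q' \ Q)) := by
    have key : ∀ x ∈ Q' \ Q, ∀ y ∈ Q' \ Q, ∀ s ∈ S, ∀ k : ℤ, y = x + s + k • v → k ≤ 0 := by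
      intro x hx y hy s hs k hxy
      by_contra! hk
      obtain ⟨m, rfl⟩ : ∃ m : ℕ, k = (m : ℤ) + 1 := ⟨(k - 1).toNat, by lia⟩
      refine hnot x hx m ?_
      have := hQ'S (-s) (S.neg_mem hs) y hy.1
      rw [hxy] at this
      convert this using 1
      abel
    rintro _ ⟨x, hx, rfl⟩ _ ⟨y, hy, rfl⟩ hxy
    have h : x - y ∈ S' := (Submodule.Quotient.eq S').1 hxy
    obtain ⟨s, hs, z, hz, hsz⟩ := Submodule.mem_sup.1 h
    obtain ⟨k, rfl⟩ := Submodule.mem_span_singleton.1 hz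
    have h1 := key y hy x hx s hs k (by rw [add_assoc, hsz]; abel)
    have h2 := key x hx y hy (-s) (S.neg_mem hs) (-k) (by
      rw [neg_smul, add_assoc, ← neg_add, hsz]; abel)
    obtain rfl : k = 0 := by lia
    refine (Submodule.Quotient.eq S).2 ?_
    rw [← hsz]
    simpa using hs
  have himage : Submodule.factor hle '' (S.mkQ '' (Q' \ Q)) = S'.mkQ '' Q'' := by
    apply Set.Subset.antisymm
    · rintro _ ⟨_, ⟨x, ⟨⟨t, _, hx⟩, _⟩, rfl⟩, rfl⟩
      exact ⟨x, ⟨t, hx⟩, rfl⟩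
    · rintro _ ⟨x, ⟨t, hx⟩, rfl⟩
      obtain ⟨b, hb⟩ := hbdd (φ x)
      obtain ⟨j, ⟨τ, hτ, hjτ⟩, hj⟩ := Int.exists_greatest_of_bdd
        (P := fun j : ℤ => ∃ τ : ℝ, φ x + τ • φ v ∈ P ∧ (j : ℝ) ≤ τ)
        ⟨⌊b⌋, fun z ⟨τ, hτ, hz⟩ => Int.le_floor.2 (hz.trans (hb hτ))⟩
        ⟨⌊-t⌋, -t, by rwa [neg_smul, ← sub_eq_add_neg], Int.floor_le _⟩
      have hlt : τ < j + 1 := by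
        by_contra! h
        have := hj (j + 1) ⟨τ, hτ, by push_cast; exact h⟩
        lia
      have hφ : φ (x + (j + 1) • v) = φ x + ((j : ℝ) + 1) • φ v := by
        rw [map_add, map_zsmul, ← Int.cast_smul_eq_zsmul ℝ]
        push_cast
        rfl
      refine ⟨S.mkQ (x + (j + 1) • v), ⟨_, ⟨⟨j + 1 - τ, ⟨by linarith, by linarith⟩, ?_⟩, ?_⟩, rfl⟩,
        ?_⟩
      · rw [hφ]
        convert hτ using 1
        module
      · intro hmem
        have := hj (j + 1) ⟨(j : ℝ) + 1, by rw [← hφ]; exact hmem, by push_cast; rfl⟩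
        lia
      · refine (Submodule.Quotient.eq S').2 ?_
        rw [LinearMap.id_apply, add_sub_cancel_left]
        exact S'.smul_mem _ (Submodule.mem_sup_right (Submodule.mem_span_singleton_self v))
  rw [hsplit, Set.encard_union_eq hdisj, ← himage, hinj.encard_image]

variable {n : ℕ} {ι : Type}

/-- The inclusion `ℤ^n → ℝ^n`. -/
def toReal (n : ℕ) : (Fin n → ℤ) →+ (Fin n → ℝ) := (Int.castAddHom ℝ).compLeft (Fin n)

/-- An integer vector in the real span of integer vectors has a nonzero multiple in their
integer span. -/
theorem toReal_mem_span_iff (X : ι → Fin n → ℤ) (B : Finset ι) (x : Fin n → ℤ) :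
    toReal n x ∈ Submodule.span ℝ ((fun i => toReal n (X i)) '' ↑B) ↔
      ∃ k : ℤ, k ≠ 0 ∧ k • x ∈ Submodule.span ℤ (X '' ↑B) := by
  constructor
  · intro h
    obtain ⟨c, hc⟩ := (Submodule.mem_span_image_finset_iff_exists_fun ℝ).1 h
    obtain ⟨π, hπ⟩ := LinearMap.exists_leftInverse_of_injective
      (Algebra.linearMap ℚ ℝ) (LinearMap.ker_eq_bot.2 (algebraMap ℚ ℝ).injective)
    have hπ' (q : ℚ) : π (q : ℝ) = q := LinearMap.congr_fun hπ q
    have hrat (j : Fin n) : ∑ i, π (c i) * (X i j : ℚ) = (x j : ℚ) := by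
      have hj : ∑ i, c i * (X i j : ℝ) = (x j : ℝ) := by
        simpa [toReal] using congrFun hc j
      have hz (z : ℤ) : π (z : ℝ) = (z : ℚ) := by simpa using hπ' z
      have := congrArg π hj
      rw [map_sum, hz] at this
      rw [← this]
      refine Finset.sum_congr rfl fun i _ => ?_
      have : c i * (X i j : ℝ) = (X i j : ℤ) • c i := by simp [mul_comm]
      rw [this, map_zsmul]
      simp [mul_comm]
    obtain ⟨k, hk⟩ := IsLocalization.exist_integer_multiples_of_finite (nonZeroDivisors ℤ)
      (fun i : B => π (c i))
    choose d hd using hk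
    refine ⟨k, nonZeroDivisors.coe_ne_zero k,
      (Submodule.mem_span_image_finset_iff_exists_fun ℤ).2 ⟨d, ?_⟩⟩
    ext j
    have hd' (i : B) : (d i : ℚ) = (k : ℤ) * π (c i) := by
      simpa [Submonoid.smul_def] using hd i
    have : ((∑ i, d i * X i j : ℤ) : ℚ) = ((k : ℤ) * x j : ℤ) := by
      push_cast
      rw [← hrat j, Finset.mul_sum]
      exact Finset.sum_congr rfl fun i _ => by rw [hd' i, mul_assoc]
    simpa using Int.cast_injective this
  · rintro ⟨k, hk, h⟩
    have hmap : toReal n (k • x) ∈ Submodule.span ℝ ((fun i => toReal n (X i)) '' ↑B) := by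
      obtain ⟨d, hd⟩ := (Submodule.mem_span_image_finset_iff_exists_fun ℤ).1 h
      rw [← hd, map_sum]
      refine Submodule.sum_mem _ fun i _ => ?_
      rw [map_zsmul]
      exact zsmul_mem (Submodule.subset_span (Set.mem_image_of_mem _ i.2)) _
    rw [map_zsmul, ← Int.cast_smul_eq_zsmul ℝ] at hmap
    exact (Submodule.smul_mem_iff _ (Int.cast_ne_zero.2 hk)).1 hmap

/-- The zonotope of the vectors `u i`, `i ∈ C`, plus the span of the vectors `u i`, `i ∈ B`. -/
def cylinder {V : Type*} [AddCommGroup V] [Module ℝ V] (u : ι → V) (B C : Finset ι) : Set V :=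
  {y | ∃ t : ι → ℝ, (∀ i, t i ∈ Set.Icc (0 : ℝ) 1) ∧
    y - ∑ i ∈ C, t i • u i ∈ Submodule.span ℝ (u '' ↑B)}

section cylinder

variable {V : Type*} [AddCommGroup V] [Module ℝ V] (u : ι → V) (B C : Finset ι)

theorem cylinder_empty : cylinder u B ∅ = Submodule.span ℝ (u '' ↑B) := by
  ext y
  simp only [cylinder, Finset.sum_empty, sub_zero, Set.mem_ofPred_eq, SetLike.mem_coe]
  exact ⟨fun ⟨_, _, h⟩ => h, fun h => ⟨0, by simp, h⟩⟩

theorem convex_cylinder : Convex ℝ (cylinder u B C) := by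
  rintro x ⟨s, hs, hx⟩ y ⟨t, ht, hy⟩ a b ha hb hab
  refine ⟨fun i => a • s i + b • t i, fun i => convex_Icc 0 1 (hs i) (ht i) ha hb hab, ?_⟩
  convert Submodule.add_mem _ (Submodule.smul_mem _ a hx) (Submodule.smul_mem _ b hy) using 1
  simp only [smul_sub, add_smul, Finset.sum_add_distrib, Finset.smul_sum, smul_assoc]
  abel

variable {u B C}

theorem add_mem_cylinder {y w : V} (hy : y ∈ cylinder u B C)
    (hw : w ∈ Submodule.span ℝ (u '' ↑B)) : y + w ∈ cylinder u B C := by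
  obtain ⟨t, ht, h⟩ := hy
  exact ⟨t, ht, by rw [add_sub_right_comm]; exact Submodule.add_mem _ h hw⟩

theorem bddAbove_cylinder {v : V} (hv : v ∉ Submodule.span ℝ (u '' ↑B)) (y : V) :
    BddAbove {τ : ℝ | y + τ • v ∈ cylinder u B C} := by
  obtain ⟨f, hfv, hf⟩ := Submodule.exists_le_ker_of_notMem hv
  refine ⟨(∑ i ∈ C, |f (u i)| + |f y|) / |f v|, ?_⟩
  rintro τ ⟨t, ht, h⟩
  have h0 : f y + τ * f v - ∑ i ∈ C, t i * f (u i) = 0 := by simpa using hf h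
  rw [le_div_iff₀ (abs_pos.2 hfv)]
  have hsum : |∑ i ∈ C, t i * f (u i)| ≤ ∑ i ∈ C, |f (u i)| := by
    refine (Finset.abs_sum_le_sum_abs _ _).trans (Finset.sum_le_sum fun i _ => ?_)
    rw [abs_mul, abs_of_nonneg (ht i).1]
    exact mul_le_of_le_one_left (abs_nonneg _) (ht i).2
  calc τ * |f v| ≤ |τ| * |f v| := by gcongr; exact le_abs_self τ
    _ = |∑ i ∈ C, t i * f (u i) - f y| := by rw [← abs_mul]; congr 1; linarith
    _ ≤ _ := (abs_sub _ _).trans (by gcongr)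

variable [DecidableEq ι]

theorem mem_cylinder_insert {v : ι} (hv : v ∉ C) {y : V} :
    y ∈ cylinder u B (insert v C) ↔ ∃ t ∈ Set.Icc (0 : ℝ) 1, y - t • u v ∈ cylinder u B C := by
  constructor
  · rintro ⟨t, ht, h⟩
    rw [Finset.sum_insert hv, ← sub_sub] at h
    exact ⟨t v, ht v, t, ht, h⟩
  · rintro ⟨a, ha, t, ht, h⟩
    refine ⟨Function.update t v a, fun i => ?_, ?_⟩
    · rcases eq_or_ne i v with rfl | hi
      · simpa using ha
      · simpa [hi] using ht i
    · have hsum : ∑ i ∈ C, Function.update t v a i • u i = ∑ i ∈ C, t i • u i :=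
        Finset.sum_congr rfl fun i hi => by
          rw [Function.update_of_ne (ne_of_mem_of_not_mem hi hv)]
      rwa [Finset.sum_insert hv, ← sub_sub, Function.update_self, hsum]

theorem mem_cylinder_insert_left {v : ι} {y : V} :
    y ∈ cylinder u (insert v B) C ↔ ∃ t : ℝ, y - t • u v ∈ cylinder u B C := by
  constructor
  · rintro ⟨t, ht, h⟩
    rw [Finset.coe_insert, Set.image_insert_eq, Submodule.mem_span_insert] at h
    obtain ⟨a, z, hz, h⟩ := h
    refine ⟨a, t, ht, ?_⟩
    rwa [sub_right_comm, h, add_sub_cancel_left]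
  · rintro ⟨a, t, ht, h⟩
    refine ⟨t, ht, ?_⟩
    rw [Finset.coe_insert, Set.image_insert_eq, Submodule.mem_span_insert]
    exact ⟨a, _, h, by abel⟩

theorem cylinder_insert_of_mem_span {v : ι} (hv : v ∉ C) (hu : u v ∈ Submodule.span ℝ (u '' ↑B)) :
    cylinder u B (insert v C) = cylinder u B C := by
  ext y
  rw [mem_cylinder_insert hv]
  constructor
  · rintro ⟨t, _, h⟩
    simpa using add_mem_cylinder h (Submodule.smul_mem _ t hu)
  · intro h
    exact ⟨0, by simp, by simpa using h⟩

end cylinder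

theorem linearIndepOn_iff_card_sub_rnk [Fintype ι] (X : ι → Fin n → ℤ) (A : Finset ι) :
    LinearIndepOn ℝ (fun i => toReal n (X i)) ↑A ↔ A.card - rnk X A = 0 := by
  rw [LinearIndepOn, linearIndependent_iff_card_le_finrank_span, Nat.sub_eq_zero_iff_le,
    rnk, Set.image_eq_range]
  change Fintype.card A ≤ _ ↔ _
  rw [Fintype.card_coe]
  rfl

theorem encard_mkQ_image_span [Fintype ι] (X : ι → Fin n → ℤ) (B : Finset ι) :
    ((Submodule.span ℤ (X '' ↑B)).mkQ ''
      {x | toReal n x ∈ Submodule.span ℝ ((fun i => toReal n (X i)) '' ↑B)}).encard =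
        (mult X B : ℕ∞) := by
  set S := Submodule.span ℤ (X '' ↑B)
  have hset : S.mkQ '' {x | toReal n x ∈ Submodule.span ℝ ((fun i => toReal n (X i)) '' ↑B)} =
      (Submodule.torsion ℤ ((Fin n → ℤ) ⧸ S) : Set _) := by
    have key (x : Fin n → ℤ) : S.mkQ x ∈ Submodule.torsion ℤ ((Fin n → ℤ) ⧸ S) ↔
        toReal n x ∈ Submodule.span ℝ ((fun i => toReal n (X i)) '' ↑B) := by
      rw [toReal_mem_span_iff, Submodule.mem_torsion_iff]
      have hz (k : ℤ) : k • S.mkQ x = 0 ↔ k • x ∈ S := by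
        rw [← map_smul]
        exact Submodule.Quotient.mk_eq_zero S
      constructor
      · rintro ⟨k, hk⟩
        exact ⟨k, nonZeroDivisors.coe_ne_zero k, (hz k).1 hk⟩
      · rintro ⟨k, hk, h⟩
        exact ⟨⟨k, mem_nonZeroDivisors_of_ne_zero hk⟩, (hz k).2 h⟩
    ext q
    obtain ⟨x, rfl⟩ := S.mkQ_surjective q
    constructor
    · rintro ⟨y, hy, hyx⟩
      rw [← hyx]
      exact (key y).2 hy
    · exact fun h => ⟨x, (key x).1 h, rfl⟩
  have : Finite (Submodule.torsion ℤ ((Fin n → ℤ) ⧸ S)) :=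
    Module.finite_of_fg_torsion _ Submodule.torsion_isTorsion
  rw [hset, mult, ← ENat.card_coe_set_eq]
  exact ENat.card_eq_coe_natCard _

open Classical in
theorem encard_mkQ_image_cylinder [Fintype ι] (X : ι → Fin n → ℤ) (C : Finset ι) :
    ∀ B : Finset ι, Disjoint B C → LinearIndepOn ℝ (fun i => toReal n (X i)) ↑B →
    ((Submodule.span ℤ (X '' ↑B)).mkQ ''
      {x | toReal n x ∈ cylinder (fun i => toReal n (X i)) B C}).encard =
        ∑ A ∈ C.powerset, if LinearIndepOn ℝ (fun i => toReal n (X i)) ↑(A ∪ B)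
          then (mult X (A ∪ B) : ℕ∞) else 0 := by
  induction C using Finset.induction_on with
  | empty =>
    intro B _ hB
    simpa [cylinder_empty, hB] using encard_mkQ_image_span X B
  | insert v C hv ih =>
    intro B hBC hB
    rw [Finset.disjoint_insert_right] at hBC
    rw [Finset.sum_powerset_insert hv, ← ih B hBC.2 hB]
    by_cases hvB : toReal n (X v) ∈ Submodule.span ℝ ((fun i => toReal n (X i)) '' ↑B)
    · rw [cylinder_insert_of_mem_span hv hvB, Finset.sum_eq_zero, add_zero]
      intro A _
      rw [if_neg]
      intro hA
      refine ((linearIndepOn_insert (Finset.mem_coe.not.2 hBC.1)).1 (hA.mono ?_)).2 hvB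
      rw [← Finset.coe_insert, Finset.coe_subset]
      intro i
      simp only [Finset.mem_insert, Finset.mem_union]
      tauto
    · have hins : LinearIndepOn ℝ (fun i => toReal n (X i)) ↑(insert v B) := by
        rw [Finset.coe_insert]
        exact (linearIndepOn_insert (Finset.mem_coe.not.2 hBC.1)).2 ⟨hB, hvB⟩
      have hsum := ih (insert v B) (Finset.disjoint_insert_left.2 ⟨hv, hBC.2⟩) hins
      simp only [Finset.union_insert, ← Finset.insert_union] at hsum
      rw [← hsum]
      have hspan : Submodule.span ℤ (X '' ↑(insert v B)) =
          Submodule.span ℤ (X '' ↑B) ⊔ Submodule.span ℤ {X v} := by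
        rw [Finset.coe_insert, Set.image_insert_eq, Submodule.span_insert, sup_comm]
      rw [hspan]
      simp only [mem_cylinder_insert hv, mem_cylinder_insert_left]
      refine encard_mkQ_image_add_segment (toReal n) _ (convex_cylinder _ B C) (X v) ?_
        fun y => bddAbove_cylinder hvB y
      intro s hs p hp
      exact add_mem_cylinder hp ((toReal_mem_span_iff X B s).2 ⟨1, one_ne_zero, by simpa using hs⟩)

end ZonotopePoints

/-- The number of integer points in the zonotope `Z(X)` equals `M_X(2,1)`. -/
theorem stmt8 {n N : ℕ} (X : Fin N → Fin n → ℤ)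
    (hspan : Submodule.span ℝ (Set.range (fun i (j : Fin n) => (X i j : ℝ))) = ⊤) :
    (Nat.card {x : Fin n → ℤ |
        (fun j => (x j : ℝ)) ∈ zonotope (fun i (j : Fin n) => (X i j : ℝ))} : ℝ) =
      Mpoly X 2 1 := by
  classical
  have h := ZonotopePoints.encard_mkQ_image_cylinder X Finset.univ ∅ (by simp) (by simp)
  have hinj : Function.Injective (Submodule.span ℤ (X '' ↑(∅ : Finset (Fin N)))).mkQ := by
    rw [← LinearMap.ker_eq_bot, Submodule.ker_mkQ]
    simp
  have hset : {x : Fin n → ℤ |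
      (fun j => (x j : ℝ)) ∈ zonotope (fun i (j : Fin n) => (X i j : ℝ))} =
      {x | ZonotopePoints.toReal n x ∈
        ZonotopePoints.cylinder (fun i => ZonotopePoints.toReal n (X i)) ∅ Finset.univ} := by
    ext x
    simp only [ZonotopePoints.cylinder, Finset.coe_empty, Set.image_empty, Submodule.span_empty,
      Submodule.mem_bot, sub_eq_zero]
    rfl
  simp only [hinj.encard_image, ← hset, Finset.powerset_univ, Finset.union_empty,
    ZonotopePoints.linearIndepOn_iff_card_sub_rnk] at h
  have hcard : Nat.card {x : Fin n → ℤ |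
      (fun j => (x j : ℝ)) ∈ zonotope (fun i (j : Fin n) => (X i j : ℝ))} =
      ∑ A : Finset (Fin N), if A.card - rnk X A = 0 then mult X A else 0 := by
    rw [Nat.card_coe_set_eq, Set.ncard, h, ← ENat.toNat_natCast (∑ A : Finset (Fin N), _)]
    congr 1
    push_cast
    rfl
  rw [hcard, Mpoly]
  push_cast
  refine Finset.sum_congr rfl fun A _ => ?_
  norm_num [zero_pow_eq]
end

section
/- Let A be a finite list of vectors in ℤ^n. In the complex torus T = (ℂ*)^n, let H_A = {t ∈ T : χ(t) = 1 for every χ ∈ A}, where for χ = (χ_1,…,χ_n) ∈ ℤ^n and t = (t_1,…,t_n) ∈ T we set χ(t) = Π_i t_i^{χ_i}. Then the number of connected components of H_A (in the subspace topology) equals m(A), the cardinality of the torsion subgroup of ℤ^n/⟨A⟩_ℤ. -/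
/-- The subvariety of the complex torus `(ℂ*)^n` cut out by the characters in the list `A`:
`H_A = {t : χ(t) = 1 for all χ ∈ A}`, where `χ(t) = Π_i t_i^{χ_i}`. -/
def torusKer {n N : ℕ} (A : Fin N → Fin n → ℤ) : Set (Fin n → ℂˣ) :=
  {t | ∀ k : Fin N, ∏ i, t i ^ (A k i) = 1}

section SmithNormalForm

open Module

variable {ι R M : Type*} [CommRing R] [AddCommGroup M] [Module R M] {N : Submodule R M} {r : ℕ}

theorem Module.Basis.SmithNormalForm.a_ne_zero [Nontrivial R]
    (S : Basis.SmithNormalForm N ι r) (i : Fin r) : S.a i ≠ 0 := by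
  intro h
  apply S.bN.ne_zero i
  ext
  simp [S.snf, h]

theorem Module.Basis.SmithNormalForm.sum_smul_mem_iff
    (S : Basis.SmithNormalForm N ι r) (c : Fin r → R) :
    ∑ i, c i • S.bM (S.f i) ∈ N ↔ ∀ i, S.a i ∣ c i := by
  classical
  constructor
  · intro h i
    have h₁ := S.repr_apply_embedding_eq_repr_smul (m := ⟨_, h⟩) (i := i)
    simp only [map_sum, map_smul, Basis.repr_self, Finsupp.finsetSum_apply, Finsupp.smul_apply,
      Finsupp.single_apply, S.f.injective.eq_iff, smul_eq_mul, mul_ite, mul_one, mul_zero,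
      Finset.sum_ite_eq', Finset.mem_univ, if_true] at h₁
    rw [h₁]
    simp
  · intro h
    refine N.sum_mem fun i _ ↦ ?_
    obtain ⟨d, hd⟩ := h i
    rw [hd, mul_comm, mul_smul, ← S.snf]
    exact N.smul_mem _ (S.bN i).2

/-- The combinations of the basis vectors occurring in a Smith normal form of `N`, modulo `N`. -/
noncomputable def Module.Basis.SmithNormalForm.toQuotient (S : Basis.SmithNormalForm N ι r) :
    (Fin r → R) →ₗ[R] M ⧸ N :=
  N.mkQ ∘ₗ Fintype.linearCombination R fun i ↦ S.bM (S.f i)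

theorem Module.Basis.SmithNormalForm.ker_toQuotient (S : Basis.SmithNormalForm N ι r) :
    LinearMap.ker S.toQuotient = Submodule.pi Set.univ fun i ↦ Ideal.span {S.a i} := by
  ext c
  simp [toQuotient, Fintype.linearCombination_apply, S.sum_smul_mem_iff,
    Submodule.mem_pi, Ideal.mem_span_singleton, -map_sum]

theorem Module.Basis.SmithNormalForm.range_toQuotient [IsDomain R] [Finite ι]
    (S : Basis.SmithNormalForm N ι r) :
    LinearMap.range S.toQuotient = Submodule.torsion R (M ⧸ N) := by
  classical
  have := Fintype.ofFinite ι
  apply le_antisymm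
  · rintro _ ⟨c, rfl⟩
    rw [Submodule.mem_torsion_iff]
    refine ⟨⟨∏ i, S.a i, mem_nonZeroDivisors_of_ne_zero
      (Finset.prod_ne_zero_iff.2 fun i _ ↦ S.a_ne_zero i)⟩, ?_⟩
    rw [Submonoid.mk_smul, ← map_smul, ← LinearMap.mem_ker, S.ker_toQuotient]
    intro i _
    exact Ideal.mem_span_singleton.2 ((Finset.dvd_prod_of_mem _ (Finset.mem_univ i)).mul_right _)
  · intro x hx
    obtain ⟨y, rfl⟩ := N.mkQ_surjective x
    obtain ⟨⟨m, hm⟩, h⟩ := (Submodule.mem_torsion_iff _).1 hx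
    have hm0 : m ≠ 0 := nonZeroDivisors.ne_zero hm
    rw [Submonoid.mk_smul, ← map_smul, Submodule.mkQ_apply, Submodule.Quotient.mk_eq_zero] at h
    refine ⟨fun i ↦ S.bM.repr y (S.f i), ?_⟩
    rw [toQuotient, LinearMap.comp_apply, Fintype.linearCombination_apply]
    congr 1
    conv_rhs => rw [← S.bM.sum_repr y]
    refine Finset.sum_of_injOn S.f S.f.injective.injOn (by simp) (fun j _ hj ↦ ?_) (by simp)
    have h₁ := S.repr_eq_zero_of_notMem_range ⟨_, h⟩ (i := j) (by simpa using hj)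
    have h₂ : m * S.bM.repr y j = 0 := by simpa using h₁
    simp [(mul_eq_zero.1 h₂).resolve_left hm0]

theorem Module.Basis.SmithNormalForm.card_torsion_quotient {M : Type*} [AddCommGroup M]
    {N : Submodule ℤ M} [Finite ι] (S : Basis.SmithNormalForm N ι r) :
    Nat.card (Submodule.torsion ℤ (M ⧸ N)) = ∏ i, (S.a i).natAbs := by
  classical
  rw [← S.range_toQuotient, ← Nat.card_congr S.toQuotient.quotKerEquivRange.toEquiv,
    S.ker_toQuotient, Nat.card_congr (Submodule.quotientPi _).toEquiv, Nat.card_pi]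
  refine Finset.prod_congr rfl fun i _ ↦ ?_
  rw [Nat.card_congr (Int.quotientSpanEquivZMod (S.a i)).toEquiv, Nat.card_zmod]

end SmithNormalForm

section Topology

theorem ConnectedComponents.card_eq_of_isPreconnected_fiber {X Y : Type*} [TopologicalSpace X]
    [TopologicalSpace Y] [TotallyDisconnectedSpace Y] {g : X → Y} (hg : Continuous g)
    (hs : Function.Surjective g) (hf : ∀ y, IsPreconnected (g ⁻¹' {y})) :
    Nat.card (ConnectedComponents X) = Nat.card Y := by
  refine Nat.card_eq_of_bijective hg.connectedComponentsLift ⟨fun a b ↦ ?_, fun y ↦ ?_⟩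
  · obtain ⟨x, rfl⟩ := ConnectedComponents.surjective_coe a
    obtain ⟨z, rfl⟩ := ConnectedComponents.surjective_coe b
    intro h
    rw [hg.connectedComponentsLift_apply_coe, hg.connectedComponentsLift_apply_coe] at h
    exact ConnectedComponents.coe_eq_coe'.2 ((hf (g z)).subset_connectedComponent rfl h)
  · obtain ⟨x, rfl⟩ := hs y
    exact ⟨x, hg.connectedComponentsLift_apply_coe x⟩

instance Complex.preconnectedSpace_units : PreconnectedSpace ℂˣ := by
  let e : ℂ → ℂˣ := fun z ↦ ⟨exp z, exp (-z), by simp [← exp_add], by simp [← exp_add]⟩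
  have he : Continuous e := Units.continuous_iff.2
    ⟨Complex.continuous_exp, Complex.continuous_exp.comp continuous_neg⟩
  have hs : Function.Surjective e := fun u ↦
    ⟨Complex.log u, Units.ext (Complex.exp_log u.ne_zero)⟩
  exact ⟨hs.range_eq ▸ isPreconnected_range he⟩

end Topology

section Torus

open Module

variable {n N : ℕ}

/-- Evaluation of characters of the torus at the point `t`, as a `ℤ`-linear map. -/
noncomputable def torusEval (t : Fin n → ℂˣ) : (Fin n → ℤ) →ₗ[ℤ] Additive ℂˣ :=
  Fintype.linearCombination ℤ fun i ↦ Additive.ofMul (t i)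

theorem toMul_torusEval (t : Fin n → ℂˣ) (v : Fin n → ℤ) :
    (torusEval t v).toMul = ∏ i, t i ^ v i := by
  simp [torusEval, Fintype.linearCombination_apply]

theorem continuous_toMul_torusEval (v : Fin n → ℤ) :
    Continuous fun t : Fin n → ℂˣ ↦ (torusEval t v).toMul := by
  simp only [toMul_torusEval]
  fun_prop

theorem torusEval_injective : Function.Injective (torusEval (n := n)) := by
  intro s t h
  ext1 i
  simpa [torusEval] using LinearMap.congr_fun h (Pi.single i 1)

/-- The point of the torus with prescribed values on the characters of a basis. -/
noncomputable def torusPoint (b : Basis (Fin n) ℤ (Fin n → ℤ)) (s : Fin n → ℂˣ) : Fin n → ℂˣ :=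
  fun i ↦ (b.constr ℤ (fun j ↦ Additive.ofMul (s j)) (Pi.single i 1)).toMul

theorem torusEval_torusPoint (b : Basis (Fin n) ℤ (Fin n → ℤ)) (s : Fin n → ℂˣ) :
    torusEval (torusPoint b s) = b.constr ℤ fun j ↦ Additive.ofMul (s j) := by
  refine (Pi.basisFun ℤ (Fin n)).ext fun i ↦ ?_
  simp [torusEval, torusPoint]

theorem torusEval_torusPoint_basis (b : Basis (Fin n) ℤ (Fin n → ℤ)) (s : Fin n → ℂˣ)
    (j : Fin n) : (torusEval (torusPoint b s) (b j)).toMul = s j := by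
  simp [torusEval_torusPoint]

theorem torusPoint_torusEval (b : Basis (Fin n) ℤ (Fin n → ℤ)) (t : Fin n → ℂˣ) :
    torusPoint b (fun j ↦ (torusEval t (b j)).toMul) = t := by
  apply torusEval_injective
  rw [torusEval_torusPoint]
  exact b.ext fun j ↦ by simp

theorem continuous_torusPoint (b : Basis (Fin n) ℤ (Fin n → ℤ)) : Continuous (torusPoint b) := by
  unfold torusPoint
  simp only [Basis.constr_apply_fintype, toMul_sum, toMul_zsmul, toMul_ofMul]
  fun_prop

theorem mem_torusKer_iff (A : Fin N → Fin n → ℤ) {r : ℕ}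
    (S : Basis.SmithNormalForm (Submodule.span ℤ (Set.range A)) (Fin n) r) (t : Fin n → ℂˣ) :
    t ∈ torusKer A ↔ ∀ i, (torusEval t (S.bM (S.f i))).toMul ^ (S.a i).natAbs = 1 := by
  have h₁ : t ∈ torusKer A ↔ Submodule.span ℤ (Set.range A) ≤ LinearMap.ker (torusEval t) := by
    rw [Submodule.span_le, Set.range_subset_iff]
    refine forall_congr' fun k ↦ ?_
    rw [← toMul_torusEval]
    rfl
  have h₂ (i) : (torusEval t (S.bM (S.f i))).toMul ^ (S.a i).natAbs = 1 ↔
      torusEval t (S.bN i) = 0 := by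
    rw [pow_natAbs_eq_one, S.snf, map_smul, ← toMul_zsmul, toMul_eq_one]
  simp only [h₁, h₂]
  refine ⟨fun h i ↦ h (S.bN i).2, fun h v hv ↦ ?_⟩
  have h₃ : torusEval t ∘ₗ Submodule.subtype _ = 0 := S.bN.ext fun i ↦ by simpa using h i
  exact LinearMap.congr_fun h₃ ⟨v, hv⟩

theorem isPreconnected_setOf_torusEval_eq (b : Basis (Fin n) ℤ (Fin n → ℤ)) {r : ℕ}
    (f : Fin r ↪ Fin n) (c : Fin r → ℂˣ) :
    IsPreconnected {t : Fin n → ℂˣ | ∀ i, (torusEval t (b (f i))).toMul = c i} := by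
  have h₁ : IsPreconnected (Set.univ.pi fun j : Fin n ↦ {u : ℂˣ | ∀ i, f i = j → u = c i}) := by
    refine isPreconnected_univ_pi fun j ↦ ?_
    by_cases hj : ∃ i, f i = j
    · obtain ⟨i, rfl⟩ := hj
      exact Set.Subsingleton.isPreconnected fun u hu v hv ↦ (hu i rfl).trans (hv i rfl).symm
    · have : {u : ℂˣ | ∀ i, f i = j → u = c i} = Set.univ :=
        Set.eq_univ_of_forall fun u i hi ↦ (hj ⟨i, hi⟩).elim
      rw [this]
      exact isPreconnected_univ
  convert h₁.image _ (continuous_torusPoint b).continuousOn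
  ext t
  constructor
  · intro ht
    refine ⟨_, ?_, torusPoint_torusEval b t⟩
    rintro _ - i rfl
    exact ht i
  · rintro ⟨s, hs, rfl⟩ i
    rw [torusEval_torusPoint_basis]
    exact hs _ trivial i rfl

end Torus

/-- The number of connected components of `H_A` equals `m(A)`, the cardinality of the torsion
subgroup of `ℤ^n/⟨A⟩`. -/
theorem stmt9 {n N : ℕ} (A : Fin N → Fin n → ℤ) :
    Nat.card (ConnectedComponents (torusKer A)) =
      Nat.card (Submodule.torsion ℤ ((Fin n → ℤ) ⧸ Submodule.span ℤ (Set.range A))) := by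
  classical
  obtain ⟨r, S⟩ := Submodule.smithNormalForm (Pi.basisFun ℤ (Fin n))
    (Submodule.span ℤ (Set.range A))
  have (i : Fin r) : NeZero (S.a i).natAbs := ⟨Int.natAbs_ne_zero.2 (S.a_ne_zero i)⟩
  let g : torusKer A → ∀ i, rootsOfUnity (S.a i).natAbs ℂ := fun t i ↦
    ⟨(torusEval t.1 (S.bM (S.f i))).toMul, (mem_torusKer_iff A S t.1).1 t.2 i⟩
  have hg : Continuous g := continuous_pi fun i ↦
    ((continuous_toMul_torusEval _).comp continuous_subtype_val).subtype_mk _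
  have hs : Function.Surjective g := by
    intro c
    let t := torusPoint S.bM fun j ↦ if h : ∃ i, S.f i = j then (c h.choose : ℂˣ) else 1
    have ht (i : Fin r) : (torusEval t (S.bM (S.f i))).toMul = c i := by
      have h : ∃ k, S.f k = S.f i := ⟨i, rfl⟩
      rw [torusEval_torusPoint_basis, dif_pos h, S.f.injective h.choose_spec]
    refine ⟨⟨t, (mem_torusKer_iff A S t).2 fun i ↦ ?_⟩, funext fun i ↦ Subtype.ext (ht i)⟩
    rw [ht]
    exact (c i).2
  have hf (c) : IsPreconnected (g ⁻¹' {c}) := by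
    rw [← Topology.IsInducing.subtypeVal.isPreconnected_image]
    convert isPreconnected_setOf_torusEval_eq S.bM S.f fun i ↦ (c i : ℂˣ)
    ext t
    constructor
    · rintro ⟨t, rfl, rfl⟩ i
      rfl
    · intro ht
      refine ⟨⟨t, (mem_torusKer_iff A S t).2 fun i ↦ ?_⟩, funext fun i ↦ Subtype.ext (ht i), rfl⟩
      rw [ht]
      exact (c i).2
  rw [ConnectedComponents.card_eq_of_isPreconnected_fiber hg hs hf, S.card_torsion_quotient,
    Nat.card_pi]
  exact Finset.prod_congr rfl fun i _ ↦ Complex.card_rootsOfUnity _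
end

section
/- Let X be a finite list of nonzero vectors in ℤ^n whose ℝ-linear span is all of ℝ^n. In the compact torus T̄ = (ℝ/ℤ)^n, each χ = (χ_1,…,χ_n) ∈ X defines the hypersurface H̄_χ = {t ∈ T̄ : χ_1 t_1 + ⋯ + χ_n t_n = 0 in ℝ/ℤ}. Then the number of connected components of the complement T̄ ∖ ⋃_{χ∈X} H̄_χ equals M_X(1,0). -/
/-- The complement in the compact torus `(ℝ/ℤ)^n` of the union of the hypersurfaces
`H̄_χ = {t : χ_1 t_1 + ⋯ + χ_n t_n = 0}`, for `χ` ranging over the list `X`. -/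
def compactComplement {n N : ℕ} (X : Fin N → Fin n → ℤ) : Set (Fin n → AddCircle (1 : ℝ)) :=
  {t | ∀ k : Fin N, ∑ i, X k i • t i ≠ 0}

namespace ToricArrangement

open Filter Topology Set

/-- `g` is piecewise constant on the circle, and the sum of its jumps from the right is `c`. -/
def HasJumpSum (g : AddCircle (1 : ℝ) → ℤ) (c : ℤ) : Prop :=
  ∃ j : AddCircle (1 : ℝ) → ℤ, (∀ t, ∀ᶠ ε : ℝ in 𝓝[>] 0, g (t + (ε : AddCircle (1 : ℝ))) = j t) ∧
    (Function.support fun t => g t - j t).Finite ∧ ∑ᶠ t, (g t - j t) = c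

namespace HasJumpSum

lemma zero : HasJumpSum (fun _ => 0) 0 :=
  ⟨fun _ => 0, fun _ => by simp, by simp, by simp⟩

lemma add {g g' : AddCircle (1 : ℝ) → ℤ} {c c' : ℤ} (h : HasJumpSum g c) (h' : HasJumpSum g' c') :
    HasJumpSum (fun t => g t + g' t) (c + c') := by
  obtain ⟨j, hj, hf, rfl⟩ := h
  obtain ⟨j', hj', hf', rfl⟩ := h'
  have key : (fun t => g t + g' t - (j t + j' t)) = fun t => (g t - j t) + (g' t - j' t) := by
    funext t; ring
  refine ⟨fun t => j t + j' t, fun t => ?_, ?_, ?_⟩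
  · filter_upwards [hj t, hj' t] with ε h1 h2
    rw [h1, h2]
  · rw [key]
    exact (hf.union hf').subset (Function.support_add _ _)
  · rw [key, finsum_add_distrib hf hf']

lemma const_mul (a : ℤ) {g : AddCircle (1 : ℝ) → ℤ} {c : ℤ} (h : HasJumpSum g c) :
    HasJumpSum (fun t => a * g t) (a * c) := by
  obtain ⟨j, hj, hf, rfl⟩ := h
  have key : (fun t => a * g t - a * j t) = fun t => a * (g t - j t) := by
    funext t; ring
  refine ⟨fun t => a * j t, fun t => ?_, ?_, ?_⟩
  · filter_upwards [hj t] with ε h1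
    rw [h1]
  · rw [key]
    exact hf.subset (Function.support_mul_subset_right _ _)
  · rw [key, mul_finsum' _ _ hf]

lemma unique {g : AddCircle (1 : ℝ) → ℤ} {c c' : ℤ} (h : HasJumpSum g c) (h' : HasJumpSum g c') :
    c = c' := by
  obtain ⟨j, hj, hf, rfl⟩ := h
  obtain ⟨j', hj', hf', rfl⟩ := h'
  have : j = j' := by
    funext t
    obtain ⟨ε, h1, h2⟩ := ((hj t).and (hj' t)).exists
    rw [← h1, h2]
  rw [this]

end HasJumpSum

/-- `c` is the Euler characteristic (with compact support) of the function `f` on the torus,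
computed by integrating one coordinate at a time. -/
def HasEuler : (n : ℕ) → ((Fin n → AddCircle (1 : ℝ)) → ℤ) → ℤ → Prop
  | 0, f, c => f Fin.elim0 = c
  | n + 1, f, c => ∃ g : AddCircle (1 : ℝ) → ℤ,
      (∀ t, HasEuler n (fun y => f (Fin.cons t y)) (g t)) ∧ HasJumpSum g c

namespace HasEuler

lemma zero : ∀ n : ℕ, HasEuler n (fun _ => 0) 0
  | 0 => rfl
  | n + 1 => ⟨fun _ => 0, fun _ => zero n, HasJumpSum.zero⟩

lemma add : ∀ {n : ℕ} {f f' : (Fin n → AddCircle (1 : ℝ)) → ℤ} {c c' : ℤ},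
    HasEuler n f c → HasEuler n f' c' → HasEuler n (fun t => f t + f' t) (c + c')
  | 0, _, _, _, _, h, h' => by
    simp only [HasEuler] at *
    rw [h, h']
  | n + 1, _, _, _, _, ⟨g, hg, hc⟩, ⟨g', hg', hc'⟩ =>
    ⟨fun t => g t + g' t, fun t => (hg t).add (hg' t), hc.add hc'⟩

lemma const_mul (a : ℤ) : ∀ {n : ℕ} {f : (Fin n → AddCircle (1 : ℝ)) → ℤ} {c : ℤ},
    HasEuler n f c → HasEuler n (fun t => a * f t) (a * c)
  | 0, _, _, h => by
    simp only [HasEuler] at *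
    rw [h]
  | n + 1, _, _, ⟨g, hg, hc⟩ =>
    ⟨fun t => a * g t, fun t => (hg t).const_mul a, hc.const_mul a⟩

lemma sum {n : ℕ} {α : Type*} (s : Finset α) {f : α → (Fin n → AddCircle (1 : ℝ)) → ℤ}
    {c : α → ℤ} (h : ∀ i ∈ s, HasEuler n (f i) (c i)) :
    HasEuler n (fun t => ∑ i ∈ s, f i t) (∑ i ∈ s, c i) := by
  classical
  induction s using Finset.induction_on with
  | empty => simpa using zero n
  | insert a s ha ih =>
    simp only [Finset.sum_insert ha]
    exact (h a (Finset.mem_insert_self a s)).add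
      (ih fun i hi => h i (Finset.mem_insert_of_mem hi))

lemma unique : ∀ {n : ℕ} {f : (Fin n → AddCircle (1 : ℝ)) → ℤ} {c c' : ℤ},
    HasEuler n f c → HasEuler n f c' → c = c'
  | 0, _, _, _, h, h' => by
    simp only [HasEuler] at *
    rw [← h, ← h']
  | n + 1, f, _, _, ⟨g, hg, hc⟩, ⟨g', hg', hc'⟩ => by
    have : g = g' := funext fun t => (hg t).unique (hg' t)
    subst this
    exact hc.unique hc'

end HasEuler

lemma eventually_add_notMem {F : Set (AddCircle (1 : ℝ))} (hF : F.Finite) (t : AddCircle (1 : ℝ)) :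
    ∀ᶠ ε : ℝ in 𝓝[>] 0, t + (ε : AddCircle (1 : ℝ)) ∉ F := by
  have hcont : Continuous fun ε : ℝ => t + (ε : AddCircle (1 : ℝ)) :=
    continuous_const.add (AddCircle.continuous_mk' 1)
  have h1 : ∀ᶠ ε : ℝ in 𝓝[>] 0, t + (ε : AddCircle (1 : ℝ)) ∉ F \ {t} := by
    have h0 : (F \ {t})ᶜ ∈ 𝓝 (t + ((0 : ℝ) : AddCircle (1 : ℝ))) :=
      (hF.subset sdiff_subset).isClosed.isOpen_compl.mem_nhds (by simp)
    exact nhdsWithin_le_nhds (hcont.continuousAt.eventually_mem h0)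
  have h2 : ∀ᶠ ε : ℝ in 𝓝[>] 0, ε ∈ Ioo (0 : ℝ) 1 := Ioo_mem_nhdsGT one_pos
  filter_upwards [h1, h2] with ε h1 h2 h
  refine h1 ⟨h, fun h3 => ?_⟩
  have h4 : (ε : AddCircle (1 : ℝ)) = 0 := by simpa using h3
  rw [AddCircle.coe_eq_zero_iff] at h4
  obtain ⟨m, hm⟩ := h4
  simp only [zsmul_eq_mul, mul_one] at hm
  rw [← hm] at h2
  obtain ⟨h5, h6⟩ := h2
  norm_cast at h5 h6
  omega

open Classical in
lemma hasJumpSum_of_finite {F : Set (AddCircle (1 : ℝ))} (hF : F.Finite) :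
    HasJumpSum (fun t => if t ∈ F then 1 else 0) F.ncard := by
  refine ⟨fun _ => 0, fun t => ?_, hF.subset fun t ht => ?_, ?_⟩
  · filter_upwards [eventually_add_notMem hF t] with ε h
    rw [if_neg h]
  · by_contra h
    simp [h] at ht
  · simp only [sub_zero]
    rw [finsum_eq_sum_of_support_subset (s := hF.toFinset) _ (fun t ht => by
      by_contra h
      simp at h
      simp [h] at ht), Finset.sum_congr rfl (g := fun _ => (1 : ℤ)) (fun t ht => by
      simp at ht
      simp [ht]), ncard_eq_toFinset_card _ hF]
    simp

lemma finite_or_eq_top {P : AddSubgroup (AddCircle (1 : ℝ))}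
    (hP : IsClosed (P : Set (AddCircle (1 : ℝ)))) : (P : Set (AddCircle (1 : ℝ))).Finite ∨ P = ⊤ := by
  let φ : ℝ →+ AddCircle (1 : ℝ) := QuotientAddGroup.mk' (AddSubgroup.zmultiples (1 : ℝ))
  have hφ : Function.Surjective φ := QuotientAddGroup.mk'_surjective _
  rcases AddSubgroup.dense_or_cyclic (P.comap φ) with h | ⟨a, ha⟩
  · right
    have hc : IsClosed ((P.comap φ : AddSubgroup ℝ) : Set ℝ) :=
      hP.preimage (AddCircle.continuous_mk' 1)
    have h2 := h.closure_eq
    rw [hc.closure_eq] at h2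
    refine eq_top_iff.2 fun t _ => ?_
    obtain ⟨x, rfl⟩ := hφ t
    have : x ∈ ((P.comap φ : AddSubgroup ℝ) : Set ℝ) := h2 ▸ mem_univ x
    exact this
  · left
    rw [← AddSubgroup.zmultiples_eq_closure] at ha
    have h1 : (1 : ℝ) ∈ P.comap φ := by
      rw [AddSubgroup.mem_comap]
      have : φ 1 = 0 := AddCircle.coe_period 1
      rw [this]
      exact P.zero_mem
    rw [ha] at h1
    obtain ⟨m, hm⟩ := AddSubgroup.mem_zmultiples_iff.1 h1
    have hm0 : m ≠ 0 := by
      rintro rfl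
      simp at hm
    have hfin : IsOfFinAddOrder (φ a) := by
      rw [isOfFinAddOrder_iff_zsmul_eq_zero]
      refine ⟨m, hm0, ?_⟩
      rw [← map_zsmul, hm]
      exact AddCircle.coe_period 1
    have hPe : P = AddSubgroup.zmultiples (φ a) := by
      rw [← AddSubgroup.map_comap_eq_self_of_surjective hφ P, ha, AddMonoidHom.map_zmultiples]
    rw [hPe]
    exact hfin.finite_zmultiples

open Classical in
lemma hasJumpSum_coset {P : AddSubgroup (AddCircle (1 : ℝ))}
    (hP : IsClosed (P : Set (AddCircle (1 : ℝ)))) (c : AddCircle (1 : ℝ)) :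
    HasJumpSum (fun t => if t - c ∈ P then 1 else 0) (Nat.card P) := by
  rcases finite_or_eq_top hP with h | rfl
  · have := hasJumpSum_of_finite (h.preimage ((sub_left_injective (b := c)).injOn))
    have hcard : Nat.card P = ((fun a => a - c) ⁻¹' (P : Set (AddCircle (1 : ℝ)))).ncard := by
      rw [ncard_preimage_of_injective_subset_range sub_left_injective, ← Nat.card_coe_set_eq]
      · rfl
      · intro x _
        exact ⟨x + c, by simp⟩
    rw [hcard]
    exact this
  · have : Infinite (⊤ : AddSubgroup (AddCircle (1 : ℝ))) := by
      have : Infinite (AddCircle (1 : ℝ)) :=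
        (AddCircle.equivIco (1 : ℝ) 0).infinite_iff.2 (Ico_infinite (by norm_num)).to_subtype
      exact (AddSubgroup.topEquiv (G := AddCircle (1 : ℝ))).toEquiv.infinite_iff.2 this
    rw [Nat.card_eq_zero_of_infinite]
    simp only [AddSubgroup.mem_top, if_true]
    exact ⟨fun _ => 1, by simp, by simp, by simp⟩

open Classical in
lemma hasEuler_coset : ∀ {n : ℕ} {K : AddSubgroup (Fin n → AddCircle (1 : ℝ))}
    (_ : IsClosed (K : Set (Fin n → AddCircle (1 : ℝ)))) (c : Fin n → AddCircle (1 : ℝ)),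
    HasEuler n (fun t => if t - c ∈ K then 1 else 0) (Nat.card K)
  | 0, K, _, c => by
    have h : Fin.elim0 - c = (0 : Fin 0 → AddCircle (1 : ℝ)) := Subsingleton.elim _ _
    have h1 : Nat.card K = 1 := Nat.card_of_subsingleton (0 : K)
    simp only [HasEuler, h, K.zero_mem, if_true, h1, Nat.cast_one]
  | n + 1, K, hK, c => by
    let ι : (Fin n → AddCircle (1 : ℝ)) →+ (Fin (n + 1) → AddCircle (1 : ℝ)) :=
      { toFun := fun y => Fin.cons 0 y
        map_zero' := by ext i; refine Fin.cases ?_ (fun i => ?_) i <;> simp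
        map_add' := fun x y => by ext i; refine Fin.cases ?_ (fun i => ?_) i <;> simp }
    let π : (Fin (n + 1) → AddCircle (1 : ℝ)) →+ AddCircle (1 : ℝ) := Pi.evalAddMonoidHom _ 0
    have hι : Continuous ι := by
      refine continuous_pi fun i => ?_
      refine Fin.cases ?_ (fun i => ?_) i
      · exact continuous_const
      · exact continuous_apply i
    have hK0 : IsClosed ((K.comap ι : AddSubgroup _) : Set (Fin n → AddCircle (1 : ℝ))) :=
      hK.preimage hι
    have hP : IsClosed ((K.map π : AddSubgroup _) : Set (AddCircle (1 : ℝ))) :=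
      (hK.isCompact.image (continuous_apply 0)).isClosed
    have hcard : (Nat.card K : ℤ) = Nat.card (K.comap ι) * Nat.card (K.map π) := by
      have e1 : Nat.card (π.comp K.subtype).range = Nat.card (K.map π) := by
        rw [AddMonoidHom.range_comp, AddSubgroup.range_subtype]
      have e2 : Nat.card (π.comp K.subtype).ker = Nat.card (K.comap ι) := by
        refine Nat.card_congr ⟨fun k => ⟨Fin.tail k.1.1, ?_⟩, fun y => ⟨⟨ι y.1, y.2⟩, rfl⟩, ?_, ?_⟩
        · have h0 : k.1.1 0 = 0 := k.2
          have : ι (Fin.tail k.1.1) = k.1.1 := by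
            change Fin.cons 0 (Fin.tail k.1.1) = k.1.1
            rw [← h0, Fin.cons_self_tail]
          rw [AddSubgroup.mem_comap, this]
          exact k.1.2
        · intro k
          have h0 : k.1.1 0 = 0 := k.2
          ext1; ext1
          change Fin.cons 0 (Fin.tail k.1.1) = k.1.1
          rw [← h0, Fin.cons_self_tail]
        · intro y
          ext1
          exact Fin.tail_cons (α := fun _ => AddCircle (1 : ℝ)) 0 y.1
      rw [← AddSubgroup.card_mul_index (π.comp K.subtype).ker, AddSubgroup.index_ker, e1, e2]
      push_cast
      rfl
    refine ⟨fun t => Nat.card (K.comap ι) * (if t - c 0 ∈ K.map π then 1 else 0), fun t => ?_, ?_⟩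
    · by_cases ht : t - c 0 ∈ K.map π
      · obtain ⟨k, hk, hkt⟩ := AddSubgroup.mem_map.1 ht
        have hkt : k 0 = t - c 0 := hkt
        have := hasEuler_coset hK0 (Fin.tail c + Fin.tail k)
        beta_reduce
        rw [if_pos ht, mul_one]
        convert this using 4 with y
        have e : (Fin.cons t y : Fin (n + 1) → AddCircle (1 : ℝ)) - c
            = ι (y - (Fin.tail c + Fin.tail k)) + k := by
          ext i
          refine Fin.cases ?_ (fun i => ?_) i
          · change t - c 0 = 0 + k 0
            rw [hkt, zero_add]
          · change y i - c i.succ = (y i - (c i.succ + k i.succ)) + k i.succ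
            abel
        rw [e, AddSubgroup.add_mem_cancel_right _ hk, AddSubgroup.mem_comap]
      · beta_reduce
        rw [if_neg ht, mul_zero]
        convert HasEuler.zero n using 2 with y
        refine if_neg fun h => ht ?_
        exact AddSubgroup.mem_map.2 ⟨_, h, rfl⟩
    · rw [hcard]
      exact (hasJumpSum_coset hP (c 0)).const_mul _

/-- The number of points of `C` above a point of the torus. -/
noncomputable def fiberCount {n : ℕ} (C : Set (Fin n → ℝ)) (t : Fin n → AddCircle (1 : ℝ)) : ℤ :=
  {x ∈ C | ∀ i, (x i : AddCircle (1 : ℝ)) = t i}.ncard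

lemma finite_fiber {I : Set ℝ} (hI : Bornology.IsBounded I) (t : AddCircle (1 : ℝ)) :
    {x ∈ I | (x : AddCircle (1 : ℝ)) = t}.Finite := by
  obtain ⟨x₀, rfl⟩ := QuotientAddGroup.mk_surjective t
  obtain ⟨M, hM⟩ := hI.subset_closedBall x₀
  refine ((finite_Icc (-⌈M⌉) ⌈M⌉).image fun k : ℤ => x₀ + k).subset ?_
  rintro x ⟨hx, hxt⟩
  have h1 : ((x - x₀ : ℝ) : AddCircle (1 : ℝ)) = 0 := by
    rw [AddCircle.coe_sub]
    exact sub_eq_zero.2 hxt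
  rw [AddCircle.coe_eq_zero_iff] at h1
  obtain ⟨k, hk⟩ := h1
  simp only [zsmul_eq_mul, mul_one] at hk
  have h2 := hM hx
  rw [Metric.mem_closedBall, Real.dist_eq, ← hk, abs_le] at h2
  have h3 := Int.le_ceil M
  refine ⟨k, ⟨?_, ?_⟩, by simp [hk]⟩
  · have : -(⌈M⌉ : ℝ) ≤ k := by linarith
    exact_mod_cast this
  · have : (k : ℝ) ≤ ⌈M⌉ := by linarith
    exact_mod_cast this

lemma finite_fiber_pi {n : ℕ} {C : Set (Fin n → ℝ)} (hC : Bornology.IsBounded C)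
    (t : Fin n → AddCircle (1 : ℝ)) : {x ∈ C | ∀ i, (x i : AddCircle (1 : ℝ)) = t i}.Finite := by
  refine (Finite.pi' fun i => finite_fiber (hC.image_eval i) (t i)).subset ?_
  rintro x ⟨hx, hxt⟩ i
  exact ⟨⟨x, hx, rfl⟩, hxt i⟩

lemma hasJumpSum_Ioo {a b : ℝ} (hab : a < b) :
    HasJumpSum (fun t => ({x ∈ Ioo a b | (x : AddCircle (1 : ℝ)) = t}.ncard : ℤ)) (-1) := by
  classical
  have hcard : ∀ t : AddCircle (1 : ℝ), ({x ∈ Ico a b | (x : AddCircle (1 : ℝ)) = t}.ncard : ℤ) =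
      {x ∈ Ioo a b | (x : AddCircle (1 : ℝ)) = t}.ncard + if t = (a : AddCircle (1 : ℝ)) then 1 else 0 := by
    intro t
    have hf := finite_fiber (Metric.isBounded_Ioo a b) t
    split_ifs with h
    · have : {x ∈ Ico a b | (x : AddCircle (1 : ℝ)) = t} =
          insert a {x ∈ Ioo a b | (x : AddCircle (1 : ℝ)) = t} := by
        ext x
        simp only [mem_Ico, mem_Ioo, mem_ofPred_eq, mem_insert_iff]
        constructor
        · rintro ⟨⟨h1, h2⟩, h3⟩
          rcases h1.eq_or_lt with h4 | h4
          · exact Or.inl h4.symm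
          · exact Or.inr ⟨⟨h4, h2⟩, h3⟩
        · rintro (rfl | ⟨⟨h1, h2⟩, h3⟩)
          · exact ⟨⟨le_rfl, hab⟩, h.symm⟩
          · exact ⟨⟨h1.le, h2⟩, h3⟩
      rw [this, ncard_insert_of_notMem (by simp) hf]
      push_cast
      rfl
    · rw [add_zero]
      congr 2
      ext x
      simp only [mem_Ico, mem_Ioo, mem_ofPred_eq]
      refine ⟨fun ⟨⟨h1, h2⟩, h3⟩ => ⟨⟨h1.lt_of_ne ?_, h2⟩, h3⟩, fun ⟨⟨h1, h2⟩, h3⟩ => ⟨⟨h1.le, h2⟩, h3⟩⟩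
      rintro rfl
      exact h h3.symm
  have key : (fun t => ({x ∈ Ioo a b | (x : AddCircle (1 : ℝ)) = t}.ncard : ℤ) -
      {x ∈ Ico a b | (x : AddCircle (1 : ℝ)) = t}.ncard) =
      fun t => -(if t = (a : AddCircle (1 : ℝ)) then 1 else 0) := by
    funext t
    rw [hcard]
    ring
  refine ⟨fun t => {x ∈ Ico a b | (x : AddCircle (1 : ℝ)) = t}.ncard, fun t => ?_, ?_, ?_⟩
  · have hfin := finite_fiber (Metric.isBounded_Icc (a - 1) b) t
    have h1 : ∀ᶠ ε : ℝ in 𝓝[>] 0, ∀ x ∈ {x ∈ Icc (a - 1) b | (x : AddCircle (1 : ℝ)) = t},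
        (x + ε ∈ Ioo a b ↔ x ∈ Ico a b) := by
      rw [eventually_all_finite hfin]
      intro x _
      have hx : Tendsto (fun ε : ℝ => x + ε) (𝓝[>] 0) (𝓝 x) := by
        have : Tendsto (fun ε : ℝ => x + ε) (𝓝 0) (𝓝 (x + 0)) :=
          (continuous_const.add continuous_id).tendsto 0
        rw [add_zero] at this
        exact this.mono_left nhdsWithin_le_nhds
      have hpos : ∀ᶠ ε : ℝ in 𝓝[>] 0, 0 < ε := self_mem_nhdsWithin
      rcases lt_or_ge x a with h | h
      · filter_upwards [hx.eventually_lt_const h] with ε h2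
        constructor
        · rintro ⟨h3, _⟩; linarith
        · rintro ⟨h3, _⟩; linarith
      · rcases lt_or_ge x b with h' | h'
        · filter_upwards [hx.eventually_lt_const h', hpos] with ε h2 h3
          exact ⟨fun _ => ⟨h, h'⟩, fun _ => ⟨by linarith, h2⟩⟩
        · filter_upwards [hpos] with ε h3
          constructor
          · rintro ⟨_, h4⟩; linarith
          · rintro ⟨_, h4⟩; linarith
    have h2 : ∀ᶠ ε : ℝ in 𝓝[>] 0, ε ∈ Ioo (0 : ℝ) 1 := Ioo_mem_nhdsGT one_pos
    filter_upwards [h1, h2] with ε h1 ⟨h2, h3⟩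
    congr 1
    rw [← ncard_image_of_injective {x ∈ Ico a b | (x : AddCircle (1 : ℝ)) = t}
      (add_left_injective ε)]
    congr 1
    ext y
    simp only [mem_ofPred_eq, mem_image]
    constructor
    · rintro ⟨hy, hyt⟩
      have hyt' : ((y - ε : ℝ) : AddCircle (1 : ℝ)) = t := by
        rw [AddCircle.coe_sub, hyt, add_sub_cancel_right]
      refine ⟨y - ε, ⟨(h1 (y - ε) ⟨⟨?_, ?_⟩, hyt'⟩).1 (by simpa using hy), hyt'⟩, by simp⟩
      · linarith [hy.1]
      · linarith [hy.2]
    · rintro ⟨x, ⟨hx, hxt⟩, rfl⟩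
      refine ⟨(h1 x ⟨⟨?_, ?_⟩, hxt⟩).2 hx, by rw [AddCircle.coe_add, hxt]⟩
      · linarith [hx.1]
      · linarith [hx.2]
  · rw [key]
    refine (finite_singleton (a : AddCircle (1 : ℝ))).subset fun t ht => ?_
    by_contra h
    have h : t ≠ a := h
    simp [h] at ht
  · rw [key, finsum_eq_single _ (a : AddCircle (1 : ℝ))]
    · simp
    · intro t ht
      simp [ht]

lemma exists_eq_Ioo {I : Set ℝ} (hc : Convex ℝ I) (ho : IsOpen I) (hb : Bornology.IsBounded I)
    (hne : I.Nonempty) : ∃ a b, a < b ∧ I = Ioo a b := by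
  have hI : I = Ioo (sInf I) (sSup I) := by
    refine Subset.antisymm (fun x hx => ?_)
      (IsConnected.Ioo_csInf_csSup_subset ⟨hne, hc.isPreconnected⟩ hb.bddBelow hb.bddAbove)
    obtain ⟨ε, hε, h⟩ := Metric.isOpen_iff.1 ho x hx
    have h1 : x - ε / 2 ∈ I := h (by rw [Metric.mem_ball, Real.dist_eq, abs_lt]; constructor <;> linarith)
    have h2 : x + ε / 2 ∈ I := h (by rw [Metric.mem_ball, Real.dist_eq, abs_lt]; constructor <;> linarith)
    have h3 := csInf_le hb.bddBelow h1
    have h4 := le_csSup hb.bddAbove h2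
    constructor <;> linarith
  refine ⟨sInf I, sSup I, ?_, hI⟩
  obtain ⟨x, hx⟩ := hne
  rw [hI] at hx
  exact hx.1.trans hx.2

lemma fiberCount_cons {n : ℕ} {C : Set (Fin (n + 1) → ℝ)} (hC : Bornology.IsBounded C)
    (t : AddCircle (1 : ℝ)) (y : Fin n → AddCircle (1 : ℝ)) :
    fiberCount C (Fin.cons t y) =
      ∑ a ∈ (finite_fiber (hC.image_eval 0) t).toFinset, fiberCount {z | Fin.cons a z ∈ C} y := by
  classical
  have hf := finite_fiber_pi hC (Fin.cons t y)
  unfold fiberCount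
  rw [ncard_eq_toFinset_card _ hf, Finset.card_eq_sum_card_fiberwise (f := fun x => x 0)
    (t := (finite_fiber (hC.image_eval 0) t).toFinset)]
  · push_cast
    refine Finset.sum_congr rfl fun a ha => ?_
    rw [← ncard_coe_finset, ← ncard_image_of_injective
      {z ∈ {z | Fin.cons a z ∈ C} | ∀ i, (z i : AddCircle (1 : ℝ)) = y i}
      (Fin.cons_right_injective (α := fun _ => ℝ) a)]
    refine congrArg (fun s : Set (Fin (n + 1) → ℝ) => (s.ncard : ℤ)) ?_
    simp only [Finite.mem_toFinset, mem_ofPred_eq] at ha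
    ext x
    simp only [Finset.coe_filter, Finite.mem_toFinset, mem_ofPred_eq, mem_image]
    constructor
    · rintro ⟨⟨hx, hxt⟩, rfl⟩
      refine ⟨Fin.tail x, ⟨by rwa [Fin.cons_self_tail], fun i => hxt i.succ⟩,
        Fin.cons_self_tail x⟩
    · rintro ⟨z, ⟨hz, hzt⟩, rfl⟩
      refine ⟨⟨hz, fun i => ?_⟩, rfl⟩
      refine Fin.cases ?_ (fun i => ?_) i
      · simpa using ha.2
      · simpa using hzt i
  · intro x hx
    simp only [Finite.coe_toFinset, mem_ofPred_eq] at hx ⊢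
    exact ⟨⟨x, hx.1, rfl⟩, by simpa using hx.2 0⟩

lemma hasEuler_fiberCount : ∀ {n : ℕ} {C : Set (Fin n → ℝ)}, Convex ℝ C → IsOpen C →
    Bornology.IsBounded C → C.Nonempty → HasEuler n (fiberCount C) ((-1) ^ n)
  | 0, C, _, _, _, hne => by
    have hC : C = univ := Subsingleton.eq_univ_of_nonempty hne
    simp [HasEuler, fiberCount, hC]
  | n + 1, C, hc, ho, hb, hne => by
    have hcons : ∀ a : ℝ, Continuous fun z : Fin n → ℝ => (Fin.cons a z : Fin (n + 1) → ℝ) := by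
      intro a
      refine continuous_pi fun i => ?_
      refine Fin.cases ?_ (fun i => ?_) i
      · exact continuous_const
      · exact continuous_apply i
    obtain ⟨a, b, hab, hI⟩ := exists_eq_Ioo (I := Function.eval 0 '' C)
      (hc.linear_image (LinearMap.proj 0)) (isOpenMap_eval 0 _ ho) (hb.image_eval 0)
      (hne.image _)
    refine ⟨fun t => (-1) ^ n * {x ∈ Ioo a b | (x : AddCircle (1 : ℝ)) = t}.ncard,
      fun t => ?_, ?_⟩
    · have hf := finite_fiber (hb.image_eval 0) t
      simp_rw [fiberCount_cons hb]
      rw [← hI, ncard_eq_toFinset_card _ hf, mul_comm, ← nsmul_eq_mul, ← Finset.sum_const]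
      refine HasEuler.sum _ fun x hx => ?_
      simp only [Finite.mem_toFinset, mem_ofPred_eq] at hx
      obtain ⟨⟨z, hz, rfl⟩, -⟩ := hx
      refine hasEuler_fiberCount ?_ (ho.preimage (hcons _)) ?_
        ⟨Fin.tail z, by simpa [Fin.cons_self_tail] using hz⟩
      · intro x hx y hy s r hs hr hsr
        have := hc hx hy hs hr hsr
        change Fin.cons _ _ ∈ C
        convert this using 1
        ext i
        refine Fin.cases ?_ (fun i => ?_) i
        · simp [← add_mul, hsr]
        · simp
      · refine (Metric.isBounded_iff_subset_closedBall 0).2 ?_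
        obtain ⟨M, hM⟩ := hb.subset_closedBall 0
        have hM0 : 0 ≤ M := by
          simpa using dist_nonneg.trans (hM hz)
        refine ⟨M, fun y hy => ?_⟩
        have h1 := hM hy
        rw [mem_closedBall_zero_iff, pi_norm_le_iff_of_nonneg hM0] at h1 ⊢
        intro i
        simpa using h1 i.succ
    · rw [pow_succ]
      exact (hasJumpSum_Ioo hab).const_mul _

lemma apply_eq_sum_single {R M : Type*} [CommSemiring R] [AddCommMonoid M] [Module R M] {n : ℕ}
    (f : (Fin n → R) →ₗ[R] M) (v : Fin n → R) : f v = ∑ i, v i • f (Pi.single i 1) := by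
  conv_lhs => rw [← Finset.univ_sum_single v]
  rw [map_sum]
  refine Finset.sum_congr rfl fun i _ => ?_
  rw [← map_smul, ← Pi.single_smul, smul_eq_mul, mul_one]

lemma eq_zero_of_dotProduct_eq_zero {n : ℕ} {S : Set (Fin n → ℝ)} (hS : Submodule.span ℝ S = ⊤)
    {w : Fin n → ℝ} (hw : ∀ v ∈ S, ∑ i, v i * w i = 0) : w = 0 := by
  have h : Submodule.span ℝ S ≤ LinearMap.ker (Fintype.linearCombination ℝ w) := by
    rw [Submodule.span_le]
    intro v hv
    simpa [Fintype.linearCombination_apply] using hw v hv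
  rw [hS] at h
  funext i
  have := h (Submodule.mem_top (x := Pi.single i 1))
  simpa using this

lemma coe_dotProduct {n : ℕ} (v : Fin n → ℤ) (x : Fin n → ℝ) :
    ((∑ i, (v i : ℝ) * x i : ℝ) : AddCircle (1 : ℝ)) = ∑ i, v i • (x i : AddCircle (1 : ℝ)) := by
  have h := map_sum (QuotientAddGroup.mk' (AddSubgroup.zmultiples (1 : ℝ)))
    (fun i => (v i : ℝ) * x i) Finset.univ
  refine h.trans (Finset.sum_congr rfl fun i _ => ?_)
  rw [← zsmul_eq_mul, map_zsmul]
  rfl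

/-- The common zero set in the torus of the characters in the sublist `A`. -/
def zeroLocus {n N : ℕ} (X : Fin N → Fin n → ℤ) (A : Finset (Fin N)) :
    AddSubgroup (Fin n → AddCircle (1 : ℝ)) where
  carrier := {t | ∀ k ∈ A, ∑ i, X k i • t i = 0}
  zero_mem' k _ := by simp
  add_mem' {s t} hs ht k hk := by simp [Finset.sum_add_distrib, hs k hk, ht k hk]
  neg_mem' {t} ht k hk := by simp [ht k hk]

lemma mem_zeroLocus {n N : ℕ} {X : Fin N → Fin n → ℤ} {A : Finset (Fin N)}
    {t : Fin n → AddCircle (1 : ℝ)} : t ∈ zeroLocus X A ↔ ∀ k ∈ A, ∑ i, X k i • t i = 0 := Iff.rfl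

lemma continuous_character {n : ℕ} (v : Fin n → ℤ) :
    Continuous fun t : Fin n → AddCircle (1 : ℝ) => ∑ i, v i • t i :=
  continuous_finsetSum _ fun i _ => (continuous_apply i).zsmul (v i)

lemma isClosed_zeroLocus {n N : ℕ} (X : Fin N → Fin n → ℤ) (A : Finset (Fin N)) :
    IsClosed (zeroLocus X A : Set (Fin n → AddCircle (1 : ℝ))) := by
  have : (zeroLocus X A : Set (Fin n → AddCircle (1 : ℝ))) =
      ⋂ k ∈ A, {t | ∑ i, X k i • t i = 0} := by
    ext t
    simp [mem_zeroLocus]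
  rw [this]
  exact isClosed_biInter fun k _ => isClosed_eq (continuous_character (X k)) continuous_const

lemma rnk_eq_iff {n N : ℕ} {X : Fin N → Fin n → ℤ} {A : Finset (Fin N)} :
    rnk X A = n ↔ Submodule.span ℝ ((fun i (j : Fin n) => (X i j : ℝ)) '' ↑A) = ⊤ := by
  refine ⟨fun h => Submodule.eq_top_of_finrank_eq (h.trans (by simp)), fun h => ?_⟩
  rw [rnk, h]
  simp

lemma rnk_le {n N : ℕ} (X : Fin N → Fin n → ℤ) (A : Finset (Fin N)) : rnk X A ≤ n :=
  (Submodule.finrank_le _).trans (by simp)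

lemma infinite_zeroLocus {n N : ℕ} {X : Fin N → Fin n → ℤ} {A : Finset (Fin N)}
    (h : rnk X A ≠ n) : Infinite (zeroLocus X A) := by
  obtain ⟨f, hf, hle⟩ := Submodule.exists_le_ker_of_lt_top _
    (lt_top_iff_ne_top.2 (rnk_eq_iff.not.1 h))
  have hfe : ∀ v : Fin n → ℝ, f v = ∑ i, v i * f (Pi.single i 1) := apply_eq_sum_single f
  obtain ⟨i, hi⟩ : ∃ i, f (Pi.single i 1) ≠ 0 := by
    by_contra! hi
    refine hf (LinearMap.ext fun v => ?_)
    rw [hfe, LinearMap.zero_apply]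
    exact Finset.sum_eq_zero fun i _ => by rw [hi, mul_zero]
  let γ : ℝ → zeroLocus X A := fun s =>
    ⟨fun j => ((s * f (Pi.single j 1) : ℝ) : AddCircle (1 : ℝ)), fun k hk => by
      have h1 : f (fun j => (X k j : ℝ)) = 0 := hle (Submodule.subset_span ⟨k, hk, rfl⟩)
      rw [← coe_dotProduct]
      have h2 : ∑ j, (X k j : ℝ) * (s * f (Pi.single j 1)) = s * f (fun j => (X k j : ℝ)) := by
        rw [hfe, Finset.mul_sum]
        exact Finset.sum_congr rfl fun j _ => by ring
      rw [h2, h1, mul_zero]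
      rfl⟩
  have : Infinite (AddCircle (1 : ℝ)) :=
    (AddCircle.equivIco (1 : ℝ) 0).infinite_iff.2 (Ico_infinite (by norm_num)).to_subtype
  refine Infinite.of_surjective (fun t : zeroLocus X A => t.1 i) fun t => ?_
  obtain ⟨x, rfl⟩ := QuotientAddGroup.mk_surjective t
  refine ⟨γ (x / f (Pi.single i 1)), ?_⟩
  change ((x / f (Pi.single i 1) * f (Pi.single i 1) : ℝ) : AddCircle (1 : ℝ)) = _
  rw [div_mul_cancel₀ _ hi]

lemma torsion_quotient_eq_top {n N : ℕ} {X : Fin N → Fin n → ℤ} {A : Finset (Fin N)}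
    (h : rnk X A = n) :
    Submodule.torsion ℤ ((Fin n → ℤ) ⧸ Submodule.span ℤ (X '' ↑A)) = ⊤ := by
  rw [rnk_eq_iff] at h
  set Q := (Fin n → ℤ) ⧸ Submodule.span ℤ (X '' ↑A) with hQ
  rw [eq_top_iff]
  intro q _
  rw [← Submodule.Quotient.mk_eq_zero, ← Module.forall_dual_apply_eq_zero_iff ℤ]
  intro f
  let F : (Fin n → ℤ) →ₗ[ℤ] ℤ :=
    (f.comp (Submodule.torsion ℤ Q).mkQ).comp (Submodule.span ℤ (X '' ↑A)).mkQ
  have hFe : ∀ v : Fin n → ℤ, F v = ∑ i, v i * F (Pi.single i 1) := apply_eq_sum_single F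
  have hw := eq_zero_of_dotProduct_eq_zero h (w := fun i => (F (Pi.single i 1) : ℝ)) (by
    rintro _ ⟨k, hk, rfl⟩
    have h0 : F (X k) = 0 := by
      have : (Submodule.span ℤ (X '' ↑A)).mkQ (X k) = 0 :=
        (Submodule.Quotient.mk_eq_zero _).2 (Submodule.subset_span ⟨k, hk, rfl⟩)
      simp only [F, LinearMap.comp_apply, this, map_zero]
    rw [hFe] at h0
    change ∑ i, (X k i : ℝ) * (F (Pi.single i 1) : ℝ) = 0
    exact_mod_cast h0)
  obtain ⟨v, rfl⟩ := Submodule.Quotient.mk_surjective _ q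
  change F v = 0
  rw [hFe]
  refine Finset.sum_eq_zero fun i _ => ?_
  have := congrFun hw i
  simp only [Pi.zero_apply, Int.cast_eq_zero] at this
  rw [this, mul_zero]

/-- The points of `zeroLocus X A` are the homomorphisms from `ℤ^n / ⟨A⟩` to the circle. -/
lemma card_zeroLocus_eq_card_hom {n N : ℕ} (X : Fin N → Fin n → ℤ) (A : Finset (Fin N)) :
    Nat.card (zeroLocus X A) =
      Nat.card (((Fin n → ℤ) ⧸ Submodule.span ℤ (X '' ↑A)) →ₗ[ℤ] AddCircle (1 : ℝ)) := by
  symm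
  refine Nat.card_congr (Equiv.ofBijective
    (fun f => (⟨fun i => f (Submodule.Quotient.mk (Pi.single i 1)), fun k hk => ?_⟩ :
      zeroLocus X A)) ⟨fun f g hfg => ?_, fun t => ?_⟩)
  · refine (apply_eq_sum_single (f.comp (Submodule.mkQ _)) (X k)).symm.trans ?_
    have : (Submodule.span ℤ (X '' ↑A)).mkQ (X k) = 0 :=
      (Submodule.Quotient.mk_eq_zero _).2 (Submodule.subset_span ⟨k, hk, rfl⟩)
    rw [LinearMap.comp_apply, this, map_zero]
  · refine Submodule.linearMap_qext _ (LinearMap.ext fun v => ?_)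
    rw [apply_eq_sum_single, apply_eq_sum_single (g.comp _)]
    refine Finset.sum_congr rfl fun i _ => ?_
    exact congrArg (v i • ·) (congrFun (congrArg Subtype.val hfg) i)
  · refine ⟨Submodule.liftQ _ (Fintype.linearCombination ℤ t.1) ?_, ?_⟩
    · rw [Submodule.span_le]
      rintro _ ⟨k, hk, rfl⟩
      exact t.2 k hk
    · ext i
      simp

lemma card_hom_addCircle (Q : Type) [AddCommGroup Q] [Finite Q] :
    Nat.card (Q →ₗ[ℤ] AddCircle (1 : ℝ)) = Nat.card Q := by
  have := Fintype.ofFinite Q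
  have hinj := AddCircle.injective_toCircle (one_ne_zero (α := ℝ))
  have h1 : Nat.card (Q →ₗ[ℤ] AddCircle (1 : ℝ)) = Nat.card (AddChar Q Circle) := by
    refine Nat.card_congr (Equiv.ofBijective (fun f =>
      ({ toFun := fun q => AddCircle.toCircle (f q)
         map_zero_eq_one' := by simp
         map_add_eq_mul' := fun a b => by rw [map_add, AddCircle.toCircle_add] } :
        AddChar Q Circle)) ⟨fun f g hfg => ?_, fun χ => ?_⟩)
    · ext q
      exact hinj (DFunLike.congr_fun hfg q)
    · have hs : ∀ z : Circle, ∃ t : AddCircle (1 : ℝ), AddCircle.toCircle t = z :=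
by
        intro z
        obtain ⟨t, ht⟩ := (AddCircle.homeomorphCircle (one_ne_zero (α := ℝ))).surjective z
        exact ⟨t, by rw [← ht, AddCircle.homeomorphCircle_apply]⟩
      choose s hs using hs
      refine ⟨(AddMonoidHom.mk' (fun q => s (χ q)) fun a b => hinj ?_).toIntLinearMap, ?_⟩
      · rw [AddCircle.toCircle_add, hs, hs, hs, AddChar.map_add_eq_mul]
      · ext q
        exact congrArg _ (hs (χ q))
  rw [h1, Nat.card_congr AddChar.circleEquivComplex.toEquiv, Nat.card_eq_fintype_card,
    Nat.card_eq_fintype_card, AddChar.card_eq]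

lemma card_zeroLocus {n N : ℕ} {X : Fin N → Fin n → ℤ} {A : Finset (Fin N)}
    (h : rnk X A = n) : Nat.card (zeroLocus X A) = mult X A := by
  have htop := torsion_quotient_eq_top h
  have : Finite ((Fin n → ℤ) ⧸ Submodule.span ℤ (X '' ↑A)) := by
    refine Module.finite_of_fg_torsion _ ?_
    intro q
    exact (Submodule.mem_torsion_iff q).1 (htop ▸ Submodule.mem_top)
  rw [card_zeroLocus_eq_card_hom, card_hom_addCircle, mult, htop]
  exact (Nat.card_congr Submodule.topEquiv.toEquiv).symm

open Classical in
lemma indicator_compactComplement {n N : ℕ} (X : Fin N → Fin n → ℤ)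
    (t : Fin n → AddCircle (1 : ℝ)) :
    (if t ∈ compactComplement X then 1 else 0 : ℤ) =
      ∑ A : Finset (Fin N), (-1) ^ A.card * if t - 0 ∈ zeroLocus X A then 1 else 0 := by
  have h := Finset.prod_one_add (f := fun k : Fin N => -(if ∑ i, X k i • t i = 0 then 1 else 0 : ℤ))
    Finset.univ
  rw [Finset.powerset_univ] at h
  refine Eq.trans ?_ (h.trans (Finset.sum_congr rfl fun A _ => ?_))
  · split_ifs with ht
    · rw [Finset.prod_eq_one]
      intro k _
      rw [if_neg (ht k)]
      rfl
    · simp only [compactComplement, mem_ofPred_eq, not_forall, not_not] at ht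
      obtain ⟨k, hk⟩ := ht
      rw [Finset.prod_eq_zero (Finset.mem_univ k)]
      rw [if_pos hk]
      rfl
  · rw [Finset.prod_neg, sub_zero]
    congr 1
    rw [Finset.prod_ite_zero]
    simp [mem_zeroLocus]

open Classical in
lemma hasEuler_compactComplement {n N : ℕ} (X : Fin N → Fin n → ℤ) :
    HasEuler n (fun t => if t ∈ compactComplement X then 1 else 0)
      (∑ A : Finset (Fin N), (-1) ^ A.card * Nat.card (zeroLocus X A)) := by
  simp_rw [indicator_compactComplement]
  exact HasEuler.sum _ fun A _ => (hasEuler_coset (isClosed_zeroLocus X A) 0).const_mul _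

lemma Mpoly_one_zero {n N : ℕ} {X : Fin N → Fin n → ℤ} (h : rnk X Finset.univ = n) :
    Mpoly X 1 0 = (-1) ^ n * ∑ A : Finset (Fin N), (-1) ^ A.card * (Nat.card (zeroLocus X A) : ℝ) := by
  rw [Mpoly, Finset.mul_sum]
  refine Finset.sum_congr rfl fun A _ => ?_
  by_cases hA : rnk X A = n
  · have hle : n ≤ A.card := by
      classical
      have h1 : rnk X A ≤ (A.image fun k (i : Fin n) => (X k i : ℝ)).card := by
        rw [rnk, ← Finset.coe_image]
        exact finrank_span_finset_le_card _
      exact hA ▸ h1.trans Finset.card_image_le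
    rw [card_zeroLocus hA, h, hA, sub_self, Nat.sub_self, pow_zero, mul_one, zero_sub,
      ← mul_assoc, ← pow_add, mul_comm]
    congr 1
    rw [neg_one_pow_congr]
    grind
  · have := infinite_zeroLocus hA
    have hlt : n - rnk X A ≠ 0 := by
      have := rnk_le X A
      omega
    rw [h, Nat.card_eq_zero_of_infinite, sub_self, zero_pow hlt]
    simp

/-- A chamber of the periodic hyperplane arrangement in `ℝ^n` that lifts the toric arrangement. -/
def chamber {n N : ℕ} (X : Fin N → Fin n → ℤ) (v : Fin N → ℤ) : Set (Fin n → ℝ) :=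
  {x | ∀ k, ∑ i, (X k i : ℝ) * x i ∈ Ioo (v k : ℝ) (v k + 1)}

/-- The image of a chamber in the torus. -/
def toricChamber {n N : ℕ} (X : Fin N → Fin n → ℤ) (v : Fin N → ℤ) :
    Set (Fin n → AddCircle (1 : ℝ)) :=
  (fun x i => (x i : AddCircle (1 : ℝ))) '' chamber X v

section chamber

variable {n N : ℕ} {X : Fin N → Fin n → ℤ} {v v' : Fin N → ℤ}

lemma convex_chamber : Convex ℝ (chamber X v) := by
  have : chamber X v =
      ⋂ k, Fintype.linearCombination ℝ (fun i => (X k i : ℝ)) ⁻¹' Ioo (v k : ℝ) (v k + 1) := by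
    ext x
    simp [chamber, Fintype.linearCombination_apply, mul_comm]
  rw [this]
  exact convex_iInter fun k => (convex_Ioo _ _).linear_preimage _

lemma isOpen_chamber : IsOpen (chamber X v) := by
  have : chamber X v =
      ⋂ k, (fun x : Fin n → ℝ => ∑ i, (X k i : ℝ) * x i) ⁻¹' Ioo (v k : ℝ) (v k + 1) := by
    ext x
    simp [chamber]
  rw [this]
  exact isOpen_iInter_of_finite fun k => isOpen_Ioo.preimage (by fun_prop)

lemma eq_zero_of_forall_dotProduct_eq_zero
    (hspan : Submodule.span ℝ (range (fun i (j : Fin n) => (X i j : ℝ))) = ⊤) {x : Fin n → ℝ}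
    (hx : ∀ k, ∑ i, (X k i : ℝ) * x i = 0) : x = 0 :=
  eq_zero_of_dotProduct_eq_zero hspan (by rintro _ ⟨k, rfl⟩; exact hx k)

lemma isBounded_chamber
    (hspan : Submodule.span ℝ (range (fun i (j : Fin n) => (X i j : ℝ))) = ⊤) :
    Bornology.IsBounded (chamber X v) := by
  let L : (Fin n → ℝ) →ₗ[ℝ] (Fin N → ℝ) :=
    LinearMap.pi fun k => Fintype.linearCombination ℝ (fun i => (X k i : ℝ))
  have hL : ∀ x k, L x k = ∑ i, (X k i : ℝ) * x i := by
    intro x k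
    simp [L, Fintype.linearCombination_apply, mul_comm]
  have hker : LinearMap.ker L = ⊥ := by
    refine LinearMap.ker_eq_bot'.2 fun x hx => eq_zero_of_forall_dotProduct_eq_zero hspan fun k => ?_
    rw [← hL, hx]
    rfl
  obtain ⟨K, -, hK⟩ := L.exists_antilipschitzWith hker
  refine (hK.isBounded_preimage (s := pi univ fun k => Ioo (v k : ℝ) (v k + 1))
    (Bornology.IsBounded.pi fun k => Metric.isBounded_Ioo _ _)).subset fun x hx => ?_
  intro k _
  rw [hL]
  exact hx k

lemma isOpen_toricChamber : IsOpen (toricChamber X v) := by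
  have : IsOpenMap fun (x : Fin n → ℝ) i => (x i : AddCircle (1 : ℝ)) :=
    IsOpenMap.piMap (fun _ => QuotientAddGroup.isOpenMap_coe) (by simp)
  exact this _ isOpen_chamber

lemma isPreconnected_toricChamber : IsPreconnected (toricChamber X v) :=
  convex_chamber.isPreconnected.image _
    (continuous_pi fun i => (AddCircle.continuous_mk' 1).comp (continuous_apply i)).continuousOn

lemma toricChamber_subset : toricChamber X v ⊆ compactComplement X := by
  rintro _ ⟨x, hx, rfl⟩ k h
  rw [← coe_dotProduct, AddCircle.coe_eq_zero_iff] at h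
  obtain ⟨m, hm⟩ := h
  simp only [zsmul_eq_mul, mul_one] at hm
  obtain ⟨h1, h2⟩ := hx k
  rw [← hm] at h1 h2
  norm_cast at h1 h2
  omega

lemma exists_int_sub {x x' : Fin n → ℝ}
    (h : ∀ i, (x i : AddCircle (1 : ℝ)) = (x' i : AddCircle (1 : ℝ))) :
    ∃ m : Fin n → ℤ, ∀ i, x' i = x i + m i := by
  have : ∀ i, ∃ m : ℤ, x' i = x i + m := by
    intro i
    have h1 : ((x' i - x i : ℝ) : AddCircle (1 : ℝ)) = 0 := by
      rw [AddCircle.coe_sub, h, sub_self]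
    rw [AddCircle.coe_eq_zero_iff] at h1
    obtain ⟨m, hm⟩ := h1
    simp only [zsmul_eq_mul, mul_one] at hm
    exact ⟨m, by rw [hm]; ring⟩
  exact ⟨fun i => (this i).choose, fun i => (this i).choose_spec⟩

lemma dotProduct_add_int {k : Fin N} {x x' : Fin n → ℝ} {m : Fin n → ℤ}
    (h : ∀ i, x' i = x i + m i) :
    ∑ i, (X k i : ℝ) * x' i = ∑ i, (X k i : ℝ) * x i + ((∑ i, X k i * m i : ℤ) : ℝ) := by
  push_cast
  rw [← Finset.sum_add_distrib]
  exact Finset.sum_congr rfl fun i _ => by rw [h]; ring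

lemma toricChamber_subset_of_mem {t : Fin n → AddCircle (1 : ℝ)} (ht : t ∈ toricChamber X v)
    (ht' : t ∈ toricChamber X v') : toricChamber X v ⊆ toricChamber X v' := by
  obtain ⟨x, hx, rfl⟩ := ht
  obtain ⟨x', hx', hxx'⟩ := ht'
  obtain ⟨m, hm⟩ := exists_int_sub fun i => (congrFun hxx' i).symm
  have hv : ∀ k, v' k = v k + ∑ i, X k i * m i := by
    intro k
    obtain ⟨h1, h2⟩ := hx k
    obtain ⟨h3, h4⟩ := hx' k
    rw [dotProduct_add_int hm] at h3 h4
    have h5 : ((v' k : ℤ) : ℝ) < ((v k + 1 + ∑ i, X k i * m i : ℤ) : ℝ) := by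
      rw [Int.cast_add, Int.cast_add, Int.cast_one]
      linarith
    have h6 : ((v k + ∑ i, X k i * m i : ℤ) : ℝ) < ((v' k + 1 : ℤ) : ℝ) := by
      rw [Int.cast_add, Int.cast_add, Int.cast_one]
      linarith
    norm_cast at h5 h6
    omega
  rintro _ ⟨y, hy, rfl⟩
  refine ⟨fun i => y i + m i, fun k => ?_, ?_⟩
  · rw [dotProduct_add_int (x := y) (m := m) fun i => rfl, hv]
    obtain ⟨h1, h2⟩ := hy k
    rw [Int.cast_add]
    constructor <;> linarith
  · funext i
    have : ((m i : ℝ) : AddCircle (1 : ℝ)) = 0 :=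
      (AddCircle.coe_eq_zero_iff 1).2 ⟨m i, by simp⟩
    change ((y i + m i : ℝ) : AddCircle (1 : ℝ)) = _
    rw [AddCircle.coe_add, this, add_zero]

lemma injOn_chamber (hspan : Submodule.span ℝ (range (fun i (j : Fin n) => (X i j : ℝ))) = ⊤) :
    InjOn (fun (x : Fin n → ℝ) i => (x i : AddCircle (1 : ℝ))) (chamber X v) := by
  intro x hx x' hx' h
  obtain ⟨m, hm⟩ := exists_int_sub (congrFun h)
  have h0 : (fun i => (m i : ℝ)) = 0 := by
    refine eq_zero_of_forall_dotProduct_eq_zero hspan fun k => ?_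
    obtain ⟨h1, h2⟩ := hx k
    obtain ⟨h3, h4⟩ := hx' k
    rw [dotProduct_add_int hm] at h3 h4
    have h5 : ((-1 : ℤ) : ℝ) < ((∑ i, X k i * m i : ℤ) : ℝ) := by
      rw [Int.cast_neg, Int.cast_one]
      linarith
    have h6 : ((∑ i, X k i * m i : ℤ) : ℝ) < ((1 : ℤ) : ℝ) := by
      rw [Int.cast_one]
      linarith
    have h7 : ∑ i, X k i * m i = 0 := by
      rw [Int.cast_lt] at h5 h6
      omega
    exact_mod_cast h7
  funext i
  have := congrFun h0 i
  simp only [Pi.zero_apply] at this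
  rw [hm, this, add_zero]

open Classical in
lemma fiberCount_chamber
    (hspan : Submodule.span ℝ (range (fun i (j : Fin n) => (X i j : ℝ))) = ⊤) :
    fiberCount (chamber X v) = fun t => if t ∈ toricChamber X v then 1 else 0 := by
  funext t
  unfold fiberCount
  split_ifs with h
  · obtain ⟨x, hx, rfl⟩ := h
    have : {y ∈ chamber X v | ∀ i, (y i : AddCircle (1 : ℝ)) = (x i : AddCircle (1 : ℝ))} = {x} := by
      ext y
      refine ⟨fun hy => injOn_chamber hspan hy.1 hx (funext hy.2), ?_⟩
      rintro rfl
      exact ⟨hx, fun _ => rfl⟩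
    rw [this]
    simp
  · have : {y ∈ chamber X v | ∀ i, (y i : AddCircle (1 : ℝ)) = t i} = ∅ := by
      rw [eq_empty_iff_forall_notMem]
      exact fun y hy => h ⟨y, hy.1, funext hy.2⟩
    rw [this]
    simp

lemma exists_mem_toricChamber {t : Fin n → AddCircle (1 : ℝ)} (ht : t ∈ compactComplement X) :
    ∃ v ∈ {v : Fin N → ℤ | ∀ k, v k ∈ Icc (-∑ i, |X k i|) (∑ i, |X k i|)},
      t ∈ toricChamber X v := by
  have hlift : ∀ i, ∃ x ∈ Ico (0 : ℝ) 1, (x : AddCircle (1 : ℝ)) = t i := by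
    intro i
    have h := (AddCircle.equivIco (1 : ℝ) 0 (t i)).2
    exact ⟨_, by simpa only [zero_add] using h, (AddCircle.equivIco (1 : ℝ) 0).symm_apply_apply (t i)⟩
  choose x hx hxt using hlift
  obtain rfl : (fun i => (x i : AddCircle (1 : ℝ))) = t := funext hxt
  refine ⟨fun k => ⌊∑ i, (X k i : ℝ) * x i⌋, fun k => ?_, x, fun k => ⟨?_, Int.lt_floor_add_one _⟩, rfl⟩
  · have habs : |∑ i, (X k i : ℝ) * x i| ≤ ((∑ i, |X k i| : ℤ) : ℝ) := by
      push_cast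
      refine (Finset.abs_sum_le_sum_abs _ _).trans (Finset.sum_le_sum fun i _ => ?_)
      rw [abs_mul, abs_of_nonneg (hx i).1]
      exact mul_le_of_le_one_right (abs_nonneg _) (hx i).2.le
    rw [abs_le] at habs
    constructor
    · rw [Int.le_floor, Int.cast_neg]
      exact habs.1
    · have := (Int.floor_le (∑ i, (X k i : ℝ) * x i)).trans habs.2
      exact_mod_cast this
  · refine lt_of_le_of_ne (Int.floor_le _) fun h => ht k ?_
    rw [← coe_dotProduct, ← h]
    exact (AddCircle.coe_eq_zero_iff 1).2 ⟨⌊∑ i, (X k i : ℝ) * x i⌋, by simp⟩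

lemma mem_toricChamber_iff {s : compactComplement X} (hs : s.1 ∈ toricChamber X v)
    {t : compactComplement X} :
    t.1 ∈ toricChamber X v ↔ (t : ConnectedComponents (compactComplement X)) = s := by
  constructor
  · intro ht
    have hpre : IsPreconnected ((↑) ⁻¹' toricChamber X v : Set (compactComplement X)) := by
      rw [← Topology.IsInducing.subtypeVal.isPreconnected_image,
        Subtype.image_preimage_coe, inter_eq_right.2 toricChamber_subset]
      exact isPreconnected_toricChamber
    rw [ConnectedComponents.coe_eq_coe']
    exact hpre.subset_connectedComponent hs ht
  · intro h
    have hclopen : IsClopen ((↑) ⁻¹' toricChamber X v : Set (compactComplement X)) := by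
      refine ⟨⟨?_⟩, isOpen_toricChamber.preimage continuous_subtype_val⟩
      rw [isOpen_iff_mem_nhds]
      intro r hr
      obtain ⟨w, -, hw⟩ := exists_mem_toricChamber r.2
      filter_upwards [(isOpen_toricChamber.preimage continuous_subtype_val).mem_nhds hw] with q hq hq'
      exact hr (toricChamber_subset_of_mem hq hq' hw)
    rw [ConnectedComponents.coe_eq_coe'] at h
    exact hclopen.connectedComponent_subset hs h

lemma finite_connectedComponents (X : Fin N → Fin n → ℤ) :
    Finite (ConnectedComponents (compactComplement X)) := by
  have hfin : {v : Fin N → ℤ | ∀ k, v k ∈ Icc (-∑ i, |X k i|) (∑ i, |X k i|)}.Finite :=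
    Finite.pi' fun k => finite_Icc _ _
  have : Finite {v : Fin N → ℤ | ∀ k, v k ∈ Icc (-∑ i, |X k i|) (∑ i, |X k i|)} := hfin
  have h : ∀ c : ConnectedComponents (compactComplement X), ∃ v : {v : Fin N → ℤ |
      ∀ k, v k ∈ Icc (-∑ i, |X k i|) (∑ i, |X k i|)}, ∃ s : compactComplement X,
      (s : ConnectedComponents (compactComplement X)) = c ∧ s.1 ∈ toricChamber X v.1 := by
    intro c
    obtain ⟨s, rfl⟩ := ConnectedComponents.surjective_coe c
    obtain ⟨v, hv, hs⟩ := exists_mem_toricChamber s.2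
    exact ⟨⟨v, hv⟩, s, rfl, hs⟩
  choose v s hsc hsv using h
  refine Finite.of_injective v fun c c' hcc' => ?_
  rw [← hsc c, ← hsc c', ← mem_toricChamber_iff (hsv c'), ← hcc']
  exact hsv c

open Classical in
lemma hasEuler_compactComplement_eq_card
    (hspan : Submodule.span ℝ (range (fun i (j : Fin n) => (X i j : ℝ))) = ⊤) :
    HasEuler n (fun t => if t ∈ compactComplement X then 1 else 0)
      (Nat.card (ConnectedComponents (compactComplement X)) * (-1) ^ n) := by
  have := finite_connectedComponents X
  have := Fintype.ofFinite (ConnectedComponents (compactComplement X))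
  have h : ∀ c : ConnectedComponents (compactComplement X), ∃ v : Fin N → ℤ,
      ∃ s : compactComplement X,
      (s : ConnectedComponents (compactComplement X)) = c ∧ s.1 ∈ toricChamber X v := by
    intro c
    obtain ⟨s, rfl⟩ := ConnectedComponents.surjective_coe c
    obtain ⟨v, -, hs⟩ := exists_mem_toricChamber s.2
    exact ⟨v, s, rfl, hs⟩
  choose v s hsc hsv using h
  have key : (fun t => if t ∈ compactComplement X then 1 else 0 : (Fin n → AddCircle (1 : ℝ)) → ℤ) =
      fun t => ∑ c, fiberCount (chamber X (v c)) t := by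
    funext t
    simp only [fiberCount_chamber hspan]
    split_ifs with ht
    · rw [Finset.sum_eq_single (ConnectedComponents.mk ⟨t, ht⟩)]
      · rw [if_pos ((mem_toricChamber_iff (hsv _) (t := ⟨t, ht⟩)).2 (hsc _).symm)]
      · intro c _ hc
        refine if_neg fun h => hc ?_
        rw [mem_toricChamber_iff (hsv c) (t := ⟨t, ht⟩)] at h
        rw [← hsc c]
        exact h.symm
      · simp
    · symm
      exact Finset.sum_eq_zero fun c _ => if_neg fun h => ht (toricChamber_subset h)
  rw [key, Nat.card_eq_fintype_card, ← nsmul_eq_mul, ← Finset.card_univ, ← Finset.sum_const]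
  refine HasEuler.sum _ fun c _ => hasEuler_fiberCount convex_chamber isOpen_chamber
    (isBounded_chamber hspan) ?_
  obtain ⟨x, hx, -⟩ := hsv c
  exact ⟨x, hx⟩

end chamber

end ToricArrangement

/-- The number of connected components of the complement of the toric arrangement in the
compact torus `(ℝ/ℤ)^n` equals `M_X(1,0)`. -/
theorem stmt10 {n N : ℕ} (X : Fin N → Fin n → ℤ)
    (hnz : ∀ k : Fin N, X k ≠ 0)
    (hspan : Submodule.span ℝ (Set.range (fun i (j : Fin n) => (X i j : ℝ))) = ⊤) :
    (Nat.card (ConnectedComponents (compactComplement X)) : ℝ) = Mpoly X 1 0 := by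
  have h := (ToricArrangement.hasEuler_compactComplement_eq_card hspan).unique
    (ToricArrangement.hasEuler_compactComplement X)
  have hr : rnk X Finset.univ = n := by
    rw [ToricArrangement.rnk_eq_iff, Finset.coe_univ, Set.image_univ]
    exact hspan
  have h' : (Nat.card (ConnectedComponents (compactComplement X)) : ℝ) * (-1) ^ n =
      ∑ A : Finset (Fin N), (-1) ^ A.card * (Nat.card (ToricArrangement.zeroLocus X A) : ℝ) := by
    exact_mod_cast h
  rw [ToricArrangement.Mpoly_one_zero hr, ← h', mul_comm, mul_assoc, ← mul_pow]
  simp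
end
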